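/- arXiv:2103.02960 — 2 statements merged into one kernel-verified Lean document; each statement's English description precedes it below -/
import Mathlib

section
/- Let S be a finite family of n curves in the plane, each colored red or blue, such that every pair of curves in S intersects in at most one point and no two curves of the same color intersect. Then the number of unordered pairs of curves of S that touch each other is at most 11n. -/
open Set

/-- Points of the plane. -/
abbrev Pt : Type := ℝ × ℝ

/-- A curve: the image of an injective continuous map from `[0,1]` to the plane. -/
def IsCurve (s : Set Pt) : Prop :=
  ∃ f : ℝ → Pt, ContinuousOn f (Set.Icc 0 1) ∧ Set.InjOn f (Set.Icc 0 1) ∧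
    s = f '' Set.Icc 0 1

/-- A simple polygonal chain consisting of finitely many line segments. -/
def IsPolygonalCurve (s : Set Pt) : Prop :=
  IsCurve s ∧ ∃ P : Finset (Pt × Pt), s = ⋃ p ∈ P, segment ℝ p.1 p.2

/-- `p` is an endpoint of the curve `s`. -/
def IsEndpoint (s : Set Pt) (p : Pt) : Prop :=
  ∃ f : ℝ → Pt, ContinuousOn f (Set.Icc 0 1) ∧ Set.InjOn f (Set.Icc 0 1) ∧
    s = f '' Set.Icc 0 1 ∧ (p = f 0 ∨ p = f 1)

/-- The open (Euclidean) disk of radius `r` centered at `p`. -/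
def Disk (p : Pt) (r : ℝ) : Set Pt :=
  {q : Pt | (q.1 - p.1) ^ 2 + (q.2 - p.2) ^ 2 < r ^ 2}

/-- Curves `s` and `t` touch at a point `p`: `p` is their unique common point, `p` is not
an endpoint of either curve, and there is an open disk `D` centered at `p` containing no
endpoint of either curve such that `(s ∩ D) \ {p}` lies in a single connected component
of `D \ t`. -/
def Touches (s t : Set Pt) : Prop :=
  ∃ p : Pt, s ∩ t = {p} ∧ ¬ IsEndpoint s p ∧ ¬ IsEndpoint t p ∧
    ∃ r : ℝ, 0 < r ∧
      (∀ q : Pt, (IsEndpoint s q ∨ IsEndpoint t q) → q ∉ Disk p r) ∧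
      ∃ x : Pt, (s ∩ Disk p r) \ {p} ⊆ connectedComponentIn (Disk p r \ t) x

namespace TouchingCurves

open Filter Topology

/-- The signed angle under which the directed segment from `u` to `v` is seen from `q`. -/
noncomputable def ang (u v q : ℂ) : ℝ := Complex.arg ((v - q) / (u - q))

/-- The point at distance `ρ` from `v` in direction `θ`. -/
noncomputable def polar (v : ℂ) (ρ θ : ℝ) : ℂ := v + ρ * Complex.exp (θ * Complex.I)

/-- `q` lies strictly to the left of the directed line from `u` to `v`. -/
def LeftOf (u v q : ℂ) : Prop := 0 < ((q - u) * (starRingEnd ℂ) (v - u)).im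

/-- The counterclockwise angle from the direction of `z` to that of `w`, in `(0, 2π]`. -/
noncomputable def ccw (z w : ℂ) : ℝ :=
  if z.arg < w.arg then w.arg - z.arg else w.arg - z.arg + 2 * Real.pi

lemma ccw_pos (z w : ℂ) : 0 < ccw z w := by
  unfold ccw
  have := Complex.neg_pi_lt_arg w
  have := Complex.arg_le_pi z
  split_ifs <;> linarith

lemma ccw_le (z w : ℂ) : ccw z w ≤ 2 * Real.pi := by
  unfold ccw
  have := Complex.neg_pi_lt_arg z
  have := Complex.arg_le_pi w
  split_ifs <;> linarith

lemma ccw_lt {z w : ℂ} (h : z.arg ≠ w.arg) : ccw z w < 2 * Real.pi := by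
  unfold ccw
  have := Complex.neg_pi_lt_arg z
  have := Complex.arg_le_pi w
  split_ifs with h1
  · linarith
  · have := lt_of_le_of_ne (not_lt.1 h1) (Ne.symm h)
    linarith

lemma ccw_of_arg_eq {z w : ℂ} (h : z.arg = w.arg) : ccw z w = 2 * Real.pi := by
  simp [ccw, h]

lemma coe_ccw (z w : ℂ) : (ccw z w : Real.Angle) = w.arg - z.arg := by
  unfold ccw
  split_ifs <;> simp

lemma ccw_eq_of_coe {z w : ℂ} {x : ℝ} (h0 : 0 < x) (h1 : x ≤ 2 * Real.pi)
    (h : (x : Real.Angle) = w.arg - z.arg) : ccw z w = x := by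
  rw [← coe_ccw, Real.Angle.angle_eq_iff_two_pi_dvd_sub] at h
  obtain ⟨k, hk⟩ := h
  have := ccw_pos z w
  have := ccw_le z w
  have hp := Real.pi_pos
  have h2 : (k : ℝ) < 1 := by
    by_contra hc
    push Not at hc
    nlinarith
  have h3 : (-1 : ℝ) < k := by
    by_contra hc
    push Not at hc
    nlinarith
  have : k = 0 := by
    have : k < 1 := by exact_mod_cast h2
    have : -1 < k := by exact_mod_cast h3
    omega
  subst this
  simp at hk
  linarith

lemma eventually_eq_of_angle_eq {α : Type*} {l : Filter α} {h : α → ℝ} {c : ℝ}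
    (ht : Tendsto h l (𝓝 c)) (he : ∀ᶠ q in l, (h q : Real.Angle) = c) : ∀ᶠ q in l, h q = c := by
  have hb : ∀ᶠ q in l, dist (h q) c < 1 := ht (Metric.ball_mem_nhds c one_pos)
  filter_upwards [hb, he] with q hq hq'
  rw [Real.Angle.angle_eq_iff_two_pi_dvd_sub] at hq'
  obtain ⟨k, hk⟩ := hq'
  rw [Real.dist_eq, hk, abs_mul, abs_of_pos Real.two_pi_pos] at hq
  have : |(k : ℝ)| < 1 := by
    by_contra hc
    push Not at hc
    nlinarith [Real.pi_gt_three]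
  have : k = 0 := by
    rw [← Int.cast_abs] at this
    have h1 : |k| < 1 := by exact_mod_cast this
    exact Int.abs_lt_one_iff.1 h1
  subst this
  simp at hk
  linarith

lemma coe_ang {u v q : ℂ} (hu : q ≠ u) (hv : q ≠ v) :
    (ang u v q : Real.Angle) = (v - q).arg - (u - q).arg :=
  Complex.arg_div_coe_angle (sub_ne_zero.2 hv.symm) (sub_ne_zero.2 hu.symm)

/-- The change of the direction of `x`, when the viewpoint moves from `q₀` to `q`. -/
noncomputable def turn (x q₀ q : ℂ) : ℝ := Complex.arg ((x - q) / (x - q₀))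

lemma coe_turn {x q₀ q : ℂ} (h₀ : q₀ ≠ x) (h : q ≠ x) :
    (turn x q₀ q : Real.Angle) = (x - q).arg - (x - q₀).arg :=
  Complex.arg_div_coe_angle (sub_ne_zero.2 h.symm) (sub_ne_zero.2 h₀.symm)

lemma continuousAt_turn {x q₀ q : ℂ} (h : 0 < ((x - q) / (x - q₀)).re) :
    ContinuousAt (turn x q₀) q := by
  unfold turn
  refine ContinuousAt.comp (f := fun q => (x - q) / (x - q₀)) (Complex.continuousAt_arg ?_) ?_
  · exact Complex.mem_slitPlane_iff.2 (Or.inl h)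
  · fun_prop

lemma tendsto_turn {x q₀ : ℂ} (h : q₀ ≠ x) : Tendsto (turn x q₀) (𝓝 q₀) (𝓝 0) := by
  have hx : x - q₀ ≠ 0 := sub_ne_zero.2 h.symm
  have h1 := continuousAt_turn (x := x) (q₀ := q₀) (q := q₀) (by simp [div_self hx])
  simpa [ContinuousAt, turn, div_self hx] using h1

lemma ang_eventually_eq {u v q₀ : ℂ} {l : Filter ℂ} {c : ℝ} (hl : l ≤ 𝓝 q₀) (hu : q₀ ≠ u)
    (hv : q₀ ≠ v) (ht : Tendsto (ang u v) l (𝓝 c)) (hc : (c : Real.Angle) = ang u v q₀) :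
    ∀ᶠ q in l, ang u v q = c + (turn v q₀ q - turn u q₀ q) := by
  have h1 : Tendsto (fun q => ang u v q - (turn v q₀ q - turn u q₀ q)) l (𝓝 c) := by
    have := ht.sub (((tendsto_turn hv).mono_left hl).sub ((tendsto_turn hu).mono_left hl))
    simpa using this
  have h2 : ∀ᶠ q in l, q ≠ u := hl (isOpen_ne.mem_nhds hu)
  have h3 : ∀ᶠ q in l, q ≠ v := hl (isOpen_ne.mem_nhds hv)
  have h4 := eventually_eq_of_angle_eq h1 (by
    filter_upwards [h2, h3] with q hqu hqv
    rw [hc]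
    rw [Real.Angle.coe_sub, Real.Angle.coe_sub, coe_ang hqu hqv, coe_ang hu hv, coe_turn hu hqu,
      coe_turn hv hqv]
    abel)
  filter_upwards [h4] with q hq
  linarith

lemma continuousAt_ang {u v q₀ : ℂ} (h : q₀ ∉ segment ℝ u v) : ContinuousAt (ang u v) q₀ := by
  have hu : u - q₀ ≠ 0 := sub_ne_zero.2 fun h' => h (h' ▸ left_mem_segment ℝ _ _)
  unfold ang
  refine ContinuousAt.comp (f := fun q => (v - q) / (u - q)) (Complex.continuousAt_arg ?_) ?_
  · by_contra hs
    rw [Complex.mem_slitPlane_iff] at hs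
    push Not at hs
    obtain ⟨h1, h2⟩ := hs
    set z := (v - q₀) / (u - q₀) with hz
    have hz' : z = (z.re : ℂ) := Complex.ext (by simp) (by simp [h2])
    have h3 : v - q₀ = z.re * (u - q₀) := by
      rw [← hz', hz, div_mul_cancel₀ _ hu]
    refine h ⟨-z.re / (1 - z.re), 1 / (1 - z.re), div_nonneg (by linarith) (by linarith),
      div_nonneg (by linarith) (by linarith), ?_, ?_⟩
    · rw [← add_div, div_eq_one_iff_eq (by linarith)]; ring
    · have h4 : ((1 - z.re : ℝ) : ℂ) ≠ 0 := by exact_mod_cast (by linarith : (1 - z.re) ≠ 0)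
      push_cast at h4
      simp only [Complex.real_smul]
      push_cast
      field_simp
      linear_combination h3
  · exact ContinuousAt.div (by fun_prop) (by fun_prop) hu

lemma exists_neg_ratio {u v q : ℂ} (huv : u ≠ v) (h : q ∈ openSegment ℝ u v) :
    ∃ x : ℝ, x < 0 ∧ (v - q) / (u - q) = x := by
  obtain ⟨a, b, ha, hb, hab, rfl⟩ := h
  refine ⟨-a / b, div_neg_of_neg_of_pos (by linarith) hb, ?_⟩
  have hb' : (b : ℂ) ≠ 0 := by exact_mod_cast hb.ne'
  have hab' : (a : ℂ) = 1 - b := by rw [eq_sub_of_add_eq hab]; push_cast; rfl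
  have h1 : u - (a • u + b • v) = b * (u - v) := by
    simp only [Complex.real_smul, hab']; ring
  have h2 : v - (a • u + b • v) = -a * (u - v) := by
    simp only [Complex.real_smul, hab']; ring
  rw [h1, h2]
  have := sub_ne_zero.2 huv
  push_cast
  field_simp

lemma ang_of_mem_openSegment {u v q : ℂ} (huv : u ≠ v) (h : q ∈ openSegment ℝ u v) :
    ang u v q = Real.pi := by
  obtain ⟨x, hx, h⟩ := exists_neg_ratio huv h
  rw [ang, h, Complex.arg_ofReal_of_neg hx]

lemma ne_of_mem_openSegment {u v q : ℂ} (huv : u ≠ v) (h : q ∈ openSegment ℝ u v) :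
    q ≠ u ∧ q ≠ v := by
  constructor
  · rintro rfl
    exact huv (left_mem_openSegment_iff.1 h)
  · rintro rfl
    exact huv (right_mem_openSegment_iff.1 h)

lemma ratio_im (u v q : ℂ) : ((v - q) / (u - q)).im =
    ((q - u) * (starRingEnd ℂ) (v - u)).im / Complex.normSq (u - q) := by
  rw [Complex.div_im]
  simp
  ring

lemma tendsto_ratio {u v q₀ : ℂ} (hu : q₀ ≠ u) (l : Filter ℂ) (hl : l ≤ 𝓝 q₀) :
    Tendsto (fun q => (v - q) / (u - q)) l (𝓝 ((v - q₀) / (u - q₀))) :=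
  Tendsto.mono_left (ContinuousAt.div (by fun_prop) (by fun_prop) (sub_ne_zero.2 hu.symm)) hl

lemma tendsto_ang_left {u v q₀ : ℂ} (huv : u ≠ v) (h : q₀ ∈ openSegment ℝ u v) :
    Tendsto (ang u v) (𝓝[{q | LeftOf u v q}] q₀) (𝓝 Real.pi) := by
  obtain ⟨x, hx, hq⟩ := exists_neg_ratio huv h
  have hu := (ne_of_mem_openSegment huv h).1
  have h1 := Complex.continuousWithinAt_arg_of_re_neg_of_im_zero (z := (x : ℂ)) (by simpa) (by simp)
  rw [ContinuousWithinAt, Complex.arg_ofReal_of_neg hx] at h1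
  refine h1.comp (tendsto_nhdsWithin_iff.2 ⟨?_, ?_⟩)
  · rw [← hq]
    exact tendsto_ratio hu _ nhdsWithin_le_nhds
  · filter_upwards [self_mem_nhdsWithin] with q hqq
    simp only [ratio_im]
    exact div_nonneg (le_of_lt hqq) (Complex.normSq_nonneg _)

lemma tendsto_ang_right {u v q₀ : ℂ} (huv : u ≠ v) (h : q₀ ∈ openSegment ℝ u v) :
    Tendsto (ang u v) (𝓝[{q | LeftOf v u q}] q₀) (𝓝 (-Real.pi)) := by
  obtain ⟨x, hx, hq⟩ := exists_neg_ratio huv h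
  have hu := (ne_of_mem_openSegment huv h).1
  have h1 := Complex.tendsto_arg_nhdsWithin_im_neg_of_re_neg_of_im_zero (z := (x : ℂ))
    (by simpa) (by simp)
  refine h1.comp (tendsto_nhdsWithin_iff.2 ⟨?_, ?_⟩)
  · rw [← hq]
    exact tendsto_ratio hu _ nhdsWithin_le_nhds
  · have h2 : ∀ᶠ q in 𝓝[{q | LeftOf v u q}] q₀, q ≠ u :=
      nhdsWithin_le_nhds (isOpen_ne.mem_nhds hu)
    filter_upwards [self_mem_nhdsWithin, h2] with q hqq hqu
    simp only [ratio_im]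
    refine div_neg_of_neg_of_pos ?_ (Complex.normSq_pos.2 (sub_ne_zero.2 hqu.symm))
    simp only [LeftOf] at hqq
    simp at hqq ⊢
    linarith

lemma polar_arg (v b : ℂ) (ρ : ℝ) (hb : b ≠ v) :
    polar v ρ (b - v).arg = v + ((ρ / ‖b - v‖ : ℝ) : ℂ) * (b - v) := by
  have h1 := Complex.norm_mul_exp_arg_mul_I (b - v)
  have h2 : (‖b - v‖ : ℂ) ≠ 0 := by exact_mod_cast norm_ne_zero_iff.2 (sub_ne_zero.2 hb)
  unfold polar
  push_cast
  rw [div_mul_eq_mul_div, add_right_inj, eq_div_iff h2]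
  linear_combination (ρ : ℂ) * h1

lemma polar_mem_openSegment {v b : ℂ} {ρ : ℝ} (hρ : 0 < ρ) (h : ρ < ‖b - v‖) :
    polar v ρ (b - v).arg ∈ openSegment ℝ v b := by
  have hb : b ≠ v := by
    rintro rfl
    simp at h
    linarith
  have h2 : 0 < ‖b - v‖ := hρ.trans h
  refine ⟨1 - ρ / ‖b - v‖, ρ / ‖b - v‖, ?_, div_pos hρ h2, by ring, ?_⟩
  · rw [sub_pos, div_lt_one h2]; exact h
  · rw [polar_arg v b ρ hb]
    simp only [Complex.real_smul]
    push_cast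
    ring

lemma polar_congr {v : ℂ} {ρ θ θ' : ℝ} (h : (θ : Real.Angle) = θ') :
    polar v ρ θ = polar v ρ θ' := by
  obtain ⟨k, hk⟩ := Real.Angle.angle_eq_iff_two_pi_dvd_sub.1 h
  have : θ = θ' + 2 * Real.pi * k := by linarith
  unfold polar
  have h2 : Complex.exp (θ * Complex.I) = Complex.exp (θ' * Complex.I) := by
    rw [Complex.exp_eq_exp_iff_exists_int]
    refine ⟨k, ?_⟩
    rw [this]
    push_cast
    ring
  rw [h2]

lemma arg_polar {ρ θ : ℝ} (hρ : 0 < ρ) (v : ℂ) :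
    ((polar v ρ θ - v).arg : Real.Angle) = θ := by
  have := Complex.arg_mul_cos_add_sin_mul_I_coe_angle hρ (θ : Real.Angle)
  rw [Real.Angle.cos_coe, Real.Angle.sin_coe] at this
  rw [← this]
  unfold polar
  rw [add_sub_cancel_left, Complex.exp_mul_I]
  push_cast
  rfl

lemma angle_eq_of_polar_mem_segment {v x : ℂ} {ρ θ : ℝ} (hρ : 0 < ρ)
    (h : polar v ρ θ ∈ segment ℝ v x) : (θ : Real.Angle) = (x - v).arg := by
  obtain ⟨a, b, ha, hb, hab, h⟩ := h
  have h1 : polar v ρ θ - v = b * (x - v) := by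
    rw [← h, show a = 1 - b by linarith]
    simp only [Complex.real_smul]
    push_cast
    ring
  have hb0 : 0 < b := by
    refine lt_of_le_of_ne hb ?_
    rintro rfl
    simp [polar] at h1
    exact hρ.ne' h1
  rw [← arg_polar hρ v, h1, Complex.arg_real_mul _ hb0]

lemma continuous_polar (v : ℂ) : Continuous fun x : ℝ × ℝ => polar v x.1 x.2 := by
  unfold polar
  fun_prop

lemma dist_polar {v : ℂ} {ρ θ : ℝ} (hρ : 0 ≤ ρ) : dist (polar v ρ θ) v = ρ := by
  simp [polar, dist_eq_norm, Complex.norm_exp_ofReal_mul_I, abs_of_nonneg hρ]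

lemma eq_polar {v b : ℂ} : b = polar v ‖b - v‖ (b - v).arg := by
  unfold polar
  rw [Complex.norm_mul_exp_arg_mul_I]
  ring

lemma im_polar_mul_conj (v w : ℂ) (r s a b : ℝ) :
    ((polar v r a - v) * (starRingEnd ℂ) (polar w s b - w)).im = r * s * Real.sin (a - b) := by
  simp only [polar, add_sub_cancel_left, Complex.exp_mul_I]
  simp [Real.sin_sub, Complex.cos_ofReal_re, Complex.sin_ofReal_re, Complex.cos_ofReal_im,
    Complex.sin_ofReal_im]
  ring

lemma leftOf_tail_polar {v b : ℂ} {ρ θ : ℝ} (hb : b ≠ v) (hρ : 0 < ρ)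
    (h : 0 < Real.sin (θ - (b - v).arg)) : LeftOf v b (polar v ρ θ) := by
  unfold LeftOf
  conv in b - v => rw [eq_polar (v := v) (b := b)]
  rw [im_polar_mul_conj]
  have : 0 < ‖b - v‖ := norm_pos_iff.2 (sub_ne_zero.2 hb)
  positivity

lemma leftOf_head_polar {v a : ℂ} {ρ θ : ℝ} (ha : a ≠ v) (hρ : 0 < ρ)
    (h : 0 < Real.sin ((a - v).arg - θ)) : LeftOf a v (polar v ρ θ) := by
  have h1 := im_polar_mul_conj v v ‖a - v‖ ρ (a - v).arg θ
  rw [← eq_polar] at h1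
  have : 0 < ‖a - v‖ := norm_pos_iff.2 (sub_ne_zero.2 ha)
  have h2 : 0 < ‖a - v‖ * ρ * Real.sin ((a - v).arg - θ) := by positivity
  rw [← h1] at h2
  unfold LeftOf
  simp at h2 ⊢
  linarith

lemma tendsto_polar_left_tail {v b : ℂ} {ρ : ℝ} (hb : b ≠ v) (hρ : 0 < ρ) :
    Tendsto (fun δ => polar v ρ ((b - v).arg + δ)) (𝓝[>] 0)
      (𝓝[{q | LeftOf v b q}] (polar v ρ (b - v).arg)) := by
  refine tendsto_nhdsWithin_iff.2 ⟨?_, ?_⟩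
  · have h1 : Continuous fun δ : ℝ => polar v ρ ((b - v).arg + δ) := by
      unfold polar
      fun_prop
    have := h1.tendsto 0
    simp only [add_zero] at this
    exact this.mono_left nhdsWithin_le_nhds
  · filter_upwards [Ioo_mem_nhdsGT Real.pi_pos] with δ hδ
    apply leftOf_tail_polar hb hρ
    rw [add_sub_cancel_left]
    exact Real.sin_pos_of_mem_Ioo hδ

lemma tendsto_polar_left_head {v a : ℂ} {ρ γ : ℝ} (ha : a ≠ v) (hρ : 0 < ρ)
    (hγ : (γ : Real.Angle) = (a - v).arg) :
    Tendsto (fun δ => polar v ρ (γ - δ)) (𝓝[>] 0)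
      (𝓝[{q | LeftOf a v q}] (polar v ρ (a - v).arg)) := by
  rw [show (fun δ => polar v ρ (γ - δ)) = fun δ => polar v ρ ((a - v).arg - δ) from
    funext fun δ => polar_congr (by rw [Real.Angle.coe_sub, Real.Angle.coe_sub, hγ])]
  refine tendsto_nhdsWithin_iff.2 ⟨?_, ?_⟩
  · have h1 : Continuous fun δ : ℝ => polar v ρ ((a - v).arg - δ) := by
      unfold polar
      fun_prop
    have := h1.tendsto 0
    simp only [sub_zero] at this
    exact this.mono_left nhdsWithin_le_nhds
  · filter_upwards [Ioo_mem_nhdsGT Real.pi_pos] with δ hδ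
    apply leftOf_head_polar ha hρ
    rw [sub_sub_cancel]
    exact Real.sin_pos_of_mem_Ioo hδ

/-- A locally constant real function on a preconnected set is constant. -/
lemma eq_of_isPreconnected {α : Type*} [TopologicalSpace α] {s : Set α} (hs : IsPreconnected s)
    {g : α → ℝ} (hg : ∀ x ∈ s, ∀ᶠ y in 𝓝[s] x, g y = g x) {x y : α} (hx : x ∈ s) (hy : y ∈ s) :
    g x = g y :=
  hs.induction₂ (fun x y => g x = g y) (fun x hx => (hg x hx).mono fun _ h => h.symm)
    (fun _ _ _ _ _ _ h1 h2 => h1.trans h2) (fun _ _ _ _ h => h.symm) hx hy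

lemma eq_of_sector {g : ℂ → ℝ} {v : ℂ} {ε β γ : ℝ}
    (hg : ∀ ρ ∈ Ioo 0 ε, ∀ θ ∈ Ioo β γ, ∀ᶠ q in 𝓝 (polar v ρ θ), g q = g (polar v ρ θ))
    {ρ θ ρ' θ' : ℝ} (hρ : ρ ∈ Ioo 0 ε) (hθ : θ ∈ Ioo β γ) (hρ' : ρ' ∈ Ioo 0 ε)
    (hθ' : θ' ∈ Ioo β γ) : g (polar v ρ θ) = g (polar v ρ' θ') := by
  have hs : IsPreconnected (Ioo (0 : ℝ) ε ×ˢ Ioo β γ) := isPreconnected_Ioo.prod isPreconnected_Ioo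
  refine eq_of_isPreconnected (g := fun x : ℝ × ℝ => g (polar v x.1 x.2)) hs ?_
    (x := (ρ, θ)) (y := (ρ', θ')) ⟨hρ, hθ⟩ ⟨hρ', hθ'⟩
  rintro x ⟨hx1, hx2⟩
  exact nhdsWithin_le_nhds (((continuous_polar v).tendsto x).eventually (hg _ hx1 _ hx2))

/-- A plane straight-line graph, given by its directed edges. -/
structure LineGraph (E : Type) where
  src : E → ℂ
  tgt : E → ℂ
  src_ne_tgt : ∀ e, src e ≠ tgt e
  src_notMem : ∀ e e', src e' ∉ openSegment ℝ (src e) (tgt e)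
  tgt_notMem : ∀ e e', tgt e' ∉ openSegment ℝ (src e) (tgt e)
  disjoint : ∀ e e', e ≠ e' →
    Disjoint (openSegment ℝ (src e) (tgt e)) (openSegment ℝ (src e') (tgt e'))

namespace LineGraph

variable {E : Type} (G : LineGraph E)

/-- The tail of a dart, that is, of an edge with a choice of direction. -/
def tl : E × Bool → ℂ
  | (e, true) => G.src e
  | (e, false) => G.tgt e

/-- The head of a dart. -/
def hd : E × Bool → ℂ
  | (e, true) => G.tgt e
  | (e, false) => G.src e

/-- The reversal of a dart. -/
def rev (d : E × Bool) : E × Bool := (d.1, !d.2)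

/-- The point set covered by the graph. -/
def carrier : Set ℂ := ⋃ e, segment ℝ (G.src e) (G.tgt e)

@[simp] lemma tl_rev (d : E × Bool) : G.tl (rev d) = G.hd d := by
  rcases d with ⟨e, _ | _⟩ <;> rfl

@[simp] lemma hd_rev (d : E × Bool) : G.hd (rev d) = G.tl d := by
  rcases d with ⟨e, _ | _⟩ <;> rfl

lemma hd_ne_tl (d : E × Bool) : G.hd d ≠ G.tl d := by
  rcases d with ⟨e, _ | _⟩
  · exact G.src_ne_tgt e
  · exact (G.src_ne_tgt e).symm

lemma openSegment_dart (d : E × Bool) :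
    openSegment ℝ (G.tl d) (G.hd d) = openSegment ℝ (G.src d.1) (G.tgt d.1) := by
  rcases d with ⟨e, _ | _⟩
  · exact openSegment_symm ..
  · rfl

lemma segment_dart (d : E × Bool) :
    segment ℝ (G.tl d) (G.hd d) = segment ℝ (G.src d.1) (G.tgt d.1) := by
  rcases d with ⟨e, _ | _⟩
  · exact segment_symm ..
  · rfl

lemma tl_notMem (d : E × Bool) (e : E) : G.tl d ∉ openSegment ℝ (G.src e) (G.tgt e) := by
  rcases d with ⟨e, _ | _⟩
  · exact G.tgt_notMem _ _
  · exact G.src_notMem _ _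

lemma notMem_segment {e e' : E} (h : e' ≠ e) {q : ℂ}
    (hq : q ∈ openSegment ℝ (G.src e) (G.tgt e)) : q ∉ segment ℝ (G.src e') (G.tgt e') := by
  rw [← insert_endpoints_openSegment]
  rintro (rfl | rfl | h')
  · exact G.src_notMem _ _ hq
  · exact G.tgt_notMem _ _ hq
  · exact (G.disjoint _ _ h).le_bot ⟨h', hq⟩

lemma exists_dart_of_mem_segment {e : E} {d : E × Bool}
    (h : G.tl d ∈ segment ℝ (G.src e) (G.tgt e)) : ∃ b, G.tl (e, b) = G.tl d := by
  rw [← insert_endpoints_openSegment] at h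
  rcases h with h | h | h
  · exact ⟨true, h.symm⟩
  · exact ⟨false, h.symm⟩
  · exact absurd h (G.tl_notMem d e)

lemma eq_of_arg_eq {x y : E × Bool} (h : G.tl x = G.tl y)
    (ha : (G.hd x - G.tl x).arg = (G.hd y - G.tl y).arg) : x = y := by
  have hx : 0 < ‖G.hd x - G.tl x‖ := norm_pos_iff.2 (sub_ne_zero.2 (G.hd_ne_tl x))
  have hy : 0 < ‖G.hd y - G.tl y‖ := norm_pos_iff.2 (sub_ne_zero.2 (G.hd_ne_tl y))
  obtain ⟨ρ, hρ, hρ'⟩ := exists_between (lt_min hx hy)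
  have h1 := polar_mem_openSegment hρ (hρ'.trans_le (min_le_left _ _))
  have h2 := polar_mem_openSegment hρ (hρ'.trans_le (min_le_right _ _))
  rw [← ha, ← h] at h2
  have h3 : x.1 = y.1 := by
    by_contra hne
    rw [h] at h1 h2
    rw [← h, openSegment_dart] at h1
    rw [openSegment_dart] at h2
    rw [← h] at h2
    exact (G.disjoint _ _ hne).le_bot ⟨h1, h2⟩
  rcases x with ⟨e, b⟩
  rcases y with ⟨e', b'⟩
  obtain rfl : e = e' := h3
  have hne := G.src_ne_tgt e
  rcases b <;> rcases b' <;> simp_all [tl]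

lemma ne_src_of_notMem {q : ℂ} (h : q ∉ G.carrier) (e : E) : q ≠ G.src e := by
  rintro rfl
  exact h (mem_iUnion.2 ⟨e, left_mem_segment ℝ _ _⟩)

lemma ne_tgt_of_notMem {q : ℂ} (h : q ∉ G.carrier) (e : E) : q ≠ G.tgt e := by
  rintro rfl
  exact h (mem_iUnion.2 ⟨e, right_mem_segment ℝ _ _⟩)

lemma tl_ne_of_mem_openSegment (d : E × Bool) {e : E} {q : ℂ}
    (hq : q ∈ openSegment ℝ (G.src e) (G.tgt e)) : q ≠ G.tl d := by
  rintro rfl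
  exact G.tl_notMem d e hq

variable [Fintype E]

/-- The total angle under which a weighted sum of edges is seen from `q`. -/
noncomputable def wind (Z : E → ℝ) (q : ℂ) : ℝ := ∑ e, Z e * ang (G.src e) (G.tgt e) q

/-- `Z` is a circulation: it preserves every potential. -/
def IsCycle (Z : E → ℝ) : Prop := ∀ F : ℂ → ℝ, ∑ e, Z e * (F (G.tgt e) - F (G.src e)) = 0

lemma wind_eventually {Z : E → ℝ} {q₀ : ℂ} {l : Filter ℂ} (hl : l ≤ 𝓝 q₀) (c : E → ℝ)
    (hs : ∀ e, q₀ ≠ G.src e) (ht : ∀ e, q₀ ≠ G.tgt e)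
    (hc : ∀ e, Tendsto (ang (G.src e) (G.tgt e)) l (𝓝 (c e)))
    (hc' : ∀ e, (c e : Real.Angle) = ang (G.src e) (G.tgt e) q₀) :
    ∀ᶠ q in l, G.wind Z q = ∑ e, Z e * c e +
      ∑ e, Z e * (turn (G.tgt e) q₀ q - turn (G.src e) q₀ q) := by
  have h1 : ∀ᶠ q in l, ∀ e, ang (G.src e) (G.tgt e) q =
      c e + (turn (G.tgt e) q₀ q - turn (G.src e) q₀ q) :=
    eventually_all.2 fun e => ang_eventually_eq hl (hs e) (ht e) (hc e) (hc' e)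
  filter_upwards [h1] with q hq
  rw [wind, ← Finset.sum_add_distrib]
  exact Finset.sum_congr rfl fun e _ => by rw [hq e]; ring

lemma wind_eventually_of_notMem (Z : E → ℝ) {q₀ : ℂ} (h : q₀ ∉ G.carrier) :
    ∀ᶠ q in 𝓝 q₀, G.wind Z q = G.wind Z q₀ +
      ∑ e, Z e * (turn (G.tgt e) q₀ q - turn (G.src e) q₀ q) :=
  G.wind_eventually le_rfl _ (G.ne_src_of_notMem h) (G.ne_tgt_of_notMem h)
    (fun e => continuousAt_ang fun h' => h (mem_iUnion.2 ⟨e, h'⟩)) fun _ => rfl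

lemma IsCycle.wind_eventually_eq {Z : E → ℝ} (hZ : G.IsCycle Z) {q₀ : ℂ} (h : q₀ ∉ G.carrier) :
    ∀ᶠ q in 𝓝 q₀, G.wind Z q = G.wind Z q₀ := by
  filter_upwards [G.wind_eventually_of_notMem Z h] with q hq
  rw [hq, hZ fun x => turn x q₀ q, add_zero]

lemma IsCycle.wind_eq_of_mem_openSegment {Z : E → ℝ} (hZ : G.IsCycle Z) {e : E} {q q' : ℂ}
    (hq : q ∈ openSegment ℝ (G.src e) (G.tgt e)) (hq' : q' ∈ openSegment ℝ (G.src e) (G.tgt e)) :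
    G.wind Z q = G.wind Z q' := by
  refine eq_of_isPreconnected (convex_openSegment _ _).isPreconnected ?_ hq hq'
  intro q₀ hq₀
  have := G.wind_eventually (Z := Z) (q₀ := q₀)
    (nhdsWithin_le_nhds (s := openSegment ℝ (G.src e) (G.tgt e)))
    (fun e' => ang (G.src e') (G.tgt e') q₀)
    (fun e' => G.tl_ne_of_mem_openSegment (e', true) hq₀)
    (fun e' => G.tl_ne_of_mem_openSegment (e', false) hq₀) (fun e' => ?_) (fun _ => rfl)
  · filter_upwards [this] with q hq
    rw [hq, hZ fun x => turn x q₀ q, add_zero, wind]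
  · by_cases he : e' = e
    · subst he
      rw [ang_of_mem_openSegment (G.src_ne_tgt _) hq₀]
      refine tendsto_const_nhds.congr' ?_
      filter_upwards [self_mem_nhdsWithin] with q hq
      rw [ang_of_mem_openSegment (G.src_ne_tgt _) hq]
    · exact (continuousAt_ang (G.notMem_segment he hq₀)).mono_left nhdsWithin_le_nhds

open Classical in
lemma wind_eventually_left (Z : E → ℝ) (d : E × Bool) {q₀ : ℂ}
    (hq₀ : q₀ ∈ openSegment ℝ (G.src d.1) (G.tgt d.1)) :
    ∀ᶠ q in 𝓝[{q | LeftOf (G.tl d) (G.hd d) q}] q₀,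
      G.wind Z q = (G.wind Z q₀ - if d.2 then 0 else 2 * Real.pi * Z d.1) +
        ∑ e, Z e * (turn (G.tgt e) q₀ q - turn (G.src e) q₀ q) := by
  set x : ℝ := if d.2 then 0 else 2 * Real.pi with hx
  have hx' : (x : Real.Angle) = 0 := by
    rw [hx]
    split_ifs <;> simp
  have h1 := G.wind_eventually (Z := Z) (q₀ := q₀)
    (nhdsWithin_le_nhds (s := {q | LeftOf (G.tl d) (G.hd d) q}))
    (fun e' => ang (G.src e') (G.tgt e') q₀ - if e' = d.1 then x else 0)
    (fun e' => G.tl_ne_of_mem_openSegment (e', true) hq₀)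
    (fun e' => G.tl_ne_of_mem_openSegment (e', false) hq₀) (fun e' => ?_) (fun e' => ?_)
  · filter_upwards [h1] with q hq
    rw [hq, wind]
    simp only [mul_sub, Finset.sum_sub_distrib, mul_ite, mul_zero, Finset.sum_ite_eq',
      Finset.mem_univ, if_true]
    rw [hx]
    split_ifs <;> ring
  · by_cases he : e' = d.1
    · subst he
      rw [ang_of_mem_openSegment (G.src_ne_tgt _) hq₀, if_pos rfl]
      rcases d with ⟨e, _ | _⟩
      · have := tendsto_ang_right (G.src_ne_tgt e) hq₀
        rw [hx, if_neg (by simp), show Real.pi - 2 * Real.pi = -Real.pi by ring]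
        exact this
      · have := tendsto_ang_left (G.src_ne_tgt e) hq₀
        rw [hx, if_pos rfl, sub_zero]
        exact this
    · rw [if_neg he, sub_zero]
      exact (continuousAt_ang (G.notMem_segment he hq₀)).mono_left nhdsWithin_le_nhds
  · rw [Real.Angle.coe_sub]
    split_ifs <;> simp [hx']

/-- The value of `wind Z` immediately to the left of a dart, for a circulation `Z`. -/
noncomputable def leftVal (Z : E → ℝ) (d : E × Bool) : ℝ :=
  G.wind Z (midpoint ℝ (G.src d.1) (G.tgt d.1)) - if d.2 then 0 else 2 * Real.pi * Z d.1

lemma midpoint_mem_openSegment (a b : ℂ) : midpoint ℝ a b ∈ openSegment ℝ a b := by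
  refine ⟨1 / 2, 1 / 2, by norm_num, by norm_num, by norm_num, ?_⟩
  rw [midpoint_eq_smul_add, smul_add]
  norm_num

lemma IsCycle.wind_eventually_eq_leftVal {Z : E → ℝ} (hZ : G.IsCycle Z) (d : E × Bool) {q₀ : ℂ}
    (hq₀ : q₀ ∈ openSegment ℝ (G.src d.1) (G.tgt d.1)) :
    ∀ᶠ q in 𝓝[{q | LeftOf (G.tl d) (G.hd d) q}] q₀, G.wind Z q = G.leftVal Z d := by
  filter_upwards [G.wind_eventually_left Z d hq₀] with q hq
  rw [hq, hZ fun x => turn x q₀ q, add_zero, leftVal,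
    hZ.wind_eq_of_mem_openSegment G hq₀ (midpoint_mem_openSegment _ _)]

lemma exists_sector_notMem {v z : ℂ} {d₁ : E × Bool} (h₁ : G.tl d₁ = v)
    (hmin : ∀ x, G.tl x = v → ccw (G.hd d₁ - v) z ≤ ccw (G.hd x - v) z) :
    ∃ ε > 0, ∀ ρ ∈ Ioo 0 ε, ∀ θ ∈ Ioo (G.hd d₁ - v).arg ((G.hd d₁ - v).arg + ccw (G.hd d₁ - v) z),
      polar v ρ θ ∉ G.carrier := by
  have h2 : ∀ e, ∀ᶠ q in 𝓝 v, q ∈ segment ℝ (G.src e) (G.tgt e) →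
      v ∈ segment ℝ (G.src e) (G.tgt e) := by
    intro e
    by_cases hv : v ∈ segment ℝ (G.src e) (G.tgt e)
    · exact Eventually.of_forall fun _ _ => hv
    · have hcl : IsClosed (segment ℝ (G.src e) (G.tgt e)) := by
        rw [segment_eq_image]
        exact (isCompact_Icc.image (by fun_prop)).isClosed
      filter_upwards [hcl.isOpen_compl.mem_nhds hv] with q hq hq'
      exact absurd hq' hq
  obtain ⟨ε, hε, hb⟩ := Metric.eventually_nhds_iff_ball.1 (eventually_all.2 h2)
  refine ⟨ε, hε, fun ρ hρ θ hθ hmem => ?_⟩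
  obtain ⟨e, he⟩ := mem_iUnion.1 hmem
  have hv := hb _ (by rw [Metric.mem_ball, dist_polar hρ.1.le]; exact hρ.2) e he
  rw [← h₁] at hv
  obtain ⟨b, hx⟩ := G.exists_dart_of_mem_segment hv
  rw [h₁] at hx
  have h3 := G.segment_dart (e, b)
  rw [hx] at h3
  rw [← h3] at he
  have h4 := angle_eq_of_polar_mem_segment hρ.1 he
  have h5 := hmin _ hx
  have h6 : ccw (G.hd (e, b) - v) z = (G.hd d₁ - v).arg + ccw (G.hd d₁ - v) z - θ := by
    have := ccw_le (G.hd d₁ - v) z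
    apply ccw_eq_of_coe
    · linarith [hθ.2]
    · linarith [hθ.1]
    · rw [Real.Angle.coe_sub, Real.Angle.coe_add, coe_ccw, h4]
      abel
  linarith [hθ.1]

lemma IsCycle.leftVal_eq {Z : E → ℝ} (hZ : G.IsCycle Z) {d₁ d₂ : E × Bool}
    (h : G.tl d₁ = G.hd d₂)
    (hmin : ∀ x, G.tl x = G.hd d₂ →
      ccw (G.hd d₁ - G.hd d₂) (G.tl d₂ - G.hd d₂) ≤ ccw (G.hd x - G.hd d₂) (G.tl d₂ - G.hd d₂)) :
    G.leftVal Z d₁ = G.leftVal Z d₂ := by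
  obtain ⟨ε, hε, hfree⟩ := G.exists_sector_notMem h hmin
  set v := G.hd d₂ with hv
  have hb : G.hd d₁ ≠ v := h ▸ G.hd_ne_tl d₁
  have ha : G.tl d₂ ≠ v := (G.hd_ne_tl d₂).symm
  set α := ccw (G.hd d₁ - v) (G.tl d₂ - v)
  set β := (G.hd d₁ - v).arg
  have hα : 0 < α := ccw_pos _ _
  have hnb : 0 < ‖G.hd d₁ - v‖ := norm_pos_iff.2 (sub_ne_zero.2 hb)
  have hna : 0 < ‖G.tl d₂ - v‖ := norm_pos_iff.2 (sub_ne_zero.2 ha)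
  obtain ⟨ρ, hρ, hρ'⟩ := exists_between (lt_min (lt_min hnb hna) hε)
  have hρε := hρ'.trans_le (min_le_right _ _)
  have hρb := (hρ'.trans_le (min_le_left _ _)).trans_le (min_le_left _ _)
  have hρa := (hρ'.trans_le (min_le_left _ _)).trans_le (min_le_right _ _)
  have hm1 := polar_mem_openSegment hρ hρb
  have hm2 := polar_mem_openSegment hρ hρa
  have hm1' : polar v ρ β ∈ openSegment ℝ (G.src d₁.1) (G.tgt d₁.1) := by
    rwa [← openSegment_dart, h]
  have hm2' : polar v ρ (G.tl d₂ - v).arg ∈ openSegment ℝ (G.src d₂.1) (G.tgt d₂.1) := by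
    rwa [← openSegment_dart, openSegment_symm]
  have hγ : ((β + α : ℝ) : Real.Angle) = (G.tl d₂ - v).arg := by
    rw [Real.Angle.coe_add, coe_ccw]
    abel
  have e1 := hZ.wind_eventually_eq_leftVal G d₁ hm1'
  rw [h] at e1
  have e1' := (tendsto_polar_left_tail hb hρ).eventually e1
  have e2' := (tendsto_polar_left_head ha hρ hγ).eventually
    (hZ.wind_eventually_eq_leftVal G d₂ hm2')
  obtain ⟨δ, ⟨hδ1, hδ2⟩, hδ⟩ := ((e1'.and e2').and (Ioo_mem_nhdsGT hα)).exists
  rw [← hδ1, ← hδ2]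
  refine eq_of_sector (ε := ε) (β := β) (γ := β + α) ?_ ⟨hρ, hρε⟩ ?_ ⟨hρ, hρε⟩ ?_
  · intro ρ hρ θ hθ
    exact hZ.wind_eventually_eq G (hfree ρ hρ θ hθ)
  · constructor <;> linarith [hδ.1, hδ.2]
  · constructor <;> linarith [hδ.1, hδ.2]

open Classical in
/-- Weak form of Euler's formula: a rotation system coming from a plane drawing has at least
`|E| - |V|` faces. -/
theorem card_le_card_add_card_faces (V : Finset ℂ) (hs : ∀ e, G.src e ∈ V) (ht : ∀ e, G.tgt e ∈ V)
    (φ : E × Bool → E × Bool) (hφ : ∀ d, G.tl (φ d) = G.hd d)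
    (hmin : ∀ d x, G.tl x = G.hd d →
      ccw (G.hd (φ d) - G.hd d) (G.tl d - G.hd d) ≤ ccw (G.hd x - G.hd d) (G.tl d - G.hd d)) :
    Fintype.card E ≤ V.card + Nat.card (Quot fun d d' => φ d = d') := by
  set r : E × Bool → E × Bool → Prop := fun d d' => φ d = d'
  have : Finite (Quot r) := Finite.of_surjective _ Quot.mk_surjective
  have := Fintype.ofFinite (Quot r)
  let D : (E → ℝ) →ₗ[ℝ] (V → ℝ) := LinearMap.pi fun v => ∑ e,
    ((if G.tgt e = v then (1 : ℝ) else 0) - if G.src e = v then 1 else 0) • LinearMap.proj e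
  have hD : ∀ Z, D Z = 0 → G.IsCycle Z := by
    intro Z hZ F
    have hF : ∀ w ∈ V, F w = ∑ v : V, F v * if w = v then 1 else 0 := by
      intro w hw
      rw [Finset.sum_eq_single ⟨w, hw⟩]
      · simp
      · rintro b - hb
        rw [if_neg, mul_zero]
        rintro rfl
        exact hb rfl
      · simp
    have h1 : ∀ v : V, ∑ e, ((if G.tgt e = v then (1 : ℝ) else 0) -
        if G.src e = v then 1 else 0) * Z e = 0 := by
      intro v
      have := congrFun hZ v
      simpa [D, LinearMap.pi_apply] using this
    calc ∑ e, Z e * (F (G.tgt e) - F (G.src e))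
        = ∑ e, ∑ v : V, F v * (((if G.tgt e = v then (1 : ℝ) else 0) -
            if G.src e = v then 1 else 0) * Z e) := by
          refine Finset.sum_congr rfl fun e _ => ?_
          rw [hF _ (hs e), hF _ (ht e), ← Finset.sum_sub_distrib, Finset.mul_sum]
          exact Finset.sum_congr rfl fun v _ => by ring
      _ = 0 := by
          rw [Finset.sum_comm]
          exact Finset.sum_eq_zero fun v _ => by rw [← Finset.mul_sum, h1, mul_zero]
  let Λ : (E → ℝ) →ₗ[ℝ] (E × Bool → ℝ) :=
    { toFun := G.leftVal
      map_add' := fun Z Z' => by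
        ext d
        simp only [leftVal, wind, Pi.add_apply, add_mul, Finset.sum_add_distrib]
        split_ifs <;> ring
      map_smul' := fun c Z => by
        ext d
        simp only [leftVal, wind, Pi.smul_apply, smul_eq_mul, mul_assoc, ← Finset.mul_sum,
          RingHom.id_apply]
        split_ifs <;> ring }
  have hΛ : Function.Injective Λ := by
    intro Z Z' h
    ext e
    have h1 := congrFun h (e, true)
    have h2 := congrFun h (e, false)
    simp only [Λ, LinearMap.coe_mk, AddHom.coe_mk, leftVal, if_true, sub_zero] at h1 h2
    simp only [h1, Bool.false_eq_true, if_false] at h2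
    have := Real.pi_pos
    have h3 : 2 * Real.pi * Z e = 2 * Real.pi * Z' e := by linarith
    exact mul_left_cancel₀ (by positivity) h3
  have hK : (LinearMap.ker D).map Λ ≤ LinearMap.range (LinearMap.funLeft ℝ ℝ (Quot.mk r)) := by
    rintro _ ⟨Z, hZ, rfl⟩
    have hc := hD Z hZ
    refine ⟨Quot.lift (G.leftVal Z) ?_, ?_⟩
    · rintro d _ rfl
      exact (hc.leftVal_eq G (hφ d) (hmin d)).symm
    · ext d
      rfl
  have h1 := Submodule.finrank_mono hK
  rw [← (Submodule.equivMapOfInjective Λ hΛ _).finrank_eq] at h1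
  have h2 := LinearMap.finrank_range_le (LinearMap.funLeft ℝ ℝ (Quot.mk r))
  have h3 := LinearMap.finrank_range_add_finrank_ker D
  have h4 := Submodule.finrank_le (LinearMap.range D)
  simp only [Module.finrank_fintype_fun_eq_card, Fintype.card_coe] at h2 h3 h4
  rw [Nat.card_eq_fintype_card]
  omega

end LineGraph

lemma turn_eventually {x p q₀ : ℂ} (hp : p ≠ x) (h : 0 < ((x - q₀) / (x - p)).re) :
    ∀ᶠ q in 𝓝 q₀, turn x q₀ q = turn x p q - turn x p q₀ := by
  have hx : q₀ ≠ x := by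
    rintro rfl
    simp at h
  have h1 : Tendsto (fun q => turn x q₀ q - turn x p q) (𝓝 q₀) (𝓝 (0 - turn x p q₀)) :=
    (tendsto_turn hx).sub (continuousAt_turn h)
  have h2 : ∀ᶠ q in 𝓝 q₀, q ≠ x := isOpen_ne.mem_nhds hx
  have h3 := eventually_eq_of_angle_eq h1 (by
    filter_upwards [h2] with q hq
    rw [Real.Angle.coe_sub, Real.Angle.coe_sub, coe_turn hx hq, coe_turn hp hq, coe_turn hp hx,
      Real.Angle.coe_zero]
    abel)
  filter_upwards [h3] with q hq
  linarith

lemma re_div_pos {x p q : ℂ} {r : ℝ} (hx : r ≤ dist x p) (hq : q ∈ Metric.ball p r) :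
    0 < ((x - q) / (x - p)).re := by
  have hq' : dist q p < r := hq
  have hpos : 0 < ‖x - p‖ := by
    rw [← dist_eq_norm]
    linarith [dist_nonneg (x := q) (y := p)]
  have hne : x - p ≠ 0 := norm_pos_iff.1 hpos
  have h1 : (x - q) / (x - p) = 1 - (q - p) / (x - p) := by
    field_simp
    ring
  have h2 : ‖(q - p) / (x - p)‖ < 1 := by
    rw [norm_div, div_lt_one hpos, ← dist_eq_norm, ← dist_eq_norm]
    linarith
  rw [h1, Complex.sub_re, Complex.one_re]
  linarith [(Complex.re_le_norm ((q - p) / (x - p)))]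

namespace LineGraph

variable {E : Type} (G : LineGraph E) [Fintype E]

/-- The edges form a directed path from `a` to `b`. -/
def IsPath (a b : ℂ) : Prop := ∀ F : ℂ → ℝ, ∑ e, (F (G.tgt e) - F (G.src e)) = F b - F a

/-- The angle under which the part of a path from `a` to `b` inside a disk around `p` is seen. -/
noncomputable def localWind (a b p q : ℂ) : ℝ :=
  G.wind (fun _ => 1) q - (turn b p q - turn a p q)

variable {G} {a b p : ℂ} {r : ℝ}

lemma IsPath.localWind_eventually_eq (hG : G.IsPath a b) (ha : r ≤ dist a p) (hb : r ≤ dist b p)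
    {q₀ : ℂ} (hq₀ : q₀ ∈ Metric.ball p r) {l : Filter ℂ} (hl : l ≤ 𝓝 q₀) {c : ℝ}
    (h : ∀ᶠ q in l, G.wind (fun _ => 1) q =
      c + ∑ e, (fun _ => 1) e * (turn (G.tgt e) q₀ q - turn (G.src e) q₀ q)) :
    ∀ᶠ q in l, G.localWind a b p q = c - (turn b p q₀ - turn a p q₀) := by
  have hpr : 0 < r := dist_nonneg.trans_lt hq₀
  have hpa : p ≠ a := by
    rintro rfl
    simp at ha
    linarith
  have hpb : p ≠ b := by
    rintro rfl
    simp at hb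
    linarith
  filter_upwards [h, hl (turn_eventually hpa (re_div_pos ha hq₀)),
    hl (turn_eventually hpb (re_div_pos hb hq₀))] with q h1 h2 h3
  simp only [one_mul] at h1
  rw [hG fun x => turn x q₀ q] at h1
  rw [localWind, h1, h2, h3]
  ring

lemma IsPath.localWind_locally_const (hG : G.IsPath a b) (ha : r ≤ dist a p)
    (hb : r ≤ dist b p) {q₀ : ℂ} (hq₀ : q₀ ∈ Metric.ball p r) (h : q₀ ∉ G.carrier) :
    ∀ᶠ q in 𝓝 q₀, G.localWind a b p q = G.localWind a b p q₀ :=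
  hG.localWind_eventually_eq ha hb hq₀ le_rfl (G.wind_eventually_of_notMem _ h)

lemma IsPath.localWind_left (hG : G.IsPath a b) (ha : r ≤ dist a p) (hb : r ≤ dist b p)
    (d : E × Bool) {q₀ : ℂ} (hq₀ : q₀ ∈ Metric.ball p r)
    (h : q₀ ∈ openSegment ℝ (G.src d.1) (G.tgt d.1)) :
    ∀ᶠ q in 𝓝[{q | LeftOf (G.tl d) (G.hd d) q}] q₀, G.localWind a b p q =
      G.localWind a b p q₀ - if d.2 then 0 else 2 * Real.pi := by
  filter_upwards [hG.localWind_eventually_eq ha hb hq₀ nhdsWithin_le_nhds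
    (G.wind_eventually_left _ d h)] with q hq
  rw [hq, localWind]
  split_ifs <;> ring

/-- The two sides of a path at an inner vertex `p` lie in different components of the complement
of the path in a disk around `p`. -/
lemma IsPath.not_crossing (hG : G.IsPath a b) (hr : 0 < r) (ha : r ≤ dist a p) (hb : r ≤ dist b p)
    {e₁ e₂ : E} (h₁ : G.src e₁ = p) (h₂ : G.tgt e₂ = p)
    (hall : ∀ x, G.tl x = p → x = (e₁, true) ∨ x = (e₂, false)) {u₁ u₂ : ℂ}
    (hu₁ : u₁ ≠ p) (hu₂ : u₂ ≠ p)
    (hs₁ : ccw (G.tgt e₁ - p) (u₁ - p) < ccw (G.tgt e₁ - p) (G.src e₂ - p))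
    (hs₂ : ccw (G.src e₂ - p) (u₂ - p) < ccw (G.src e₂ - p) (G.tgt e₁ - p))
    {C : Set ℂ} (hC : IsPreconnected C) (hCD : C ⊆ Metric.ball p r \ G.carrier)
    (hC₁ : openSegment ℝ p u₁ ∩ Metric.ball p r ⊆ C)
    (hC₂ : openSegment ℝ p u₂ ∩ Metric.ball p r ⊆ C) : False := by
  obtain ⟨ε₁, hε₁, hf₁⟩ := G.exists_sector_notMem (v := p) (z := G.src e₂ - p) (d₁ := (e₁, true))
    h₁ (by
      intro x hx
      rcases hall x hx with rfl | rfl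
      · exact le_rfl
      · exact (ccw_le _ _).trans_eq (ccw_of_arg_eq rfl).symm)
  obtain ⟨ε₂, hε₂, hf₂⟩ := G.exists_sector_notMem (v := p) (z := G.tgt e₁ - p) (d₁ := (e₂, false))
    h₂ (by
      intro x hx
      rcases hall x hx with rfl | rfl
      · exact (ccw_le _ _).trans_eq (ccw_of_arg_eq rfl).symm
      · exact le_rfl)
  simp only [hd] at hf₁ hf₂
  have ht : G.tgt e₁ ≠ p := fun h => G.src_ne_tgt e₁ (h₁.trans h.symm)
  obtain ⟨ρ, hρ, hρ'⟩ := exists_between (show 0 < min (min (min ε₁ ε₂) r)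
    (min ‖G.tgt e₁ - p‖ (min ‖u₁ - p‖ ‖u₂ - p‖)) by
      have := norm_pos_iff.2 (sub_ne_zero.2 ht)
      have := norm_pos_iff.2 (sub_ne_zero.2 hu₁)
      have := norm_pos_iff.2 (sub_ne_zero.2 hu₂)
      simp [*])
  simp only [lt_min_iff] at hρ'
  obtain ⟨⟨⟨hρ₁, hρ₂⟩, hρr⟩, hρt, hρu₁, hρu₂⟩ := hρ'
  have hball : ∀ ρ' ∈ Ioo 0 r, ∀ θ, polar p ρ' θ ∈ Metric.ball p r := fun ρ' h θ => by
    rw [Metric.mem_ball, dist_polar h.1.le]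
    exact h.2
  have hm : polar p ρ (G.tgt e₁ - p).arg ∈ openSegment ℝ (G.src e₁) (G.tgt e₁) := by
    rw [h₁]
    exact polar_mem_openSegment hρ hρt
  have hl := hG.localWind_left ha hb (e₁, true) (hball ρ ⟨hρ, hρr⟩ _) hm
  have hl' := hG.localWind_left ha hb (e₁, false) (hball ρ ⟨hρ, hρr⟩ _) hm
  simp only [hd, tl, h₁, if_true, Bool.false_eq_true, if_false, sub_zero] at hl hl'
  have hγ : (((G.src e₂ - p).arg + ccw (G.src e₂ - p) (G.tgt e₁ - p) : ℝ) : Real.Angle) =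
      (G.tgt e₁ - p).arg := by
    rw [Real.Angle.coe_add, coe_ccw]
    abel
  have hα₁ := ccw_pos (G.tgt e₁ - p) (G.src e₂ - p)
  have hα₂ := ccw_pos (G.src e₂ - p) (G.tgt e₁ - p)
  obtain ⟨δ, ⟨⟨hδ, hδ'⟩, hδ0, hδ1⟩, -, hδ2⟩ :=
    ((((tendsto_polar_left_tail ht hρ).eventually hl).and
      ((tendsto_polar_left_head ht hρ hγ).eventually hl')).and (Ioo_mem_nhdsGT hα₁)).and
      (Ioo_mem_nhdsGT hα₂) |>.exists
  have hsec : ∀ (u w : ℂ), polar p ρ (u - p).arg =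
      polar p ρ ((w - p).arg + ccw (w - p) (u - p)) := fun u w => polar_congr <| by
    rw [Real.Angle.coe_add, coe_ccw]
    abel
  have e₁' : G.localWind a b p (polar p ρ (u₁ - p).arg) =
      G.localWind a b p (polar p ρ ((G.tgt e₁ - p).arg + δ)) := by
    rw [hsec u₁ (G.tgt e₁)]
    refine eq_of_sector (ε := min ε₁ r) (β := (G.tgt e₁ - p).arg)
      (γ := (G.tgt e₁ - p).arg + ccw (G.tgt e₁ - p) (G.src e₂ - p)) ?_ ⟨hρ, lt_min hρ₁ hρr⟩ ?_
      ⟨hρ, lt_min hρ₁ hρr⟩ ?_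
    · intro ρ' hρ' θ hθ
      have hρ'' := lt_min_iff.1 hρ'.2
      exact hG.localWind_locally_const ha hb (hball ρ' ⟨hρ'.1, hρ''.2⟩ _)
        (hf₁ ρ' ⟨hρ'.1, hρ''.1⟩ θ hθ)
    · have := ccw_pos (G.tgt e₁ - p) (u₁ - p)
      constructor <;> linarith
    · constructor <;> linarith
  have e₂' : G.localWind a b p (polar p ρ (u₂ - p).arg) =
      G.localWind a b p
        (polar p ρ ((G.src e₂ - p).arg + ccw (G.src e₂ - p) (G.tgt e₁ - p) - δ)) := by
    rw [hsec u₂ (G.src e₂)]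
    refine eq_of_sector (ε := min ε₂ r) (β := (G.src e₂ - p).arg)
      (γ := (G.src e₂ - p).arg + ccw (G.src e₂ - p) (G.tgt e₁ - p)) ?_ ⟨hρ, lt_min hρ₂ hρr⟩ ?_
      ⟨hρ, lt_min hρ₂ hρr⟩ ?_
    · intro ρ' hρ' θ hθ
      have hρ'' := lt_min_iff.1 hρ'.2
      exact hG.localWind_locally_const ha hb (hball ρ' ⟨hρ'.1, hρ''.2⟩ _)
        (hf₂ ρ' ⟨hρ'.1, hρ''.1⟩ θ hθ)
    · have := ccw_pos (G.src e₂ - p) (u₂ - p)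
      constructor <;> linarith
    · constructor <;> linarith
  have e₃ : G.localWind a b p (polar p ρ (u₁ - p).arg) =
      G.localWind a b p (polar p ρ (u₂ - p).arg) := by
    refine eq_of_isPreconnected hC ?_
      (hC₁ ⟨polar_mem_openSegment hρ hρu₁, hball _ ⟨hρ, hρr⟩ _⟩)
      (hC₂ ⟨polar_mem_openSegment hρ hρu₂, hball _ ⟨hρ, hρr⟩ _⟩)
    intro q hq
    exact nhdsWithin_le_nhds (hG.localWind_locally_const ha hb (hCD hq).1 (hCD hq).2)
  rw [e₁', e₂', hδ, hδ'] at e₃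
  linarith [Real.pi_pos]

end LineGraph

/-- Four directions around a point, such that the pairs `s₁, s₂` and `t₁, t₂` do not interleave. -/
lemma exists_ccw_lt {s₁ s₂ t₁ t₂ : ℂ} (hs : s₁.arg ≠ s₂.arg) (ht : t₁.arg ≠ t₂.arg)
    (h₁₁ : s₁.arg ≠ t₁.arg) (h₁₂ : s₁.arg ≠ t₂.arg) (h₂₁ : s₂.arg ≠ t₁.arg) (h₂₂ : s₂.arg ≠ t₂.arg)
    (h : ¬ (ccw t₁ s₁ < ccw t₁ t₂ ∧ ccw t₂ s₂ < ccw t₂ t₁))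
    (h' : ¬ (ccw t₁ s₂ < ccw t₁ t₂ ∧ ccw t₂ s₁ < ccw t₂ t₁)) :
    (ccw s₂ s₁ < ccw t₁ s₁ ∧ ccw s₂ s₁ < ccw t₂ s₁ ∨
      ccw s₁ s₂ < ccw t₁ s₂ ∧ ccw s₁ s₂ < ccw t₂ s₂) ∧
    (ccw t₂ t₁ < ccw s₁ t₁ ∧ ccw t₂ t₁ < ccw s₂ t₁ ∨
      ccw t₁ t₂ < ccw s₁ t₂ ∧ ccw t₁ t₂ < ccw s₂ t₂) := by
  have hb := fun z : ℂ => And.intro (Complex.neg_pi_lt_arg z) (Complex.arg_le_pi z)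
  have b1 := hb s₁
  have b2 := hb s₂
  have b3 := hb t₁
  have b4 := hb t₂
  unfold ccw at *
  generalize s₁.arg = a at *
  generalize s₂.arg = b at *
  generalize t₁.arg = c at *
  generalize t₂.arg = d at *
  generalize Real.pi = π at *
  clear hb
  rcases lt_or_gt_of_ne hs with h1 | h1 <;> rcases lt_or_gt_of_ne ht with h2 | h2 <;>
  rcases lt_or_gt_of_ne h₁₁ with h3 | h3 <;> rcases lt_or_gt_of_ne h₁₂ with h4 | h4 <;>
  rcases lt_or_gt_of_ne h₂₁ with h5 | h5 <;> rcases lt_or_gt_of_ne h₂₂ with h6 | h6 <;>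
  simp only [h1, h2, h3, h4, h5, h6, h1.not_gt, h2.not_gt, h3.not_gt, h4.not_gt, h5.not_gt,
    h6.not_gt, if_true, if_false] at h h' ⊢ <;> grind

/-- The ray `s₁` lies in the sector from `t₁` to `t₂`, and `s₂` lies in the sector from `t₂`
to `t₁`. -/
def Splits (t₁ t₂ s₁ s₂ : ℂ) : Prop := ccw t₁ s₁ < ccw t₁ t₂ ∧ ccw t₂ s₂ < ccw t₂ t₁

/-- A family of polygonal chains `P i 0, …, P i (k i)`, colored red or blue, that meet only in
vertices, such that any two of them meet at most once and chains of the same color are disjoint. -/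
structure Arrangement (n : ℕ) where
  color : Fin n → Bool
  k : Fin n → ℕ
  P : Fin n → ℕ → ℂ
  inj : ∀ i m m', m ≤ k i → m' ≤ k i → P i m = P i m' → m = m'
  vertex_notMem : ∀ i m j m', m < k i → m' ≤ k j → P j m' ∉ openSegment ℝ (P i m) (P i (m + 1))
  disjoint : ∀ i m j m', m < k i → m' < k j → (i ≠ j ∨ m ≠ m') →
    Disjoint (openSegment ℝ (P i m) (P i (m + 1))) (openSegment ℝ (P j m') (P j (m' + 1)))
  color_ne : ∀ i m j m', i ≠ j → m ≤ k i → m' ≤ k j → P i m = P j m' → color i ≠ color j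
  unique : ∀ i j m m' l l', i ≠ j → m ≤ k i → m' ≤ k j → l ≤ k i → l' ≤ k j →
    P i m = P j m' → P i l = P j l' → m = l

namespace Arrangement

variable {n : ℕ} (A : Arrangement n)

/-- The edges of the chains. -/
abbrev Edge : Type := Σ i, Fin (A.k i)

/-- The plane graph formed by the chains. -/
def graph : LineGraph A.Edge where
  src e := A.P e.1 e.2
  tgt e := A.P e.1 (e.2 + 1)
  src_ne_tgt e h := by
    have := A.inj e.1 e.2 (e.2 + 1) e.2.2.le e.2.2 h
    omega
  src_notMem e e' := A.vertex_notMem _ _ _ _ e.2.2 e'.2.2.le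
  tgt_notMem e e' := A.vertex_notMem _ _ _ _ e.2.2 e'.2.2
  disjoint e e' h := by
    refine A.disjoint _ _ _ _ e.2.2 e'.2.2 ?_
    by_contra! h'
    rcases e with ⟨i, m⟩
    rcases e' with ⟨j, m'⟩
    obtain ⟨rfl, h'⟩ := h'
    exact h (congrArg (Sigma.mk i) (Fin.ext h'))

variable {A}

/-- The position of the tail of a dart on its chain. -/
def tailIdx : A.Edge × Bool → ℕ
  | (e, true) => e.2
  | (e, false) => e.2 + 1

/-- The position of the head of a dart on its chain. -/
def headIdx : A.Edge × Bool → ℕ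
  | (e, true) => e.2 + 1
  | (e, false) => e.2

/-- The number of edges of its chain that follow a dart. -/
def rest : A.Edge × Bool → ℕ
  | (e, true) => A.k e.1 - (e.2 + 1)
  | (e, false) => e.2

lemma tl_eq (d : A.Edge × Bool) : A.graph.tl d = A.P d.1.1 (tailIdx d) := by
  rcases d with ⟨e, _ | _⟩ <;> rfl

lemma hd_eq (d : A.Edge × Bool) : A.graph.hd d = A.P d.1.1 (headIdx d) := by
  rcases d with ⟨e, _ | _⟩ <;> rfl

lemma tailIdx_le (d : A.Edge × Bool) : tailIdx d ≤ A.k d.1.1 := by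
  rcases d with ⟨⟨i, m⟩, _ | _⟩ <;> simp only [tailIdx] <;> omega

lemma headIdx_le (d : A.Edge × Bool) : headIdx d ≤ A.k d.1.1 := by
  rcases d with ⟨⟨i, m⟩, _ | _⟩ <;> simp only [headIdx] <;> omega

lemma ext_headIdx {d d' : A.Edge × Bool} (h₁ : d.1.1 = d'.1.1) (h₂ : d.2 = d'.2)
    (h₃ : headIdx d = headIdx d') : d = d' := by
  rcases d with ⟨⟨i, m⟩, b⟩
  rcases d' with ⟨⟨i', m'⟩, b'⟩
  obtain rfl : i = i' := h₁
  obtain rfl : b = b' := h₂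
  obtain rfl : m = m' := by
    rcases b <;> simp only [headIdx] at h₃ <;> exact Fin.ext (by omega)
  rfl

variable (A) in
/-- A choice of the next dart around the face to the left of each dart. -/
def IsNext (φ : A.Edge × Bool → A.Edge × Bool) : Prop :=
  ∀ d, A.graph.tl (φ d) = A.graph.hd d ∧ ∀ x, A.graph.tl x = A.graph.hd d →
    ccw (A.graph.hd (φ d) - A.graph.hd d) (A.graph.tl d - A.graph.hd d) ≤
      ccw (A.graph.hd x - A.graph.hd d) (A.graph.tl d - A.graph.hd d)

variable (A) in
lemma exists_isNext : ∃ φ, A.IsNext φ := by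
  have h : ∀ d : A.Edge × Bool, ∃ y, A.graph.tl y = A.graph.hd d ∧
      ∀ x, A.graph.tl x = A.graph.hd d →
      ccw (A.graph.hd y - A.graph.hd d) (A.graph.tl d - A.graph.hd d) ≤
        ccw (A.graph.hd x - A.graph.hd d) (A.graph.tl d - A.graph.hd d) := by
    intro d
    exact Set.exists_min_image {y | A.graph.tl y = A.graph.hd d}
      (fun x => ccw (A.graph.hd x - A.graph.hd d) (A.graph.tl d - A.graph.hd d)) (Set.toFinite _)
      ⟨LineGraph.rev d, A.graph.tl_rev d⟩
  choose φ hφ using h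
  exact ⟨φ, hφ⟩

variable {φ : A.Edge × Bool → A.Edge × Bool}

lemma IsNext.eq_rev (hφ : A.IsNext φ) {d x : A.Edge × Bool} (h : φ d = LineGraph.rev d)
    (hx : A.graph.tl x = A.graph.hd d) : x = LineGraph.rev d := by
  by_contra hne
  have h1 := (hφ d).2 x hx
  rw [h, LineGraph.hd_rev, ccw_of_arg_eq rfl] at h1
  refine absurd h1 (not_le.2 (ccw_lt fun h2 => hne ?_))
  refine A.graph.eq_of_arg_eq (by rw [hx, LineGraph.tl_rev]) ?_
  rwa [LineGraph.hd_rev, LineGraph.tl_rev, hx]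

lemma IsNext.rest_eq_zero (hφ : A.IsNext φ) {d : A.Edge × Bool} (h : φ d = LineGraph.rev d) :
    rest d = 0 := by
  rcases d with ⟨⟨i, m, hm⟩, _ | _⟩
  · simp only [rest]
    by_contra h0
    have := hφ.eq_rev (x := (⟨i, m - 1, by omega⟩, false)) h
      (by simp only [LineGraph.tl, LineGraph.hd, graph]; congr 1; omega)
    simp [LineGraph.rev] at this
  · simp only [rest]
    by_contra h0
    have := hφ.eq_rev (x := (⟨i, m + 1, by omega⟩, true)) h rfl
    simp [LineGraph.rev] at this

lemma eq_of_rest_eq {d d' : A.Edge × Bool} (h₁ : d.1.1 = d'.1.1) (h₂ : d.2 = d'.2)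
    (h₃ : rest d = rest d') : d = d' := by
  refine ext_headIdx h₁ h₂ ?_
  rcases d with ⟨⟨i, m, hm⟩, b⟩
  rcases d' with ⟨⟨i', m', hm'⟩, b'⟩
  obtain rfl : i = i' := h₁
  obtain rfl : b = b' := h₂
  rcases b <;> simp only [headIdx, rest] at h₃ ⊢ <;> omega

lemma IsNext.owner_eq (hφ : A.IsNext φ) {d : A.Edge × Bool}
    (hc : A.color (φ d).1.1 = A.color d.1.1) : (φ d).1.1 = d.1.1 := by
  by_contra hne
  refine A.color_ne _ _ _ _ hne (tailIdx_le _) (headIdx_le d) ?_ hc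
  rw [← tl_eq, ← hd_eq, (hφ d).1]

lemma IsNext.straight (hφ : A.IsNext φ) {d : A.Edge × Bool} (h : φ d ≠ LineGraph.rev d)
    (hc : A.color (φ d).1.1 = A.color d.1.1) :
    (φ d).1.1 = d.1.1 ∧ (φ d).2 = d.2 ∧ rest (φ d) < rest d := by
  have ho := hφ.owner_eq hc
  have h1 := (hφ d).1
  rw [tl_eq, hd_eq, ho] at h1
  have h2 := A.inj _ _ _ (ho ▸ tailIdx_le _) (headIdx_le d) h1
  generalize φ d = x at *
  rcases d with ⟨⟨i, m, hm⟩, b⟩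
  rcases x with ⟨⟨i', m', hm'⟩, b'⟩
  obtain rfl : i' = i := ho
  rcases b <;> rcases b' <;> simp_all [headIdx, tailIdx, rest, LineGraph.rev] <;> omega

/-- The dart `d` turns into a chain of the other color. -/
def Switches (φ : A.Edge × Bool → A.Edge × Bool) (d : A.Edge × Bool) : Prop :=
  A.color (φ d).1.1 ≠ A.color d.1.1

/-- `y` is the next dart after `x` on the same face that switches. -/
structure NextSwitch (φ : A.Edge × Bool → A.Edge × Bool) (x y : A.Edge × Bool) : Prop where
  switches : Switches φ y
  owner : y.1.1 = (φ x).1.1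
  headIdx_ne : headIdx y ≠ tailIdx (φ x)

lemma IsNext.exists_switch (hφ : A.IsNext φ) {F : Set (A.Edge × Bool)} (hF : ∀ d ∈ F, φ d ∈ F)
    (hT : ∀ d ∈ F, φ d ≠ LineGraph.rev d) : ∀ r, ∀ d ∈ F, rest d = r →
      ∃ y ∈ F, Switches φ y ∧ y.1.1 = d.1.1 ∧ y.2 = d.2 ∧ rest y ≤ rest d := by
  intro r
  induction r using Nat.strong_induction_on with
  | _ r ih =>
    intro d hd hr
    by_cases hc : A.color (φ d).1.1 = A.color d.1.1
    · obtain ⟨h1, h2, h3⟩ := hφ.straight (hT d hd) hc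
      obtain ⟨y, hy, hs, h4, h5, h6⟩ := ih _ (hr ▸ h3) (φ d) (hF d hd) rfl
      exact ⟨y, hy, hs, h4.trans h1, h5.trans h2, h6.trans h3.le⟩
    · exact ⟨d, hd, hc, rfl, rfl, le_rfl⟩

lemma IsNext.exists_nextSwitch (hφ : A.IsNext φ) {F : Set (A.Edge × Bool)}
    (hF : ∀ d ∈ F, φ d ∈ F) (hT : ∀ d ∈ F, φ d ≠ LineGraph.rev d) {x : A.Edge × Bool} (hx : x ∈ F) :
    ∃ y ∈ F, NextSwitch φ x y := by
  obtain ⟨y, hy, hs, h1, h2, h3⟩ := hφ.exists_switch hF hT _ (φ x) (hF x hx) rfl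
  refine ⟨y, hy, hs, h1, ?_⟩
  generalize φ x = z at *
  rcases y with ⟨⟨i, m, hm⟩, b⟩
  rcases z with ⟨⟨i', m', hm'⟩, b'⟩
  obtain rfl : i = i' := h1
  rcases b <;> rcases b' <;> simp_all [headIdx, tailIdx, rest] <;> omega

lemma NextSwitch.color_ne {x y : A.Edge × Bool} (h : NextSwitch φ x y) (hx : Switches φ x) :
    A.color y.1.1 ≠ A.color x.1.1 := by
  rw [h.owner]
  exact hx

lemma IsNext.owner_ne (hφ : A.IsNext φ) {x y z : A.Edge × Bool} (hx : Switches φ x)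
    (h : NextSwitch φ x y) (h' : NextSwitch φ y z) : z.1.1 ≠ x.1.1 := by
  intro he
  have hne : y.1.1 ≠ x.1.1 := fun h'' => h.color_ne hx (by rw [h''])
  have h1 := (hφ x).1
  have h2 := (hφ y).1
  have hle := tailIdx_le (φ x)
  have hle' := tailIdx_le (φ y)
  rw [tl_eq, hd_eq, ← h.owner] at h1
  rw [tl_eq, hd_eq, ← h'.owner, he] at h2
  rw [← h.owner] at hle
  rw [← h'.owner, he] at hle'
  exact h.headIdx_ne (A.unique _ _ _ _ _ _ hne (headIdx_le y) hle' hle (headIdx_le x) h2.symm h1)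

open Classical in
lemma IsNext.four_le_card (hφ : A.IsNext φ) {F : Finset (A.Edge × Bool)} (hne : F.Nonempty)
    (hF : ∀ d ∈ F, φ d ∈ F) (hT : ∀ d ∈ F, φ d ≠ LineGraph.rev d) :
    4 ≤ (F.filter (Switches φ)).card := by
  obtain ⟨d, hd⟩ := hne
  have hnext := fun {x} => hφ.exists_nextSwitch (F := (F : Set (A.Edge × Bool))) hF hT (x := x)
  obtain ⟨x₀, hx₀, hd₀⟩ := hnext hd
  obtain ⟨x₁, hx₁, h₁⟩ := hnext hx₀
  obtain ⟨x₂, hx₂, h₂⟩ := hnext hx₁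
  obtain ⟨x₃, hx₃, h₃⟩ := hnext hx₂
  have c₁ := h₁.color_ne hd₀.switches
  have c₂ := h₂.color_ne h₁.switches
  have c₃ := h₃.color_ne h₂.switches
  have o₂ := hφ.owner_ne hd₀.switches h₁ h₂
  have o₃ := hφ.owner_ne h₁.switches h₂ h₃
  have hsub : ({x₀, x₁, x₂, x₃} : Finset (A.Edge × Bool)) ⊆ F.filter (Switches φ) := by
    intro x hx
    simp only [Finset.mem_insert, Finset.mem_singleton] at hx
    rw [Finset.mem_filter]
    rcases hx with rfl | rfl | rfl | rfl
    · exact ⟨hx₀, hd₀.switches⟩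
    · exact ⟨hx₁, h₁.switches⟩
    · exact ⟨hx₂, h₂.switches⟩
    · exact ⟨hx₃, h₃.switches⟩
  refine le_trans (le_of_eq ?_) (Finset.card_le_card hsub)
  have n₀₁ : x₀ ≠ x₁ := by rintro rfl; exact c₁ rfl
  have n₁₂ : x₁ ≠ x₂ := by rintro rfl; exact c₂ rfl
  have n₂₃ : x₂ ≠ x₃ := by rintro rfl; exact c₃ rfl
  have n₀₂ : x₀ ≠ x₂ := by rintro rfl; exact o₂ rfl
  have n₁₃ : x₁ ≠ x₃ := by rintro rfl; exact o₃ rfl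
  have n₀₃ : x₀ ≠ x₃ := by
    rintro rfl
    revert c₁ c₂ c₃
    cases A.color x₀.1.1 <;> cases A.color x₁.1.1 <;> cases A.color x₂.1.1 <;> simp
  simp [*]

lemma IsNext.card_turns (hφ : A.IsNext φ) [DecidablePred fun d => φ d = LineGraph.rev d] :
    (Finset.univ.filter fun d => φ d = LineGraph.rev d).card ≤ 2 * n := by
  have h := Finset.card_le_card_of_injOn (s := Finset.univ.filter fun d => φ d = LineGraph.rev d)
    (t := (Finset.univ : Finset (Fin n × Bool)))
    (fun d => (d.1.1, d.2)) (fun _ _ => Finset.mem_univ _) (by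
      intro d hd d' hd' (h : (d.1.1, d.2) = (d'.1.1, d'.2))
      simp only [Finset.coe_filter, Finset.mem_univ, true_and, mem_ofPred_eq] at hd hd'
      rw [Prod.mk.injEq] at h
      exact eq_of_rest_eq h.1 h.2
        ((hφ.rest_eq_zero hd).trans (hφ.rest_eq_zero hd').symm))
  rw [Finset.card_univ, Fintype.card_prod, Fintype.card_fin, Fintype.card_bool] at h
  omega

open Classical in
lemma IsNext.four_mul_faces (hφ : A.IsNext φ) :
    4 * Nat.card (Quot fun d d' => φ d = d') ≤
      (Finset.univ.filter (Switches φ)).card + 8 * n := by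
  set R := fun d d' => φ d = d'
  have : Finite (Quot R) := Finite.of_surjective _ Quot.mk_surjective
  have := Fintype.ofFinite (Quot R)
  set T := Finset.univ.filter fun d => φ d = LineGraph.rev d
  have hT : T.card ≤ 2 * n := hφ.card_turns
  have h1 : ∀ q : Quot R, 4 ≤ ((Finset.univ.filter (Switches φ)).filter (Quot.mk R · = q)).card +
      4 * (T.filter (Quot.mk R · = q)).card := by
    intro q
    by_cases hq : (T.filter (Quot.mk R · = q)).Nonempty
    · have := hq.card_pos
      omega
    · rw [Finset.not_nonempty_iff_eq_empty, Finset.filter_eq_empty_iff] at hq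
      have := hφ.four_le_card (F := Finset.univ.filter (Quot.mk R · = q)) ?_ ?_ ?_
      · rw [Finset.filter_comm]
        omega
      · obtain ⟨d, rfl⟩ := Quot.mk_surjective q
        exact ⟨d, by simp⟩
      · intro d hd
        rw [Finset.mem_filter] at hd ⊢
        refine ⟨Finset.mem_univ _, ?_⟩
        rw [← hd.2]
        exact (Quot.sound (r := R) rfl).symm
      · intro d hd hd'
        exact hq (Finset.mem_filter.2 ⟨Finset.mem_univ _, hd'⟩) (Finset.mem_filter.1 hd).2
  have h2 := Finset.sum_le_sum fun q (_ : q ∈ (Finset.univ : Finset (Quot R))) => h1 q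
  rw [Finset.sum_add_distrib, ← Finset.mul_sum,
    ← Finset.card_eq_sum_card_fiberwise (f := Quot.mk R) (fun _ _ => Finset.mem_univ _),
    ← Finset.card_eq_sum_card_fiberwise (f := Quot.mk R) (fun _ _ => Finset.mem_univ _),
    Finset.sum_const, Finset.card_univ, smul_eq_mul] at h2
  rw [Nat.card_eq_fintype_card]
  omega

variable (A) in
/-- The chains `i` and `j` have a common point. -/
def Meets (i j : Fin n) : Prop := ∃ m m', m ≤ A.k i ∧ m' ≤ A.k j ∧ A.P i m = A.P j m'

variable (A) in
open Classical in
/-- The pairs of chains with a common point. -/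
noncomputable def pairs : Finset (Finset (Fin n)) :=
  Finset.univ.filter fun p => ∃ i j, i ≠ j ∧ p = {i, j} ∧ A.Meets i j

lemma Meets.symm {i j : Fin n} (h : A.Meets i j) : A.Meets j i := by
  obtain ⟨m, m', h1, h2, h3⟩ := h
  exact ⟨m', m, h2, h1, h3.symm⟩

variable (A) in
lemma mem_pairs {i j : Fin n} (hij : i ≠ j) (h : A.Meets i j) : {i, j} ∈ A.pairs := by
  simp only [pairs, Finset.mem_filter, Finset.mem_univ, true_and]
  exact ⟨i, j, hij, rfl, h⟩

variable (A) in
/-- The vertices of the chains, listed along each chain. -/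
abbrev Vertex : Type := Σ i, Fin (A.k i + 1)

variable (A) in
open Classical in
lemma card_vertices_add_card_pairs :
    (Finset.univ.image fun w : A.Vertex => A.P w.1 w.2).card + A.pairs.card ≤ ∑ i, A.k i + n := by
  set f := fun w : A.Vertex => A.P w.1 w.2 with hf
  set R : Finset A.Vertex := Finset.univ.filter fun w => ∃ w', w'.1 < w.1 ∧ f w' = f w with hR
  have h1 : Finset.univ.image f ⊆ Rᶜ.image f := by
    intro x hx
    obtain ⟨w, -, rfl⟩ := Finset.mem_image.1 hx
    obtain ⟨w', hw', hmin⟩ := Finset.exists_min_image (Finset.univ.filter fun w' => f w' = f w)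
      (fun w' => w'.1) ⟨w, by simp⟩
    rw [Finset.mem_filter] at hw'
    refine Finset.mem_image.2 ⟨w', ?_, hw'.2⟩
    rw [Finset.mem_compl, hR, Finset.mem_filter]
    rintro ⟨-, w'', h, h'⟩
    exact absurd (hmin w'' (Finset.mem_filter.2 ⟨Finset.mem_univ _, h'.trans hw'.2⟩)) (not_le.2 h)
  have h2 := (Finset.card_le_card h1).trans Finset.card_image_le
  have h3 : A.pairs.card ≤ R.card := by
    have hch : ∀ w : A.Vertex, ∃ i, w ∈ R → i < w.1 ∧ ∃ m ≤ A.k i, A.P i m = f w := by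
      intro w
      by_cases hw : w ∈ R
      · obtain ⟨-, w', h, h'⟩ := Finset.mem_filter.1 hw
        exact ⟨w'.1, fun _ => ⟨h, w'.2, Nat.lt_succ_iff.1 w'.2.2, h'⟩⟩
      · exact ⟨w.1, fun h => absurd h hw⟩
    choose g hg using hch
    refine Finset.card_le_card_of_surjOn (fun w => {g w, w.1}) ?_
    intro p hp
    have hp' : ∃ i j, i < j ∧ p = {i, j} ∧ A.Meets i j := by
      simp only [pairs, Finset.coe_filter, Finset.mem_univ, true_and, mem_ofPred_eq] at hp
      obtain ⟨i, j, hij, rfl, h⟩ := hp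
      rcases lt_or_gt_of_ne hij with h' | h'
      · exact ⟨i, j, h', rfl, h⟩
      · exact ⟨j, i, h', Finset.pair_comm .., h.symm⟩
    obtain ⟨i, j, hij, rfl, m, m', hm, hm', he⟩ := hp'
    set w : A.Vertex := ⟨j, m', Nat.lt_succ_iff.2 hm'⟩ with hw
    have hwR : w ∈ R :=
      Finset.mem_filter.2 ⟨Finset.mem_univ _, ⟨i, m, Nat.lt_succ_iff.2 hm⟩, hij, he⟩
    refine ⟨w, hwR, ?_⟩
    obtain ⟨h4, l, hl, h5⟩ := hg w hwR
    suffices g w = i by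
      change ({g w, j} : Finset (Fin n)) = {i, j}
      rw [this]
    by_contra hne
    have c1 := A.color_ne _ _ _ _ hne hl hm (h5.trans he.symm)
    have c2 := A.color_ne _ _ _ _ hij.ne hm hm' he
    have c3 := A.color_ne _ _ _ _ h4.ne hl hm' h5
    revert c1 c2 c3
    simp only [hw]
    cases A.color (g w) <;> cases A.color i <;> cases A.color j <;> simp
  have h4 := Finset.card_compl_add_card R
  have h5 : Fintype.card A.Vertex = ∑ i, A.k i + n := by
    rw [Fintype.card_sigma]
    simp [Finset.sum_add_distrib]
  omega

variable (A) in
/-- The chains `i` and `j` meet without crossing each other. -/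
def Touch (i j : Fin n) : Prop :=
  i ≠ j ∧ ∃ m m', m + 1 < A.k i ∧ m' + 1 < A.k j ∧ A.P i (m + 1) = A.P j (m' + 1) ∧
    ∀ q, q = A.P i (m + 1) →
    ¬ Splits (A.P j (m' + 2) - q) (A.P j m' - q) (A.P i (m + 2) - q) (A.P i m - q) ∧
    ¬ Splits (A.P j (m' + 2) - q) (A.P j m' - q) (A.P i m - q) (A.P i (m + 2) - q)

end Arrangement

namespace Arrangement

variable {n : ℕ} {A : Arrangement n} {φ : A.Edge × Bool → A.Edge × Bool}

lemma IsNext.owner_ne_of_ccw_lt (hφ : A.IsNext φ) {d x : A.Edge × Bool}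
    (hx : A.graph.tl x = A.graph.hd d) {j : Fin n} {m : ℕ} (hm : m + 1 < A.k j)
    (hv : A.graph.hd d = A.P j (m + 1))
    (h₁ : ccw (A.graph.hd x - A.graph.hd d) (A.graph.tl d - A.graph.hd d) <
      ccw (A.P j (m + 2) - A.graph.hd d) (A.graph.tl d - A.graph.hd d))
    (h₂ : ccw (A.graph.hd x - A.graph.hd d) (A.graph.tl d - A.graph.hd d) <
      ccw (A.P j m - A.graph.hd d) (A.graph.tl d - A.graph.hd d)) : (φ d).1.1 ≠ j := by
  intro he
  obtain ⟨h3, h4⟩ := hφ d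
  have h5 := h4 x hx
  have hle := tailIdx_le (φ d)
  rw [hv, tl_eq] at h3
  generalize φ d = y at *
  subst he
  have h6 := A.inj _ _ _ hle hm.le h3
  rcases y with ⟨⟨j, l⟩, _ | _⟩
  · have : A.graph.hd (⟨j, l⟩, false) = A.P j m := by
      rw [hd_eq]
      simp only [headIdx, tailIdx] at h6 ⊢
      congr 1
      omega
    rw [this] at h5
    exact absurd h₂ (not_lt.2 h5)
  · have : A.graph.hd (⟨j, l⟩, true) = A.P j (m + 2) := by
      rw [hd_eq]
      simp only [headIdx, tailIdx] at h6 ⊢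
      congr 1
      omega
    rw [this] at h5
    exact absurd h₁ (not_lt.2 h5)

lemma IsNext.exists_dir (hφ : A.IsNext φ) {i j : Fin n} {m m' : ℕ} (hm : m + 1 < A.k i)
    (hm' : m' + 1 < A.k j) {q : ℂ} (hq : q = A.P i (m + 1)) (hq' : q = A.P j (m' + 1))
    (h : ccw (A.P i m - q) (A.P i (m + 2) - q) < ccw (A.P j (m' + 2) - q) (A.P i (m + 2) - q) ∧
        ccw (A.P i m - q) (A.P i (m + 2) - q) < ccw (A.P j m' - q) (A.P i (m + 2) - q) ∨
      ccw (A.P i (m + 2) - q) (A.P i m - q) < ccw (A.P j (m' + 2) - q) (A.P i m - q) ∧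
        ccw (A.P i (m + 2) - q) (A.P i m - q) < ccw (A.P j m' - q) (A.P i m - q)) :
    ∃ b, ∀ d : A.Edge × Bool, d.1.1 = i → d.2 = b → headIdx d = m + 1 → (φ d).1.1 ≠ j := by
  subst hq
  rcases h with ⟨h1, h2⟩ | ⟨h1, h2⟩
  · refine ⟨false, fun d hd1 hd2 hd3 => ?_⟩
    obtain rfl : d = (⟨i, m + 1, hm⟩, false) := ext_headIdx hd1 hd2 hd3
    exact hφ.owner_ne_of_ccw_lt (x := (⟨i, m, by omega⟩, false)) rfl hm' hq' h1 h2
  · refine ⟨true, fun d hd1 hd2 hd3 => ?_⟩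
    have hmi : m < A.k i := by omega
    obtain rfl : d = (⟨i, m, hmi⟩, true) := ext_headIdx hd1 hd2 hd3
    exact hφ.owner_ne_of_ccw_lt (x := (⟨i, m + 1, hm⟩, true)) rfl hm' hq' h1 h2

lemma IsNext.exists_dir_of_touch (hφ : A.IsNext φ) {i j : Fin n} (h : A.Touch i j) :
    ∃ m m', m ≤ A.k i ∧ m' ≤ A.k j ∧ A.P i m = A.P j m' ∧
      (∃ b, ∀ d : A.Edge × Bool, d.1.1 = i → d.2 = b → headIdx d = m → (φ d).1.1 ≠ j) ∧
      ∃ b, ∀ d : A.Edge × Bool, d.1.1 = j → d.2 = b → headIdx d = m' → (φ d).1.1 ≠ i := by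
  obtain ⟨hij, m, m', hm, hm', he, hs⟩ := h
  obtain ⟨q, hq⟩ : ∃ q, q = A.P i (m + 1) := ⟨_, rfl⟩
  have hq' := hq.trans he
  obtain ⟨hs1, hs2⟩ := hs q hq
  have harg : ∀ x y : A.Edge × Bool, A.graph.tl x = q → A.graph.tl y = q → x ≠ y →
      (A.graph.hd x - q).arg ≠ (A.graph.hd y - q).arg := by
    rintro x y hx hy hne h
    refine hne (A.graph.eq_of_arg_eq (hx.trans hy.symm) ?_)
    rwa [hx, hy]
  have key := exists_ccw_lt (s₁ := A.P i (m + 2) - q) (s₂ := A.P i m - q)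
    (t₁ := A.P j (m' + 2) - q) (t₂ := A.P j m' - q)
    (harg (⟨i, m + 1, hm⟩, true) (⟨i, m, by omega⟩, false) hq.symm hq.symm (by simp))
    (harg (⟨j, m' + 1, hm'⟩, true) (⟨j, m', by omega⟩, false) hq'.symm hq'.symm (by simp))
    (harg (⟨i, m + 1, hm⟩, true) (⟨j, m' + 1, hm'⟩, true) hq.symm hq'.symm (by simp [hij]))
    (harg (⟨i, m + 1, hm⟩, true) (⟨j, m', by omega⟩, false) hq.symm hq'.symm (by simp))
    (harg (⟨i, m, by omega⟩, false) (⟨j, m' + 1, hm'⟩, true) hq.symm hq'.symm (by simp))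
    (harg (⟨i, m, by omega⟩, false) (⟨j, m', by omega⟩, false) hq.symm hq'.symm (by simp [hij]))
    hs1 hs2
  exact ⟨m + 1, m' + 1, hm.le, hm'.le, he, hφ.exists_dir hm hm' hq hq' key.1,
    hφ.exists_dir hm' hm hq' hq key.2⟩

variable (A) in
open Classical in
/-- The pairs of chains that meet without crossing. -/
noncomputable def touchPairs : Finset (Finset (Fin n)) :=
  Finset.univ.filter fun p => ∃ i j, p = {i, j} ∧ A.Touch i j

lemma IsNext.headIdx_eq (hφ : A.IsNext φ) {i j : Fin n} (hij : i ≠ j) {m m' : ℕ} (hm : m ≤ A.k i)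
    (hm' : m' ≤ A.k j) (h : A.P i m = A.P j m') {d : A.Edge × Bool} (hd : d.1.1 = i)
    (hd' : (φ d).1.1 = j) : headIdx d = m := by
  have h1 := (hφ d).1
  have h2 := tailIdx_le (φ d)
  have h3 := headIdx_le d
  rw [tl_eq, hd_eq, hd', hd] at h1
  rw [hd'] at h2
  rw [hd] at h3
  exact A.unique _ _ _ _ _ _ hij h3 h2 hm hm' h1.symm h

open Classical in
lemma IsNext.card_fiber (hφ : A.IsNext φ) {p : Finset (Fin n)} (hp : p ∈ A.pairs) :
    ((Finset.univ.filter (Switches φ)).filter fun d => {d.1.1, (φ d).1.1} = p).card +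
      (if p ∈ A.touchPairs then 2 else 0) ≤ 4 := by
  set f : A.Edge × Bool → Fin n × Bool := fun d => (d.1.1, d.2) with hf
  set F := (Finset.univ.filter (Switches φ)).filter fun d => {d.1.1, (φ d).1.1} = p with hF
  have hmem : ∀ d, d ∈ F ↔ Switches φ d ∧ {d.1.1, (φ d).1.1} = p := by simp [hF]
  have hinj : Set.InjOn f F := by
    intro d hd d' hd' (h : (d.1.1, d.2) = (d'.1.1, d'.2))
    rw [Prod.mk.injEq] at h
    obtain ⟨h1, h2⟩ := (hmem _).1 hd
    obtain ⟨h1', h2'⟩ := (hmem _).1 hd'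
    have hne : (φ d).1.1 ≠ d.1.1 := fun h => h1 (by rw [h])
    have h3 : (φ d).1.1 = (φ d').1.1 := by
      have : (φ d).1.1 ∈ ({d'.1.1, (φ d').1.1} : Finset (Fin n)) := by
        rw [h2', ← h2]
        simp
      rw [Finset.mem_insert, Finset.mem_singleton, ← h.1] at this
      exact this.resolve_left hne
    refine ext_headIdx h.1 h.2 ?_
    have h4 := (hφ d').1
    rw [tl_eq, hd_eq] at h4
    exact hφ.headIdx_eq (h3 ▸ h.1 ▸ hne.symm) (headIdx_le _) (tailIdx_le _) h4.symm h.1 h3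
  have hprod : F.image f ⊆ p ×ˢ Finset.univ := by
    intro x hx
    obtain ⟨d, hd, rfl⟩ := Finset.mem_image.1 hx
    rw [Finset.mem_product, ← ((hmem _).1 hd).2]
    simp [hf]
  have hcard := Finset.card_image_of_injOn hinj
  have hp2 : p.card = 2 := by
    simp only [pairs, Finset.mem_filter, Finset.mem_univ, true_and] at hp
    obtain ⟨i, j, hij, rfl, -⟩ := hp
    exact Finset.card_pair hij
  split_ifs with ht
  · simp only [touchPairs, Finset.mem_filter, Finset.mem_univ, true_and] at ht
    obtain ⟨i, j, rfl, hij⟩ := ht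
    obtain ⟨m, m', hm, hm', he, ⟨b, hb⟩, b', hb'⟩ := hφ.exists_dir_of_touch hij
    have hne := hij.1
    have howner : ∀ d ∈ F, ∀ a c : Fin n, a ≠ c → ({a, c} : Finset (Fin n)) = {i, j} → d.1.1 = a →
        (φ d).1.1 = c := by
      intro d hd a c hac hac' hda
      obtain ⟨h1, h2⟩ := (hmem _).1 hd
      have : (φ d).1.1 ∈ ({a, c} : Finset (Fin n)) := by
        rw [hac', ← h2]
        simp
      rw [Finset.mem_insert, Finset.mem_singleton] at this
      exact this.resolve_left fun h => h1 (by rw [h, hda])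
    have hsub : F.image f ⊆ ((({i, j} : Finset (Fin n)) ×ˢ Finset.univ).erase (i, b)).erase
        (j, b') := by
      intro x hx
      refine Finset.mem_erase.2 ⟨?_, Finset.mem_erase.2 ⟨?_, hprod hx⟩⟩ <;>
        obtain ⟨d, hd, rfl⟩ := Finset.mem_image.1 hx <;> intro h <;>
        simp only [hf, Prod.mk.injEq] at h
      · have := howner d hd j i hne.symm (Finset.pair_comm ..) h.1
        exact hb' d h.1 h.2 (hφ.headIdx_eq hne.symm hm' hm he.symm h.1 this) this
      · have := howner d hd i j hne rfl h.1
        exact hb d h.1 h.2 (hφ.headIdx_eq hne hm hm' he h.1 this) this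
    have h1 := Finset.card_le_card hsub
    rw [Finset.card_erase_of_mem (by simp [hne.symm]), Finset.card_erase_of_mem (by simp),
      Finset.card_product, Finset.card_univ, Fintype.card_bool, hp2] at h1
    omega
  · have h1 := Finset.card_le_card hprod
    rw [Finset.card_product, Finset.card_univ, Fintype.card_bool, hp2] at h1
    omega

lemma Touch.meets {i j : Fin n} (h : A.Touch i j) : A.Meets i j := by
  obtain ⟨-, m, m', hm, hm', he, -⟩ := h
  exact ⟨m + 1, m' + 1, hm.le, hm'.le, he⟩

open Classical in
lemma IsNext.card_switches (hφ : A.IsNext φ) :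
    (Finset.univ.filter (Switches φ)).card + 2 * A.touchPairs.card ≤ 4 * A.pairs.card := by
  have hsub : A.touchPairs ⊆ A.pairs := by
    intro p hp
    simp only [touchPairs, Finset.mem_filter, Finset.mem_univ, true_and] at hp
    obtain ⟨i, j, rfl, h⟩ := hp
    exact A.mem_pairs h.1 h.meets
  have h := Finset.sum_le_sum fun p (hp : p ∈ A.pairs) => hφ.card_fiber hp
  rw [Finset.sum_add_distrib, ← Finset.card_eq_sum_card_fiberwise, ← Finset.sum_filter,
    Finset.filter_mem_eq_inter, Finset.inter_eq_right.2 hsub, Finset.sum_const, Finset.sum_const,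
    smul_eq_mul, smul_eq_mul] at h
  · omega
  · intro d hd
    simp only [Finset.coe_filter, Finset.mem_univ, true_and, mem_ofPred_eq] at hd
    refine A.mem_pairs (fun h => hd (by rw [h])) ⟨headIdx d, tailIdx (φ d), headIdx_le _,
      tailIdx_le _, ?_⟩
    rw [← tl_eq, ← hd_eq, (hφ d).1]

variable (A) in
open Classical in
/-- At most `6 * n` pairs of chains meet without crossing. -/
theorem card_touchPairs_le : A.touchPairs.card ≤ 6 * n := by
  obtain ⟨φ, hφ⟩ := A.exists_isNext
  have h1 := A.graph.card_le_card_add_card_faces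
    (Finset.univ.image fun w : A.Vertex => A.P w.1 w.2)
    (fun e => Finset.mem_image.2 ⟨⟨e.1, e.2.castSucc⟩, Finset.mem_univ _, rfl⟩)
    (fun e => Finset.mem_image.2 ⟨⟨e.1, e.2.succ⟩, Finset.mem_univ _, by simp [graph]⟩)
    φ (fun d => (hφ d).1) (fun d => (hφ d).2)
  have h2 := A.card_vertices_add_card_pairs
  have h3 := hφ.four_mul_faces
  have h4 := hφ.card_switches
  have h5 : Fintype.card A.Edge = ∑ i, A.k i := by simp
  rw [h5] at h1
  omega

end Arrangement

/-- The identification of the plane with `ℂ`. -/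
noncomputable abbrev toC : Pt ≃L[ℝ] ℂ := Complex.equivRealProdCLM.symm

lemma mem_disk_iff {p q : Pt} {r : ℝ} (hr : 0 < r) :
    q ∈ Disk p r ↔ toC q ∈ Metric.ball (toC p) r := by
  rw [Metric.mem_ball, Complex.dist_eq_re_im, Real.sqrt_lt' hr]
  simp [Disk]

namespace Arrangement

variable {n : ℕ} (A : Arrangement n)

/-- A single chain of the arrangement. -/
def chain (j : Fin n) : LineGraph (Fin (A.k j)) where
  src m := A.P j m
  tgt m := A.P j (m + 1)
  src_ne_tgt m h := by
    have := A.inj j m (m + 1) m.2.le m.2 h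
    omega
  src_notMem m m' := A.vertex_notMem _ _ _ _ m.2 m'.2.le
  tgt_notMem m m' := A.vertex_notMem _ _ _ _ m.2 m'.2
  disjoint m m' h := A.disjoint _ _ _ _ m.2 m'.2 (Or.inr fun h' => h (Fin.ext h'))

lemma chain_isPath (j : Fin n) : (A.chain j).IsPath (A.P j 0) (A.P j (A.k j)) := by
  intro F
  have h := Finset.sum_range_sub (fun m => F (A.P j m)) (A.k j)
  rw [← h, ← Fin.sum_univ_eq_sum_range fun m => F (A.P j (m + 1)) - F (A.P j m)]
  rfl

lemma eq_of_chain_tl {j : Fin n} {m : ℕ} (hm : m + 1 < A.k j) {x : Fin (A.k j) × Bool}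
    (hx : (A.chain j).tl x = A.P j (m + 1)) :
    x = (⟨m + 1, hm⟩, true) ∨ x = (⟨m, by omega⟩, false) := by
  rcases x with ⟨⟨l, hl⟩, _ | _⟩
  · have := A.inj j (l + 1) (m + 1) hl hm.le hx
    right
    simp only [Prod.mk.injEq, Fin.mk.injEq, and_true]
    omega
  · have := A.inj j l (m + 1) hl.le hm.le hx
    left
    simp [this]

/-- The chains of the arrangement are the curves `S i`, and contain all their common points as
vertices. -/
structure Realizes (S : Fin n → Set Pt) : Prop where
  segment_subset : ∀ i m, m < A.k i → segment ℝ (A.P i m) (A.P i (m + 1)) ⊆ toC '' S i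
  exists_vertex : ∀ i j, i ≠ j → ∀ x ∈ S i ∩ S j, ∃ m ≤ A.k i, A.P i m = toC x
  first : ∀ i, ∃ x, IsEndpoint (S i) x ∧ A.P i 0 = toC x
  last : ∀ i, ∃ x, IsEndpoint (S i) x ∧ A.P i (A.k i) = toC x

variable {A} {S : Fin n → Set Pt}

lemma Realizes.exists_inner_vertex (hA : A.Realizes S) {i j : Fin n} (hij : i ≠ j) {p : Pt}
    (hp : p ∈ S i ∩ S j) (he : ¬ IsEndpoint (S i) p) :
    ∃ m, m + 1 < A.k i ∧ A.P i (m + 1) = toC p := by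
  obtain ⟨m, hm, h⟩ := hA.exists_vertex i j hij p hp
  rcases Nat.eq_zero_or_pos m with rfl | h0
  · obtain ⟨x, hx, hx'⟩ := hA.first i
    exact absurd (toC.injective (h.symm.trans hx') ▸ hx) he
  rcases hm.eq_or_lt with rfl | h1
  · obtain ⟨x, hx, hx'⟩ := hA.last i
    exact absurd (toC.injective (h.symm.trans hx') ▸ hx) he
  obtain ⟨l, rfl⟩ := Nat.exists_eq_succ_of_ne_zero h0.ne'
  exact ⟨l, h1, h⟩

lemma Realizes.touch (hA : A.Realizes S) {i j : Fin n} (hij : i ≠ j) (h : Touches (S i) (S j)) :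
    A.Touch i j := by
  obtain ⟨p, hp, hpi, hpj, r, hr, hend, x, hx⟩ := h
  have hmem : p ∈ S i ∩ S j := hp ▸ mem_singleton p
  obtain ⟨m, hm, hmp⟩ := hA.exists_inner_vertex hij hmem hpi
  obtain ⟨m', hm', hmp'⟩ := hA.exists_inner_vertex hij.symm hmem.symm hpj
  refine ⟨hij, m, m', hm, hm', hmp.trans hmp'.symm, ?_⟩
  rw [hmp]
  rintro _ rfl
  have hfar : ∀ x, IsEndpoint (S j) x → r ≤ dist (toC x) (toC p) := fun x hx => by
    have := hend x (Or.inr hx)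
    rwa [mem_disk_iff hr, Metric.mem_ball, not_lt] at this
  have ha : r ≤ dist (A.P j 0) (toC p) := by
    obtain ⟨x, hx, h⟩ := hA.first j
    exact h ▸ hfar x hx
  have hb : r ≤ dist (A.P j (A.k j)) (toC p) := by
    obtain ⟨x, hx, h⟩ := hA.last j
    exact h ▸ hfar x hx
  set C := toC '' connectedComponentIn (Disk p r \ S j) x
  have hC : IsPreconnected C :=
    isPreconnected_connectedComponentIn.image _ toC.continuous.continuousOn
  have hCD : C ⊆ Metric.ball (toC p) r \ (A.chain j).carrier := by
    rintro _ ⟨y, hy, rfl⟩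
    obtain ⟨h1, h2⟩ := connectedComponentIn_subset _ _ hy
    refine ⟨(mem_disk_iff hr).1 h1, fun h3 => ?_⟩
    obtain ⟨l, hl⟩ := mem_iUnion.1 h3
    obtain ⟨z, hz, hz'⟩ := hA.segment_subset j l l.2 hl
    exact h2 (toC.injective hz' ▸ hz)
  have hedge : ∀ l < A.k i, toC p ∉ openSegment ℝ (A.P i l) (A.P i (l + 1)) →
      openSegment ℝ (A.P i l) (A.P i (l + 1)) ∩ Metric.ball (toC p) r ⊆ C := by
    rintro l hl hnot y ⟨hy, hy'⟩
    obtain ⟨z, hz, rfl⟩ := hA.segment_subset i l hl (openSegment_subset_segment _ _ _ hy)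
    refine ⟨z, hx ⟨⟨hz, (mem_disk_iff hr).2 hy'⟩, ?_⟩, rfl⟩
    rintro rfl
    exact hnot hy
  have hC₁ : openSegment ℝ (toC p) (A.P i (m + 2)) ∩ Metric.ball (toC p) r ⊆ C := by
    have := hedge (m + 1) hm (hmp ▸ A.vertex_notMem _ _ _ _ hm hm.le)
    rwa [hmp] at this
  have hC₂ : openSegment ℝ (toC p) (A.P i m) ∩ Metric.ball (toC p) r ⊆ C := by
    have := hedge m (by omega) (hmp ▸ A.vertex_notMem _ _ _ _ (by omega) hm.le)
    rwa [hmp, openSegment_symm] at this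
  have hu₁ : A.P i (m + 2) ≠ toC p := fun h => by
    have := A.inj i _ _ hm hm.le (h.trans hmp.symm)
    omega
  have hu₂ : A.P i m ≠ toC p := fun h => by
    have := A.inj i m (m + 1) (by omega) hm.le (h.trans hmp.symm)
    omega
  have hall := fun x => A.eq_of_chain_tl hm' (x := x)
  rw [hmp'] at hall
  have key := fun {u₁ u₂} => (A.chain_isPath j).not_crossing (u₁ := u₁) (u₂ := u₂) hr ha hb
    (e₁ := ⟨m' + 1, hm'⟩) (e₂ := ⟨m', by omega⟩) hmp' hmp' hall
  exact ⟨fun h => key hu₁ hu₂ h.1 h.2 hC hCD hC₁ hC₂, fun h => key hu₂ hu₁ h.1 h.2 hC hCD hC₂ hC₁⟩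

end Arrangement

section Chains

lemma ordConnected_preimage {X : Type*} [TopologicalSpace X] [T2Space X] {f : ℝ → X}
    (hf : ContinuousOn f (Icc 0 1)) (hinj : InjOn f (Icc 0 1))
    {K : Set X} (hK : IsPreconnected K) (hsub : K ⊆ f '' Icc 0 1) :
    OrdConnected {t | t ∈ Icc 0 1 ∧ f t ∈ K} := by
  have h1 : Topology.IsInducing ((Icc (0 : ℝ) 1).domRestrict f) :=
    ((continuousOn_iff_continuous_domRestrict.1 hf).isClosedEmbedding
      (injOn_iff_injective.1 hinj)).isInducing
  have h2 : (Icc (0 : ℝ) 1).domRestrict f '' {t | f t ∈ K} = K := by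
    ext x
    constructor
    · rintro ⟨t, ht, rfl⟩
      exact ht
    · intro hx
      obtain ⟨t, ht, rfl⟩ := hsub hx
      exact ⟨⟨t, ht⟩, hx, rfl⟩
  have h3 : IsPreconnected {t : Icc (0 : ℝ) 1 | f t ∈ K} :=
    h1.isPreconnected_image.1 (h2.symm ▸ hK)
  have h4 := (h3.image _ continuous_subtype_val.continuousOn).ordConnected
  have h5 : {t | t ∈ Icc 0 1 ∧ f t ∈ K} = Subtype.val '' {t : Icc (0 : ℝ) 1 | f t ∈ K} := by
    ext t
    simp [and_comm]
  exact h5 ▸ h4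

variable {X : Type*} [NormedAddCommGroup X] [NormedSpace ℝ X] {f : ℝ → X}

lemma isPreconnected_segment (a b : X) : IsPreconnected (segment ℝ a b) :=
  (convex_segment a b).isPreconnected

lemma image_Icc_eq_segment (hf : ContinuousOn f (Icc 0 1)) (hinj : InjOn f (Icc 0 1)) {a b : X}
    (hab : segment ℝ a b ⊆ f '' Icc 0 1) {s t : ℝ} (hs : 0 ≤ s) (hst : s < t) (ht : t ≤ 1)
    (h : MapsTo f (Icc s t) (segment ℝ a b)) : f '' Icc s t = segment ℝ (f s) (f t) := by
  have hs' : s ∈ Icc (0 : ℝ) 1 := ⟨hs, hst.le.trans ht⟩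
  have ht' : t ∈ Icc (0 : ℝ) 1 := ⟨hs.trans hst.le, ht⟩
  have hsub : segment ℝ (f s) (f t) ⊆ segment ℝ a b := (convex_segment a b).segment_subset
    (h (left_mem_Icc.2 hst.le)) (h (right_mem_Icc.2 hst.le))
  have h1 : f '' Icc s t ⊆ segment ℝ (f s) (f t) := by
    have := ordConnected_preimage hf hinj (isPreconnected_segment (f s) (f t)) (hsub.trans hab)
    rintro _ ⟨u, hu, rfl⟩
    exact (this.out ⟨hs', left_mem_segment ℝ _ _⟩ ⟨ht', right_mem_segment ℝ _ _⟩ hu).2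
  refine h1.antisymm ?_
  have hne : f s ≠ f t := fun h => hst.ne (hinj hs' ht' h)
  have h2 := ordConnected_preimage (f := AffineMap.lineMap (f s) (f t))
    (AffineMap.lineMap_continuous (R := ℝ)).continuousOn
    (AffineMap.lineMap_injective ℝ hne).injOn
    (isPreconnected_Icc.image f (hf.mono (Icc_subset_Icc hs ht)))
    (by rwa [← segment_eq_image_lineMap])
  rw [segment_eq_image_lineMap]
  rintro _ ⟨u, hu, rfl⟩
  refine (h2.out (x := 0) ⟨by simp, ?_⟩ (y := 1) ⟨by simp, ?_⟩ hu).2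
  · rw [AffineMap.lineMap_apply_zero]
    exact mem_image_of_mem _ (left_mem_Icc.2 hst.le)
  · rw [AffineMap.lineMap_apply_one]
    exact mem_image_of_mem _ (right_mem_Icc.2 hst.le)

lemma exists_breakpoints (hf : ContinuousOn f (Icc 0 1)) (hinj : InjOn f (Icc 0 1))
    {Q : Finset (X × X)} (hQ : f '' Icc 0 1 = ⋃ q ∈ Q, segment ℝ q.1 q.2) :
    ∃ B : Finset ℝ, ∀ s t, 0 ≤ s → s < t → t ≤ 1 → (∀ x ∈ B, x ∉ Ioo s t) →
      f '' Icc s t = segment ℝ (f s) (f t) := by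
  classical
  set K : X × X → Set ℝ := fun q => {t | t ∈ Icc 0 1 ∧ f t ∈ segment ℝ q.1 q.2}
  refine ⟨Q.image (fun q => sInf (K q)) ∪ Q.image (fun q => sSup (K q)), ?_⟩
  intro s t hs hst ht hB
  have hmid : f ((s + t) / 2) ∈ f '' Icc 0 1 := ⟨_, ⟨by linarith, by linarith⟩, rfl⟩
  rw [hQ] at hmid
  simp only [mem_iUnion] at hmid
  obtain ⟨q, hq, hmem⟩ := hmid
  have hsub : segment ℝ q.1 q.2 ⊆ f '' Icc 0 1 := by
    rw [hQ]
    exact subset_biUnion_of_mem (u := fun q : X × X => segment ℝ q.1 q.2) hq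
  have hmem' : (s + t) / 2 ∈ K q := ⟨⟨by linarith, by linarith⟩, hmem⟩
  have hcl : IsClosed (K q) := by
    have h : IsClosed (segment ℝ q.1 q.2) := by
      rw [segment_eq_image]
      exact (isCompact_Icc.image (by fun_prop)).isClosed
    exact hf.preimage_isClosed_of_isClosed isClosed_Icc h
  have hcomp : IsCompact (K q) := isCompact_Icc.of_isClosed_subset hcl fun _ h => h.1
  have h1 := hcomp.sInf_mem ⟨_, hmem'⟩
  have h2 := hcomp.sSup_mem ⟨_, hmem'⟩
  have h3 := csInf_le hcomp.bddBelow hmem'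
  have h4 := le_csSup hcomp.bddAbove hmem'
  have h5 : sInf (K q) ≤ s := by
    by_contra h
    exact hB _ (Finset.mem_union_left _ (Finset.mem_image_of_mem _ hq))
      ⟨not_le.1 h, by linarith⟩
  have h6 : t ≤ sSup (K q) := by
    by_contra h
    exact hB _ (Finset.mem_union_right _ (Finset.mem_image_of_mem _ hq))
      ⟨by linarith, not_le.1 h⟩
  have h7 := ordConnected_preimage hf hinj (isPreconnected_segment q.1 q.2) hsub
  exact image_Icc_eq_segment hf hinj hsub hs hst ht fun u hu =>
    (h7.out h1 h2 ⟨h5.trans hu.1, hu.2.trans h6⟩).2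

lemma exists_enumeration (T : Finset ℝ) (h0 : 0 ∈ T) (h1 : 1 ∈ T)
    (hT : ∀ t ∈ T, t ∈ Icc (0 : ℝ) 1) :
    ∃ (k : ℕ) (c : ℕ → ℝ), c 0 = 0 ∧ c k = 1 ∧ StrictMonoOn c (Iic k) ∧
      ∀ t ∈ T, ∃ m ≤ k, c m = t := by
  have hcard : 0 < T.card := Finset.card_pos.2 ⟨0, h0⟩
  set e := T.orderEmbOfFin rfl
  have hlt : ∀ m, min m (T.card - 1) < T.card := fun m => by omega
  have hsurj : ∀ t ∈ T, ∃ m ≤ T.card - 1, e ⟨min m (T.card - 1), hlt m⟩ = t := by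
    intro t ht
    have : t ∈ range e := by
      rw [Finset.range_orderEmbOfFin]
      exact ht
    obtain ⟨⟨m, hm⟩, rfl⟩ := this
    refine ⟨m, by omega, ?_⟩
    congr 2
    omega
  have hmono : StrictMonoOn (fun m => e ⟨min m (T.card - 1), hlt m⟩) (Iic (T.card - 1)) := by
    intro a ha b hb hab
    refine e.strictMono ?_
    simp only [mem_Iic] at ha hb
    simp only [Fin.mk_lt_mk]
    omega
  have hmem : ∀ m, e m ∈ T := fun m => T.orderEmbOfFin_mem rfl m
  refine ⟨T.card - 1, fun m => e ⟨min m (T.card - 1), hlt m⟩, ?_, ?_, hmono, hsurj⟩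
  · obtain ⟨m, hm, h⟩ := hsurj 0 h0
    refine le_antisymm ?_ (hT _ (hmem _)).1
    rw [← h]
    exact hmono.monotoneOn (mem_Iic.2 (Nat.zero_le _)) (mem_Iic.2 hm) (Nat.zero_le _)
  · obtain ⟨m, hm, h⟩ := hsurj 1 h1
    refine le_antisymm (hT _ (hmem _)).2 ?_
    rw [← h]
    exact hmono.monotoneOn (mem_Iic.2 hm) (mem_Iic.2 le_rfl) hm

/-- A polygonal curve can be subdivided into finitely many segments, such that a given finite set
of parameters becomes a set of vertices. -/
lemma exists_subdivision (hf : ContinuousOn f (Icc 0 1)) (hinj : InjOn f (Icc 0 1))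
    {Q : Finset (X × X)} (hQ : f '' Icc 0 1 = ⋃ q ∈ Q, segment ℝ q.1 q.2) {M : Set ℝ}
    (hM : M.Finite) (hM1 : M ⊆ Icc 0 1) :
    ∃ (k : ℕ) (c : ℕ → ℝ), c 0 = 0 ∧ c k = 1 ∧ StrictMonoOn c (Iic k) ∧
      (∀ t ∈ M, ∃ m ≤ k, c m = t) ∧ ∀ m < k, f '' Icc (c m) (c (m + 1)) =
        segment ℝ (f (c m)) (f (c (m + 1))) := by
  classical
  obtain ⟨B, hB⟩ := exists_breakpoints hf hinj hQ
  set T : Finset ℝ := insert 0 (insert 1 (hM.toFinset ∪ B.filter (· ∈ Icc 0 1)))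
  have hT : ∀ t ∈ T, t ∈ Icc (0 : ℝ) 1 := by
    intro t ht
    simp only [T, Finset.mem_insert, Finset.mem_union, Finset.mem_filter, Finite.mem_toFinset] at ht
    rcases ht with rfl | rfl | h | h
    · simp
    · simp
    · exact hM1 h
    · exact h.2
  obtain ⟨k, c, h0, h1, hc, hcT⟩ := exists_enumeration T (by simp [T]) (by simp [T]) hT
  have hle : ∀ m ≤ k, c m ∈ Icc (0 : ℝ) 1 := fun m hm => by
    rw [← h0, ← h1]
    exact ⟨hc.monotoneOn (mem_Iic.2 (Nat.zero_le _)) (mem_Iic.2 hm) (Nat.zero_le _),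
      hc.monotoneOn (mem_Iic.2 hm) (mem_Iic.2 le_rfl) hm⟩
  refine ⟨k, c, h0, h1, hc, fun t ht => hcT t (by simp [T, ht]), fun m hm => ?_⟩
  refine hB _ _ (hle m hm.le).1 (hc (mem_Iic.2 hm.le) (mem_Iic.2 hm) (Nat.lt_succ_self m))
    (hle _ hm).2 fun x hx hx' => ?_
  obtain ⟨l, hl, rfl⟩ := hcT x (by
    simp only [T, Finset.mem_insert, Finset.mem_union, Finset.mem_filter]
    exact Or.inr (Or.inr (Or.inr
      ⟨hx, (hle m hm.le).1.trans hx'.1.le, hx'.2.le.trans (hle _ hm).2⟩)))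
  have h2 := (hc.lt_iff_lt (mem_Iic.2 hm.le) (mem_Iic.2 hl)).1 hx'.1
  have h3 := (hc.lt_iff_lt (mem_Iic.2 hl) (mem_Iic.2 hm)).1 hx'.2
  omega

lemma openSegment_eq_image_Ioo (hinj : InjOn f (Icc 0 1)) {s t : ℝ} (hs : 0 ≤ s) (hst : s < t)
    (ht : t ≤ 1) (h : f '' Icc s t = segment ℝ (f s) (f t)) :
    openSegment ℝ (f s) (f t) = f '' Ioo s t := by
  have hs' : s ∈ Icc (0 : ℝ) 1 := ⟨hs, hst.le.trans ht⟩
  have ht' : t ∈ Icc (0 : ℝ) 1 := ⟨hs.trans hst.le, ht⟩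
  have hne : f s ≠ f t := fun h => hst.ne (hinj hs' ht' h)
  ext x
  constructor
  · intro hx
    obtain ⟨u, hu, rfl⟩ := h.symm ▸ openSegment_subset_segment _ _ _ hx
    refine ⟨u, ⟨lt_of_le_of_ne hu.1 ?_, lt_of_le_of_ne hu.2 ?_⟩, rfl⟩
    · rintro rfl
      exact hne (left_mem_openSegment_iff.1 hx)
    · rintro rfl
      exact hne (right_mem_openSegment_iff.1 hx)
  · rintro ⟨u, hu, rfl⟩
    have hu' : u ∈ Icc (0 : ℝ) 1 := ⟨hs.trans hu.1.le, hu.2.le.trans ht⟩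
    have h1 : f u ∈ segment ℝ (f s) (f t) := h ▸ mem_image_of_mem f ⟨hu.1.le, hu.2.le⟩
    rw [← insert_endpoints_openSegment] at h1
    rcases h1 with h1 | h1 | h1
    · exact absurd (hinj hu' hs' h1) hu.1.ne'
    · exact absurd (hinj hu' ht' h1) hu.2.ne
    · exact h1

end Chains

/-- A subdivision of the curve `s` into line segments, such that all points of `N` on the curve are
vertices. -/
structure Subdivision (s N : Set Pt) where
  f : ℝ → ℂ
  injOn : InjOn f (Icc 0 1)
  image_eq : f '' Icc 0 1 = toC '' s
  k : ℕ
  c : ℕ → ℝ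
  c_zero : c 0 = 0
  c_last : c k = 1
  strictMonoOn : StrictMonoOn c (Iic k)
  exists_vertex : ∀ x ∈ N ∩ s, ∃ m ≤ k, f (c m) = toC x
  image_Icc : ∀ m < k, f '' Icc (c m) (c (m + 1)) = segment ℝ (f (c m)) (f (c (m + 1)))
  first : ∃ x, IsEndpoint s x ∧ f 0 = toC x
  last : ∃ x, IsEndpoint s x ∧ f 1 = toC x

lemma exists_subdivision_of_isPolygonalCurve {s N : Set Pt} (hs : IsPolygonalCurve s)
    (hN : N.Finite) : Nonempty (Subdivision s N) := by
  classical
  obtain ⟨⟨f, hf, hinj, rfl⟩, Q, hQ⟩ := hs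
  have hinj' : InjOn (fun t => toC (f t)) (Icc 0 1) := fun a ha b hb h =>
    hinj ha hb (toC.injective h)
  have himg : (fun t => toC (f t)) '' Icc 0 1 = toC '' (f '' Icc 0 1) := by
    rw [image_image]
  have hQ' : (fun t => toC (f t)) '' Icc 0 1 =
      ⋃ q ∈ Q.image (Prod.map toC toC), segment ℝ q.1 q.2 := by
    rw [himg, hQ, image_iUnion₂, Finset.set_biUnion_finset_image]
    exact iUnion₂_congr fun q _ => image_segment ℝ toC.toLinearMap.toAffineMap q.1 q.2
  obtain ⟨k, c, h0, h1, hc, hM, hseg⟩ := exists_subdivision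
    (f := fun t => toC (f t)) (toC.continuous.comp_continuousOn hf) hinj' hQ'
    (M := Icc 0 1 ∩ f ⁻¹' N) (Finite.of_finite_image (f := f)
      (hN.subset (by rintro _ ⟨t, ht, rfl⟩; exact ht.2)) (hinj.mono inter_subset_left))
    inter_subset_left
  refine ⟨⟨_, hinj', himg, k, c, h0, h1, hc, ?_, hseg, ⟨f 0, ⟨f, hf, hinj, rfl, Or.inl rfl⟩, rfl⟩,
    ⟨f 1, ⟨f, hf, hinj, rfl, Or.inr rfl⟩, rfl⟩⟩⟩
  rintro _ ⟨hx, t, ht, rfl⟩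
  obtain ⟨m, hm, rfl⟩ := hM t ⟨ht, hx⟩
  exact ⟨m, hm, rfl⟩

namespace Subdivision

variable {s N : Set Pt} (D : Subdivision s N)

lemma c_mem {m : ℕ} (hm : m ≤ D.k) : D.c m ∈ Icc (0 : ℝ) 1 := by
  rw [← D.c_zero, ← D.c_last]
  exact ⟨D.strictMonoOn.monotoneOn (mem_Iic.2 (Nat.zero_le _)) (mem_Iic.2 hm) (Nat.zero_le _),
    D.strictMonoOn.monotoneOn (mem_Iic.2 hm) (mem_Iic.2 le_rfl) hm⟩

lemma c_lt {m : ℕ} (hm : m < D.k) : D.c m < D.c (m + 1) :=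
  D.strictMonoOn (mem_Iic.2 hm.le) (mem_Iic.2 hm) (Nat.lt_succ_self m)

lemma Ioo_subset {m : ℕ} (hm : m < D.k) : Ioo (D.c m) (D.c (m + 1)) ⊆ Icc 0 1 := fun _ ht =>
  ⟨(D.c_mem hm.le).1.trans ht.1.le, ht.2.le.trans (D.c_mem hm).2⟩

lemma openSegment_eq {m : ℕ} (hm : m < D.k) :
    openSegment ℝ (D.f (D.c m)) (D.f (D.c (m + 1))) = D.f '' Ioo (D.c m) (D.c (m + 1)) :=
  openSegment_eq_image_Ioo D.injOn (D.c_mem hm.le).1 (D.c_lt hm) (D.c_mem hm).2 (D.image_Icc m hm)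

lemma vertex_inj {m m' : ℕ} (hm : m ≤ D.k) (hm' : m' ≤ D.k) (h : D.f (D.c m) = D.f (D.c m')) :
    m = m' :=
  D.strictMonoOn.injOn (mem_Iic.2 hm) (mem_Iic.2 hm') (D.injOn (D.c_mem hm) (D.c_mem hm') h)

lemma vertex_mem {m : ℕ} (hm : m ≤ D.k) : D.f (D.c m) ∈ toC '' s :=
  D.image_eq ▸ mem_image_of_mem _ (D.c_mem hm)

lemma segment_subset {m : ℕ} (hm : m < D.k) :
    segment ℝ (D.f (D.c m)) (D.f (D.c (m + 1))) ⊆ toC '' s := by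
  rw [← D.image_Icc m hm, ← D.image_eq]
  exact image_mono (Icc_subset_Icc (D.c_mem hm.le).1 (D.c_mem hm).2)

lemma vertex_notMem {m l : ℕ} (hm : m < D.k) (hl : l ≤ D.k) :
    D.f (D.c l) ∉ openSegment ℝ (D.f (D.c m)) (D.f (D.c (m + 1))) := by
  rw [D.openSegment_eq hm]
  rintro ⟨t, ht, h⟩
  obtain rfl := D.injOn (D.Ioo_subset hm ht) (D.c_mem hl) h
  have h1 := (D.strictMonoOn.lt_iff_lt (mem_Iic.2 hm.le) (mem_Iic.2 hl)).1 ht.1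
  have h2 := (D.strictMonoOn.lt_iff_lt (mem_Iic.2 hl) (mem_Iic.2 hm)).1 ht.2
  omega

lemma notMem_openSegment {x : Pt} (hx : x ∈ N ∩ s) {m : ℕ} (hm : m < D.k) :
    toC x ∉ openSegment ℝ (D.f (D.c m)) (D.f (D.c (m + 1))) := by
  obtain ⟨l, hl, h⟩ := D.exists_vertex x hx
  exact h ▸ D.vertex_notMem hm hl

lemma disjoint_of_lt {m m' : ℕ} (hm' : m' < D.k) (h : m < m') :
    Disjoint (openSegment ℝ (D.f (D.c m)) (D.f (D.c (m + 1))))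
      (openSegment ℝ (D.f (D.c m')) (D.f (D.c (m' + 1)))) := by
  have hm := h.trans hm'
  rw [D.openSegment_eq hm, D.openSegment_eq hm', Set.disjoint_left]
  rintro _ ⟨t, ht, rfl⟩ ⟨u, hu, h'⟩
  obtain rfl := D.injOn (D.Ioo_subset hm' hu) (D.Ioo_subset hm ht) h'
  have := D.strictMonoOn.monotoneOn (mem_Iic.2 hm) (mem_Iic.2 hm'.le) h
  linarith [ht.2, hu.1]

end Subdivision

lemma exists_arrangement {n : ℕ} {S : Fin n → Set Pt} {color : Fin n → Bool}
    (hcurve : ∀ i, IsPolygonalCurve (S i))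
    (h1int : ∀ i j : Fin n, i ≠ j → (S i ∩ S j).Subsingleton)
    (hsame : ∀ i j : Fin n, i ≠ j → color i = color j → Disjoint (S i) (S j)) :
    ∃ A : Arrangement n, A.Realizes S := by
  have hfin : ∀ i, (⋃ j : Fin n, ⋃ _ : i ≠ j, S i ∩ S j).Finite := fun i =>
    finite_iUnion fun j => finite_iUnion fun h => (h1int i j h).finite
  have D : ∀ i, Subdivision (S i) (⋃ j : Fin n, ⋃ _ : i ≠ j, S i ∩ S j) := fun i =>
    (exists_subdivision_of_isPolygonalCurve (hcurve i) (hfin i)).some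
  have hN : ∀ i j x, i ≠ j → x ∈ S i → x ∈ S j →
      x ∈ (⋃ j : Fin n, ⋃ _ : i ≠ j, S i ∩ S j) ∩ S i := fun i j x hij hi hj =>
    ⟨mem_iUnion₂.2 ⟨j, hij, hi, hj⟩, hi⟩
  have hcommon : ∀ {i j m m'}, m ≤ (D i).k → m' ≤ (D j).k →
      (D i).f ((D i).c m) = (D j).f ((D j).c m') →
      ∃ x ∈ S i ∩ S j, toC x = (D i).f ((D i).c m) := by
    intro i j m m' hm hm' h
    obtain ⟨x, hx, hx'⟩ := (D i).vertex_mem hm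
    obtain ⟨y, hy, hy'⟩ := (D j).vertex_mem hm'
    obtain rfl := toC.injective ((hx'.trans h).trans hy'.symm)
    exact ⟨x, ⟨hx, hy⟩, hx'⟩
  refine ⟨⟨color, fun i => (D i).k, fun i m => (D i).f ((D i).c m), ?_, ?_, ?_, ?_, ?_⟩,
    ?_, ?_, ?_, ?_⟩
  · exact fun i m m' hm hm' h => (D i).vertex_inj hm hm' h
  · intro i m j l hm hl hmem
    by_cases hij : i = j
    · subst hij
      exact (D i).vertex_notMem hm hl hmem
    · obtain ⟨x, hx, hx'⟩ := (D i).segment_subset hm (openSegment_subset_segment _ _ _ hmem)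
      obtain ⟨y, hy, hy'⟩ := (D j).vertex_mem hl
      obtain rfl := toC.injective (hx'.trans hy'.symm)
      exact (D i).notMem_openSegment (hN i j x hij hx hy) hm (hx' ▸ hmem)
  · intro i m j m' hm hm' h
    by_cases hij : i = j
    · subst hij
      rcases lt_or_gt_of_ne (h.resolve_left fun h => h rfl) with h' | h'
      · exact (D i).disjoint_of_lt hm' h'
      · exact ((D i).disjoint_of_lt hm h').symm
    · rw [Set.disjoint_left]
      intro z hz hz'
      obtain ⟨x, hx, rfl⟩ := (D i).segment_subset hm (openSegment_subset_segment _ _ _ hz)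
      obtain ⟨y, hy, hy'⟩ := (D j).segment_subset hm' (openSegment_subset_segment _ _ _ hz')
      obtain rfl := toC.injective hy'
      exact (D i).notMem_openSegment (hN i j _ hij hx hy) hm hz
  · intro i m j m' hij hm hm' h hc
    obtain ⟨x, hx, -⟩ := hcommon hm hm' h
    exact Set.disjoint_left.1 (hsame i j hij hc) hx.1 hx.2
  · intro i j m m' l l' hij hm hm' hl hl' h h'
    obtain ⟨x, hx, hx'⟩ := hcommon hm hm' h
    obtain ⟨y, hy, hy'⟩ := hcommon hl hl' h'
    obtain rfl := h1int i j hij hx hy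
    exact (D i).vertex_inj hm hl (hx'.symm.trans hy')
  · exact fun i m hm => (D i).segment_subset hm
  · exact fun i j hij x hx => (D i).exists_vertex x (hN i j x hij hx.1 hx.2)
  · intro i
    simp only [(D i).c_zero]
    exact (D i).first
  · intro i
    simp only [(D i).c_last]
    exact (D i).last

end TouchingCurves

theorem stmt0 (n : ℕ) (S : Fin n → Set Pt) (color : Fin n → Bool)
    (hcurve : ∀ i, IsPolygonalCurve (S i))
    (hinj : Function.Injective S)
    (h1int : ∀ i j : Fin n, i ≠ j → (S i ∩ S j).Subsingleton)
    (hsame : ∀ i j : Fin n, i ≠ j → color i = color j → Disjoint (S i) (S j)) :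
    {P : Finset (Fin n) | P.card = 2 ∧
      ∃ i ∈ P, ∃ j ∈ P, i ≠ j ∧ (Touches (S i) (S j) ∨ Touches (S j) (S i))}.ncard
      ≤ 11 * n := by
  classical
  obtain ⟨A, hA⟩ := TouchingCurves.exists_arrangement hcurve h1int hsame
  have h : {P : Finset (Fin n) | P.card = 2 ∧ ∃ i ∈ P, ∃ j ∈ P, i ≠ j ∧
      (Touches (S i) (S j) ∨ Touches (S j) (S i))} ⊆ (A.touchPairs : Set (Finset (Fin n))) := by
    rintro P ⟨hP, i, hi, j, hj, hij, ht⟩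
    have hPij : P = {i, j} := by
      refine (Finset.eq_of_subset_of_card_le ?_ ?_).symm
      · simp [Finset.insert_subset_iff, hi, hj]
      · rw [hP, Finset.card_pair hij]
    simp only [TouchingCurves.Arrangement.touchPairs, Finset.coe_filter, Finset.mem_univ, true_and,
      mem_ofPred_eq]
    rcases ht with ht | ht
    · exact ⟨i, j, hPij, hA.touch hij ht⟩
    · exact ⟨j, i, hPij.trans (Finset.pair_comm ..), hA.touch hij.symm ht⟩
  have h1 := Set.ncard_le_ncard h (Finset.finite_toSet _)
  rw [Set.ncard_coe_finset] at h1
  have h2 := A.card_touchPairs_le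
  omega
end

section
/- Let S be a finite family of n curves in the plane, each colored red or blue, such that every pair of curves in S intersects in at most one point and no two curves of the same color intersect. Let C be a family of pairwise disjoint curves such that each c ∈ C intersects exactly two members of S, these two members of S are disjoint from each other, and distinct members of C intersect distinct pairs of members of S. Then |C| ≤ 11n − 11. -/
open Set

/-- The coboundary over `ZMod 2` of a function on the endpoints of a family of edges. -/
def coboundary {E V : Type*} (s t : E → V) : (V → ZMod 2) →ₗ[ZMod 2] (E → ZMod 2) where
  toFun h e := h (s e) + h (t e)
  map_add' g h := by ext e; simp only [Pi.add_apply]; ring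
  map_smul' c h := by ext e; simp only [Pi.smul_apply, smul_eq_mul, RingHom.id_apply]; ring

@[simp] theorem coboundary_apply {E V : Type*} (s t : E → V) (h : V → ZMod 2) (e : E) :
    coboundary s t h e = h (s e) + h (t e) := rfl

open Classical in
/-- The boundary map over `ZMod 2` of a finite multigraph. -/
noncomputable def edgeBoundary {E V : Type*} [Fintype E] (s t : E → V) :
    (E → ZMod 2) →ₗ[ZMod 2] (V → ZMod 2) where
  toFun z v := ∑ e, z e * ((if s e = v then 1 else 0) + (if t e = v then 1 else 0))
  map_add' y z := by
    ext v; simp only [Pi.add_apply, add_mul, Finset.sum_add_distrib]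
  map_smul' c z := by
    ext v; simp only [Pi.smul_apply, smul_eq_mul, RingHom.id_apply, mul_assoc, Finset.mul_sum]

open Classical in
theorem edgeBoundary_apply {E V : Type*} [Fintype E] (s t : E → V) (z : E → ZMod 2) (v : V) :
    edgeBoundary s t z v =
      ∑ e, z e * ((if s e = v then 1 else 0) + (if t e = v then 1 else 0)) := rfl

/-- A finite multigraph has a dual if its cycle space over `ZMod 2` is the cut space of a
multigraph with the same edges. -/
def HasDual {E V : Type*} [Fintype E] (s t : E → V) : Prop :=
  ∃ (F : Type) (l r : E → F), LinearMap.ker (edgeBoundary s t) = LinearMap.range (coboundary l r)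

theorem card_le_card_add_finrank_ker {E V : Type*} [Fintype E] [Fintype V] (s t : E → V) :
    Fintype.card E ≤
      Fintype.card V + Module.finrank (ZMod 2) (LinearMap.ker (edgeBoundary s t)) := by
  have h := LinearMap.finrank_range_add_finrank_ker (edgeBoundary s t)
  have h2 := Submodule.finrank_le (LinearMap.range (edgeBoundary s t))
  simp only [Module.finrank_fintype_fun_eq_card] at h h2
  omega

open Classical in
/-- In a cut space every edge lies in at most two vertex cuts, so large cuts force many edges. -/
theorem mul_finrank_range_coboundary_le {E F : Type*} [Fintype E] (l r : E → F) (g : ℕ)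
    (hg : ∀ h : F → ZMod 2, coboundary l r h ≠ 0 →
      g ≤ (Finset.univ.filter fun e => coboundary l r h e ≠ 0).card) :
    g * Module.finrank (ZMod 2) (LinearMap.range (coboundary l r)) ≤ 2 * Fintype.card E := by
  set S : Finset F := Finset.univ.image l ∪ Finset.univ.image r with hS
  set B : F → E → ZMod 2 := fun f => coboundary l r (Pi.single f 1) with hB
  have hspan : LinearMap.range (coboundary l r) = Submodule.span (ZMod 2) (B '' S) := by
    apply le_antisymm
    · rintro _ ⟨h, rfl⟩
      have : coboundary l r h = ∑ f ∈ S, h f • B f := by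
        ext e
        have hl : l e ∈ S := by simp [hS]
        have hr : r e ∈ S := by simp [hS]
        simp only [coboundary_apply, hB, Finset.sum_apply, Pi.smul_apply, smul_eq_mul, mul_add,
          Finset.sum_add_distrib, Pi.single_apply, mul_ite, mul_one, mul_zero,
          Finset.sum_ite_eq, hl, hr, if_true]
      rw [this]
      exact Submodule.sum_mem _ fun f hf =>
        Submodule.smul_mem _ _ (Submodule.subset_span ⟨f, hf, rfl⟩)
    · rw [Submodule.span_le]
      rintro _ ⟨f, -, rfl⟩
      exact ⟨_, rfl⟩
  obtain ⟨b, hbS, hbspan, hbli⟩ := exists_linearIndependent (ZMod 2) (B '' (S : Set F))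
  have hbfin : b.Finite := (S.finite_toSet.image B).subset hbS
  obtain ⟨T, hTS, hTb⟩ : ∃ T : Finset F, T ⊆ S ∧ Set.BijOn B T b := by
    obtain ⟨T, hT, hbij⟩ := Set.exists_subset_bijOn (f := B) (s := (S : Set F) ∩ B ⁻¹' b)
    have him : B '' ((S : Set F) ∩ B ⁻¹' b) = b := by
      rw [Set.image_inter_preimage]; exact Set.inter_eq_right.2 hbS
    rw [him] at hbij
    have hTfin : T.Finite := S.finite_toSet.subset (hT.trans Set.inter_subset_left)
    refine ⟨hTfin.toFinset, ?_, by simpa using hbij⟩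
    intro f hf
    exact (hT (by simpa using hf)).1
  have hrank : Module.finrank (ZMod 2) (LinearMap.range (coboundary l r)) = T.card := by
    have : Fintype b := hbfin.fintype
    rw [hspan, ← hbspan, finrank_span_set_eq_card hbli, Set.toFinset_card,
      ← Nat.card_eq_fintype_card]
    rw [← Nat.card_congr hTb.equiv]
    simp
  have hne : ∀ f ∈ T, B f ≠ 0 := by
    intro f hf h0
    have := hbli.ne_zero (⟨B f, hTb.mapsTo hf⟩ : b)
    exact this h0
  rw [hrank]
  calc g * T.card = ∑ f ∈ T, g := by rw [Finset.sum_const, smul_eq_mul, mul_comm]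
    _ ≤ ∑ f ∈ T, (Finset.univ.filter fun e => B f e ≠ 0).card :=
        Finset.sum_le_sum fun f hf => hg _ (hne f hf)
    _ = ∑ f ∈ T, ∑ e : E, if B f e ≠ 0 then 1 else 0 := by
        simp only [Finset.card_filter]
    _ = ∑ e : E, ∑ f ∈ T, if B f e ≠ 0 then 1 else 0 := Finset.sum_comm
    _ ≤ ∑ e : E, 2 := by
        refine Finset.sum_le_sum fun e _ => ?_
        rw [← Finset.card_filter]
        refine (Finset.card_le_card (t := {l e, r e}) ?_).trans Finset.card_le_two
        intro f hf
        simp only [Finset.mem_filter] at hf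
        by_contra hc
        simp only [Finset.mem_insert, Finset.mem_singleton, not_or] at hc
        exact hf.2 (by simp [hB, Ne.symm hc.1, Ne.symm hc.2])
    _ = 2 * Fintype.card E := by simp [mul_comm]

theorem HasDual.mul_card_le {E V : Type*} [Fintype E] [Fintype V] {s t : E → V}
    (hd : HasDual s t) (g : ℕ)
    (hg : ∀ z, edgeBoundary s t z = 0 → z ≠ 0 → g ≤ (Finset.univ.filter fun e => z e ≠ 0).card) :
    g * Fintype.card E ≤ g * Fintype.card V + 2 * Fintype.card E := by
  obtain ⟨F, l, r, h⟩ := hd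
  have h1 := card_le_card_add_finrank_ker s t
  have h2 := mul_finrank_range_coboundary_le l r g fun k hk => by
    have hk' : coboundary l r k ∈ LinearMap.ker (edgeBoundary s t) := h ▸ ⟨k, rfl⟩
    convert hg _ hk' hk
  rw [h] at h1
  nlinarith [Nat.mul_le_mul_left g h1]

/-- In a cycle over `ZMod 2` no vertex has degree one. -/
theorem exists_other_edge {E V : Type*} [Fintype E] {s t : E → V} (hst : ∀ e, s e ≠ t e)
    {z : E → ZMod 2} (hz : edgeBoundary s t z = 0) {e : E} (he : z e ≠ 0) {v : V}
    (hv : v ∈ s(s e, t e)) : ∃ e', e' ≠ e ∧ z e' ≠ 0 ∧ v ∈ s(s e', t e') := by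
  classical
  by_contra! hc
  have h0 := congrFun hz v
  rw [edgeBoundary_apply, Finset.sum_eq_single e] at h0
  · have h1 : ((if s e = v then 1 else 0) + (if t e = v then 1 else 0) : ZMod 2) = 1 := by
      have := hst e
      rcases Sym2.mem_iff.1 hv with rfl | rfl
      · simp [this.symm]
      · simp [this]
    rw [h1, mul_one] at h0
    exact he h0
  · intro e' _ hne
    by_cases hz' : z e' = 0
    · simp [hz']
    · have := hc e' hne hz'
      rw [Sym2.mem_iff, not_or] at this
      simp [Ne.symm this.1, Ne.symm this.2]
  · simp

theorem exists_other_vertex {V : Type*} {a b v : V} (hab : a ≠ b) (hv : v ∈ s(a, b)) :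
    ∃ w, w ≠ v ∧ s(a, b) = s(v, w) := by
  rcases Sym2.mem_iff.1 hv with rfl | rfl
  · exact ⟨b, hab.symm, rfl⟩
  · exact ⟨a, hab, Sym2.eq_swap⟩

section Girth

variable {E V : Type*} [Fintype E] {s t : E → V} {z : E → ZMod 2}

theorem exists_path_of_cycle (hst : ∀ e, s e ≠ t e)
    (hinj : Function.Injective fun e => s(s e, t e))
    (hz : edgeBoundary s t z = 0) (h0 : z ≠ 0) :
    ∃ e₁ e₂ u v w, z e₁ ≠ 0 ∧ z e₂ ≠ 0 ∧ s(s e₁, t e₁) = s(u, v) ∧ s(s e₂, t e₂) = s(v, w) ∧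
      u ≠ v ∧ v ≠ w ∧ u ≠ w := by
  obtain ⟨e, he⟩ := Function.ne_iff.1 h0
  obtain ⟨e', hne, he', hv⟩ := exists_other_edge hst hz he (Sym2.mem_mk_right (s e) (t e))
  obtain ⟨w, hw, hew⟩ := exists_other_vertex (hst e') hv
  refine ⟨e, e', s e, t e, w, he, he', rfl, hew, hst e, hw.symm, ?_⟩
  rintro rfl
  exact hne (hinj (hew.trans Sym2.eq_swap))

theorem three_le_card_of_cycle (hst : ∀ e, s e ≠ t e)
    (hinj : Function.Injective fun e => s(s e, t e))
    (hz : edgeBoundary s t z = 0) (h0 : z ≠ 0) :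
    3 ≤ (Finset.univ.filter fun e => z e ≠ 0).card := by
  obtain ⟨e₁, e₂, u, v, w, h₁, h₂, h₁', h₂', huv, hvw, huw⟩ := exists_path_of_cycle hst hinj hz h0
  obtain ⟨e₃, hne, h₃, hw⟩ := exists_other_edge hst hz h₂ (v := w) (by rw [h₂']; simp)
  refine Finset.two_lt_card.2 ⟨e₁, by simpa, e₂, by simpa, e₃, by simpa, ?_, ?_, hne.symm⟩
  · rintro rfl
    rw [h₁'] at h₂'
    have : u ∈ s(v, w) := h₂' ▸ Sym2.mem_mk_left u v
    simp [huv, huw] at this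
  · rintro rfl
    rw [h₁'] at hw
    simp [huw.symm, hvw.symm] at hw

theorem four_le_card_of_cycle (hst : ∀ e, s e ≠ t e)
    (hinj : Function.Injective fun e => s(s e, t e))
    (col : V → Bool) (hcol : ∀ e, col (s e) ≠ col (t e))
    (hz : edgeBoundary s t z = 0) (h0 : z ≠ 0) :
    4 ≤ (Finset.univ.filter fun e => z e ≠ 0).card := by
  classical
  have hc : ∀ e u v, s(s e, t e) = s(u, v) → col u ≠ col v := by
    intro e u v h
    rcases Sym2.eq_iff.1 h with ⟨rfl, rfl⟩ | ⟨rfl, rfl⟩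
    · exact hcol e
    · exact (hcol e).symm
  obtain ⟨e₁, e₂, u, v, w, h₁, h₂, h₁', h₂', huv, hvw, huw⟩ := exists_path_of_cycle hst hinj hz h0
  obtain ⟨e₃, h32, h₃, hw⟩ := exists_other_edge hst hz h₂ (v := w) (by rw [h₂']; simp)
  obtain ⟨e₄, h41, h₄, hu⟩ := exists_other_edge hst hz h₁ (v := u) (by rw [h₁']; simp)
  have h12 : e₁ ≠ e₂ := by
    rintro rfl
    rw [h₁'] at h₂'
    have : u ∈ s(v, w) := h₂' ▸ Sym2.mem_mk_left u v
    simp [huv, huw] at this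
  have h31 : e₃ ≠ e₁ := by
    rintro rfl
    rw [h₁'] at hw
    simp [huw.symm, hvw.symm] at hw
  have h42 : e₄ ≠ e₂ := by
    rintro rfl
    rw [h₂'] at hu
    simp [huw, huv] at hu
  have h43 : e₄ ≠ e₃ := by
    rintro rfl
    have h := (Sym2.mem_and_mem_iff huw).1 ⟨hu, hw⟩
    have a := hc _ _ _ h
    have b := hc _ _ _ h₁'
    have c := hc _ _ _ h₂'
    revert a b c
    cases col u <;> cases col v <;> cases col w <;> simp
  have : ({e₁, e₂, e₃, e₄} : Finset E) ⊆ Finset.univ.filter fun e => z e ≠ 0 := by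
    intro e he
    simp only [Finset.mem_insert, Finset.mem_singleton] at he
    rcases he with rfl | rfl | rfl | rfl <;> simpa
  refine le_trans (le_of_eq ?_) (Finset.card_le_card this)
  rw [Finset.card_insert_of_notMem, Finset.card_insert_of_notMem, Finset.card_insert_of_notMem,
    Finset.card_singleton]
  · simpa using h43.symm
  · simpa using ⟨h32.symm, h42.symm⟩
  · simpa using ⟨h12, h31.symm, h41.symm⟩

end Girth

theorem HasDual.card_le_three_mul {E V : Type*} [Fintype E] [Fintype V] {s t : E → V}
    (hd : HasDual s t) (hst : ∀ e, s e ≠ t e) (hinj : Function.Injective fun e => s(s e, t e)) :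
    Fintype.card E ≤ 3 * Fintype.card V := by
  have := hd.mul_card_le 3 fun z hz h0 => three_le_card_of_cycle hst hinj hz h0
  omega

theorem HasDual.card_le_two_mul {E V : Type*} [Fintype E] [Fintype V] {s t : E → V}
    (hd : HasDual s t) (hinj : Function.Injective fun e => s(s e, t e))
    (col : V → Bool) (hcol : ∀ e, col (s e) ≠ col (t e)) :
    Fintype.card E ≤ 2 * Fintype.card V := by
  have := hd.mul_card_le 4 fun z hz h0 =>
    four_le_card_of_cycle (fun e h => hcol e (congrArg col h)) hinj col hcol hz h0
  omega

/-- Edges of the square grid: `(p, false)` points right from `p`, `(p, true)` points up. -/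
abbrev GridEdge : Type := (ℤ × ℤ) × Bool

namespace GridEdge

def src (a : GridEdge) : ℤ × ℤ := a.1

def tgt (a : GridEdge) : ℤ × ℤ := if a.2 then (a.1.1, a.1.2 + 1) else (a.1.1 + 1, a.1.2)

/-- One of the two unit squares bordering an edge; squares are named by their lower left corner. -/
def left (a : GridEdge) : ℤ × ℤ := a.1

def right (a : GridEdge) : ℤ × ℤ := if a.2 then (a.1.1 - 1, a.1.2) else (a.1.1, a.1.2 - 1)

/-- The boundary of a chain of grid edges over `ZMod 2`. -/
noncomputable def bdry : (GridEdge →₀ ZMod 2) →ₗ[ZMod 2] (ℤ × ℤ →₀ ZMod 2) :=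
  Finsupp.linearCombination (ZMod 2) fun a => Finsupp.single a.src 1 + Finsupp.single a.tgt 1

@[simp] theorem bdry_single (a : GridEdge) (c : ZMod 2) :
    bdry (Finsupp.single a c) = c • (Finsupp.single a.src 1 + Finsupp.single a.tgt 1) := by
  simp [bdry]

theorem bdry_apply (γ : GridEdge →₀ ZMod 2) (i j : ℤ) :
    bdry γ (i, j) = γ ((i, j), false) + γ ((i - 1, j), false) + γ ((i, j), true)
      + γ ((i, j - 1), true) := by
  induction γ using Finsupp.induction_linear with
  | zero => simp
  | add f g hf hg => rw [map_add, Finsupp.add_apply, hf, hg]; simp only [Finsupp.add_apply]; ring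
  | single a c =>
    obtain ⟨⟨x, y⟩, b⟩ := a
    cases b
    · have h : (x + 1 = i ∧ y = j) ↔ (x = i - 1 ∧ y = j) := by constructor <;> intro h <;> omega
      simp [src, tgt, Finsupp.single_apply, h]
    · have h : (x = i ∧ y + 1 = j) ↔ (x = i ∧ y = j - 1) := by constructor <;> intro h <;> omega
      simp [src, tgt, Finsupp.single_apply, h]

theorem bdry_eq_zero_of_eq_coboundary (γ : GridEdge →₀ ZMod 2) (h : ℤ × ℤ → ZMod 2)
    (hγ : ∀ a, γ a = h a.left + h a.right) : bdry γ = 0 := by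
  ext ⟨i, j⟩
  rw [bdry_apply]
  simp only [hγ, left, right, Bool.false_eq_true, if_false, if_true, Finsupp.coe_zero,
    Pi.zero_apply]
  have two : ∀ c : ZMod 2, c + c = 0 := CharTwo.add_self_eq_zero
  linear_combination two (h (i, j)) + two (h (i - 1, j)) + two (h (i, j - 1))
    + two (h (i - 1, j - 1))

/-- The grid is simply connected: every finite cycle bounds a set of squares. -/
theorem exists_eq_coboundary (γ : GridEdge →₀ ZMod 2) (hγ : bdry γ = 0) :
    ∃ h : ℤ × ℤ → ZMod 2, ∀ a : GridEdge, γ a = h a.left + h a.right := by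
  have two : ∀ c : ZMod 2, c + c = 0 := CharTwo.add_self_eq_zero
  obtain ⟨B, hB⟩ : ∃ B : ℤ, ∀ i j b, j ≤ B → γ ((i, j), b) = 0 := by
    obtain ⟨B, hB⟩ := ((γ.support.image fun a => a.1.2).finite_toSet).bddBelow
    refine ⟨B - 1, fun i j b hj => ?_⟩
    by_contra hne
    have := hB (a := j) (by
      simp only [Finset.coe_image, Set.mem_image, Finset.mem_coe, Finsupp.mem_support_iff]
      exact ⟨_, hne, rfl⟩)
    omega
  have hcyc : ∀ i j, γ ((i, j), false) + γ ((i - 1, j), false) + γ ((i, j), true)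
      + γ ((i, j - 1), true) = 0 := fun i j => by rw [← bdry_apply, hγ]; rfl
  set h : ℤ × ℤ → ZMod 2 := fun q => ∑ k ∈ Finset.Ioc B q.2, γ ((q.1, k), false) with hh
  have hlow : ∀ i j, j ≤ B → h (i, j) = 0 := by
    intro i j hj
    simp [hh, Finset.Ioc_eq_empty_of_le hj]
  have hstep : ∀ i j, γ ((i, j), false) = h (i, j) + h (i, j - 1) := by
    intro i j
    by_cases hj : j ≤ B
    · rw [hB i j _ hj, hlow i j hj, hlow i (j - 1) (by omega), add_zero]
    · have : Finset.Ioc B j = insert j (Finset.Ioc B (j - 1)) := by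
        ext k; simp only [Finset.mem_Ioc, Finset.mem_insert]; omega
      have e : h (i, j) = γ ((i, j), false) + h (i, j - 1) := by
        simp only [hh, this]
        rw [Finset.sum_insert (by simp)]
      rw [e]
      linear_combination - two (h (i, j - 1))
  refine ⟨h, ?_⟩
  rintro ⟨⟨i, j⟩, b⟩
  cases b
  · exact hstep i j
  · simp only [left, right, if_true]
    by_cases hj : j ≤ B
    · rw [hB i j _ hj, hlow _ _ hj, hlow _ _ hj, add_zero]
    · refine Int.leInduction (m := B)
        (motive := fun j _ => γ ((i, j), true) = h (i, j) + h (i - 1, j)) ?_ ?_ j (by omega)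
      · rw [hB i B _ le_rfl, hlow _ _ le_rfl, hlow _ _ le_rfl, add_zero]
      · intro k _ hk
        have h1 := hcyc i (k + 1)
        have h2 := hstep i (k + 1)
        have h3 := hstep (i - 1) (k + 1)
        rw [add_sub_cancel_right] at h1 h2 h3
        linear_combination h1 - h2 - h3 - hk - two (h (i, k + 1)) - two (h (i - 1, k + 1))
          - two (h (i, k)) - two (h (i - 1, k))

end GridEdge

/-- Connectedness of a set of grid points. -/
def GridConnected (N : Set (ℤ × ℤ)) : Prop :=
  ∀ g : ℤ × ℤ → Prop, (∀ a : GridEdge, a.src ∈ N → a.tgt ∈ N → (g a.src ↔ g a.tgt)) →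
    ∀ x ∈ N, ∀ y ∈ N, g x → g y

/-- Grid edges inside a set of grid points. -/
def innerEdges (N : Set (ℤ × ℤ)) : Set GridEdge := {a | a.src ∈ N ∧ a.tgt ∈ N}

theorem GridConnected.single_add_single_mem {N : Set (ℤ × ℤ)} (hN : GridConnected N)
    {x y : ℤ × ℤ} (hx : x ∈ N) (hy : y ∈ N) :
    Finsupp.single x 1 + Finsupp.single y 1 ∈
      (Finsupp.supported (ZMod 2) (ZMod 2) (innerEdges N)).map GridEdge.bdry := by
  refine hN (fun y => Finsupp.single x 1 + Finsupp.single y 1 ∈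
      (Finsupp.supported (ZMod 2) (ZMod 2) (innerEdges N)).map GridEdge.bdry) ?_ x hx y hy ?_
  · intro a hs ht
    have ha : Finsupp.single a.src 1 + Finsupp.single a.tgt 1 ∈
        (Finsupp.supported (ZMod 2) (ZMod 2) (innerEdges N)).map GridEdge.bdry :=
      ⟨Finsupp.single a 1, Finsupp.single_mem_supported _ _ ⟨hs, ht⟩, by simp⟩
    have e : (Finsupp.single x 1 + Finsupp.single a.tgt 1 : ℤ × ℤ →₀ ZMod 2)
        = (Finsupp.single x 1 + Finsupp.single a.src 1)
          + (Finsupp.single a.src 1 + Finsupp.single a.tgt 1) := by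
      rw [← add_assoc, add_assoc (Finsupp.single x 1), ← Finsupp.single_add,
        CharTwo.add_self_eq_zero, Finsupp.single_zero, add_zero]
    rw [e]
    exact (Submodule.add_mem_iff_left _ ha).symm
  · rw [← Finsupp.single_add, CharTwo.add_self_eq_zero, Finsupp.single_zero]
    exact Submodule.zero_mem _

section Minor

variable {E V : Type*} [Fintype E] {s t : E → V} {N : V → Set (ℤ × ℤ)} {ω : E → GridEdge}

open Classical in
/-- A minor of the grid has a dual. -/
theorem hasDual_of_gridMinor [Fintype V] (hst : ∀ e, s e ≠ t e)
    (hinj : Function.Injective fun e => s(s e, t e))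
    (hfin : ∀ v, (N v).Finite) (hne : ∀ v, (N v).Nonempty) (hconn : ∀ v, GridConnected (N v))
    (hdisj : ∀ v w x, x ∈ N v → x ∈ N w → v = w)
    (hω : ∀ e, ((ω e).src ∈ N (s e) ∧ (ω e).tgt ∈ N (t e)) ∨
      ((ω e).src ∈ N (t e) ∧ (ω e).tgt ∈ N (s e))) : HasDual s t := by
  have hωinj : Function.Injective ω := by
    intro e e' h
    apply hinj
    have h1 := hω e
    have h2 := hω e'
    rw [← h] at h2
    simp only [Sym2.eq_iff]
    rcases h1 with ⟨a, b⟩ | ⟨a, b⟩ <;> rcases h2 with ⟨c, d⟩ | ⟨c, d⟩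
    · exact Or.inl ⟨hdisj _ _ _ a c, hdisj _ _ _ b d⟩
    · exact Or.inr ⟨hdisj _ _ _ a c, hdisj _ _ _ b d⟩
    · exact Or.inr ⟨hdisj _ _ _ b d, hdisj _ _ _ a c⟩
    · exact Or.inl ⟨hdisj _ _ _ b d, hdisj _ _ _ a c⟩
  set I : Set GridEdge := ⋃ v, innerEdges (N v) with hI
  have hωI : ∀ e, ω e ∉ I := by
    intro e he
    obtain ⟨v, h1, h2⟩ := Set.mem_iUnion.1 he
    rcases hω e with ⟨a, b⟩ | ⟨a, b⟩
    · exact hst e ((hdisj _ _ _ a h1).trans (hdisj _ _ _ b h2).symm)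
    · exact hst e ((hdisj _ _ _ b h2).trans (hdisj _ _ _ a h1).symm)
  have hIfin : I.Finite := by
    have : (⋃ v, N v).Finite := Set.finite_iUnion hfin
    refine (this.prod (Set.finite_univ (α := Bool))).subset ?_
    intro a ha
    obtain ⟨v, h1, -⟩ := Set.mem_iUnion.1 ha
    exact ⟨Set.mem_iUnion.2 ⟨v, h1⟩, trivial⟩
  let rel : ℤ × ℤ → ℤ × ℤ → Prop := fun q q' => ∃ a : GridEdge, a ∉ I ∧ a ∉ Set.range ω ∧
    a.left = q ∧ a.right = q'
  let lift : (E → ZMod 2) → GridEdge →₀ ZMod 2 := fun z => ∑ e, Finsupp.single (ω e) (z e)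
  have hlift : ∀ z e, lift z (ω e) = z e := by
    intro z e
    simp only [lift, Finsupp.finsetSum_apply, Finsupp.single_apply, hωinj.eq_iff]
    simp
  have hlift0 : ∀ z a, a ∉ Set.range ω → lift z a = 0 := by
    intro z a ha
    simp only [lift, Finsupp.finsetSum_apply, Finsupp.single_apply]
    exact Finset.sum_eq_zero fun e _ => if_neg fun h => ha ⟨e, h⟩
  refine ⟨Quot rel, fun e => Quot.mk _ (ω e).left, fun e => Quot.mk _ (ω e).right, ?_⟩
  apply le_antisymm
  · intro z hz
    rw [LinearMap.mem_ker] at hz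
    choose x hx using hne
    set D := (Finsupp.supported (ZMod 2) (ZMod 2) I).map GridEdge.bdry with hD
    have hDv : ∀ v y, y ∈ N v → (Finsupp.single (x v) 1 + Finsupp.single y 1 :
        ℤ × ℤ →₀ ZMod 2) ∈ D := by
      intro v y hy
      refine Submodule.map_mono (Finsupp.supported_mono ?_)
        ((hconn v).single_add_single_mem (hx v) hy)
      exact Set.subset_iUnion (fun v => innerEdges (N v)) v
    have hmem : GridEdge.bdry (lift z) ∈ D := by
      have hsum : ∑ e, z e • (Finsupp.single (x (s e)) 1 + Finsupp.single (x (t e)) 1 :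
          ℤ × ℤ →₀ ZMod 2) = 0 := by
        have key : ∀ e, (Finsupp.single (x (s e)) 1 + Finsupp.single (x (t e)) 1 :
            ℤ × ℤ →₀ ZMod 2) = ∑ v, ((if s e = v then 1 else 0) + (if t e = v then 1 else 0) :
              ZMod 2) • Finsupp.single (x v) 1 := by
          intro e
          simp [add_smul, Finset.sum_add_distrib]
        simp only [key, Finset.smul_sum, smul_smul]
        rw [Finset.sum_comm]
        refine Finset.sum_eq_zero fun v _ => ?_
        rw [← Finset.sum_smul, ← edgeBoundary_apply, hz]
        simp
      have e1 : GridEdge.bdry (lift z) = GridEdge.bdry (lift z)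
          + ∑ e, z e • (Finsupp.single (x (s e)) 1 + Finsupp.single (x (t e)) 1 :
          ℤ × ℤ →₀ ZMod 2) := by rw [hsum, add_zero]
      rw [e1]
      simp only [lift, map_sum, GridEdge.bdry_single]
      rw [← Finset.sum_add_distrib]
      refine Submodule.sum_mem _ fun e _ => ?_
      rw [← smul_add]
      refine Submodule.smul_mem _ _ ?_
      rcases hω e with ⟨a, b⟩ | ⟨a, b⟩
      · convert Submodule.add_mem _ (hDv _ _ a) (hDv _ _ b) using 1
        abel
      · convert Submodule.add_mem _ (hDv _ _ a) (hDv _ _ b) using 1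
        abel
    obtain ⟨κ, hκ, hκz⟩ := hmem
    obtain ⟨h, hh⟩ := GridEdge.exists_eq_coboundary (lift z - κ) (by rw [map_sub, hκz, sub_self])
    have hκ0 : ∀ a, a ∉ I → κ a = 0 := fun a ha =>
      Finsupp.notMem_support_iff.1 fun h => ha (hκ h)
    refine ⟨Quot.lift h ?_, ?_⟩
    · rintro q q' ⟨a, haI, haω, rfl, rfl⟩
      have := hh a
      rw [Finsupp.sub_apply, hκ0 a haI, hlift0 z a haω, sub_zero] at this
      exact CharTwo.add_eq_zero.1 this.symm
    · ext e
      rw [coboundary_apply]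
      change h (ω e).left + h (ω e).right = z e
      rw [← hh, Finsupp.sub_apply, hκ0 _ (hωI e), hlift, sub_zero]
  · rintro _ ⟨h, rfl⟩
    rw [LinearMap.mem_ker]
    set z := coboundary (fun e => Quot.mk rel (ω e).left) (fun e => Quot.mk rel (ω e).right) h
      with hz
    set f : GridEdge → ZMod 2 := fun a => h (Quot.mk _ a.left) + h (Quot.mk _ a.right) with hf
    have hf0 : ∀ a, a ∉ I → a ∉ Set.range ω → f a = 0 := by
      intro a haI haω
      have : Quot.mk rel a.left = Quot.mk rel a.right := Quot.sound ⟨a, haI, haω, rfl, rfl⟩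
      rw [hf]
      simp only [this]
      exact CharTwo.add_self_eq_zero _
    have hffin : (Function.support f).Finite := by
      refine (hIfin.union (Set.finite_range ω)).subset fun a ha => ?_
      by_contra hc
      rw [Set.mem_union, not_or] at hc
      exact ha (hf0 a hc.1 hc.2)
    set γ : GridEdge →₀ ZMod 2 := Finsupp.ofSupportFinite f hffin with hγ
    have hγa : ∀ a, γ a = f a := fun a => rfl
    have hcyc : GridEdge.bdry γ = 0 :=
      GridEdge.bdry_eq_zero_of_eq_coboundary γ (fun q => h (Quot.mk _ q)) fun a => rfl
    have hsupp : γ - lift z ∈ Finsupp.supported (ZMod 2) (ZMod 2) I := by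
      rw [Finsupp.mem_supported]
      intro a ha
      by_contra haI
      rw [Finset.mem_coe, Finsupp.mem_support_iff, Finsupp.sub_apply, hγa] at ha
      apply ha
      by_cases haω : a ∈ Set.range ω
      · obtain ⟨e, rfl⟩ := haω
        rw [hlift]
        exact sub_self _
      · rw [hf0 a haI haω, hlift0 z a haω, sub_zero]
    ext v
    let Λ : (ℤ × ℤ →₀ ZMod 2) →ₗ[ZMod 2] ZMod 2 :=
      Finsupp.linearCombination (ZMod 2) fun p => if p ∈ N v then 1 else 0
    have hΛ : ∀ u ∈ Finsupp.supported (ZMod 2) (ZMod 2) I, Λ (GridEdge.bdry u) = 0 := by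
      intro u hu
      rw [Finsupp.supported_eq_span_single] at hu
      induction hu using Submodule.span_induction with
      | mem u hu =>
        obtain ⟨a, ha, rfl⟩ := hu
        obtain ⟨w, h1, h2⟩ := Set.mem_iUnion.1 ha
        have : a.src ∈ N v ↔ a.tgt ∈ N v :=
          ⟨fun h => hdisj _ _ _ h h1 ▸ h2, fun h => hdisj _ _ _ h h2 ▸ h1⟩
        simp [Λ, this, CharTwo.add_self_eq_zero]
      | zero => simp
      | add a b _ _ ha hb => rw [map_add, map_add, ha, hb, add_zero]
      | smul c a _ ha => rw [map_smul, map_smul, ha, smul_zero]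
    have h1 := hΛ _ hsupp
    rw [map_sub, hcyc, map_sub, map_zero, zero_sub, neg_eq_zero] at h1
    rw [edgeBoundary_apply, Pi.zero_apply]
    refine Eq.trans ?_ h1
    simp only [lift, map_sum, GridEdge.bdry_single, map_smul, smul_eq_mul, map_add]
    refine Finset.sum_congr rfl fun e _ => ?_
    have hiff : ∀ u p, p ∈ N u → (p ∈ N v ↔ u = v) := fun u p hp =>
      ⟨fun h => hdisj _ _ _ hp h, fun h => h ▸ hp⟩
    rcases hω e with ⟨a, b⟩ | ⟨a, b⟩
    · simp [Λ, hiff _ _ a, hiff _ _ b]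
    · simp [Λ, hiff _ _ a, hiff _ _ b, add_comm]

end Minor

section Absorb

variable {E V : Type*} [Finite E] {s t : E → V} {N : V → Set (ℤ × ℤ)}
  {M : E → Set (ℤ × ℤ)}

/-- Connecting sets of grid points may be absorbed into the sets at one of their ends. -/
theorem exists_gridMinor (hst : ∀ e, s e ≠ t e)
    (hNfin : ∀ v, (N v).Finite) (hMfin : ∀ e, (M e).Finite) (hne : ∀ v, (N v).Nonempty)
    (hN : ∀ v, GridConnected (N v)) (hM : ∀ e, GridConnected (M e))
    (hNN : ∀ v w x, x ∈ N v → x ∈ N w → v = w)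
    (hMN : ∀ e v x, x ∈ M e → x ∈ N v → v = s e ∨ v = t e)
    (hMM : ∀ e e' x, x ∈ M e → x ∈ M e' → e = e' ∨ ∃ v, x ∈ N v)
    (hs : ∀ e, (M e ∩ N (s e)).Nonempty) (ht : ∀ e, (M e ∩ N (t e)).Nonempty) :
    ∃ (N' : V → Set (ℤ × ℤ)) (ω : E → GridEdge), (∀ v, (N' v).Finite) ∧ (∀ v, (N' v).Nonempty) ∧
      (∀ v, GridConnected (N' v)) ∧ (∀ v w x, x ∈ N' v → x ∈ N' w → v = w) ∧
      (∀ e, ((ω e).src ∈ N' (s e) ∧ (ω e).tgt ∈ N' (t e)) ∨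
        ((ω e).src ∈ N' (t e) ∧ (ω e).tgt ∈ N' (s e))) := by
  -- the part of `M e` reachable from `N (s e)` outside `N (t e)`
  let Q : E → Set (ℤ × ℤ) := fun e => {y | y ∈ M e \ N (t e) ∧ ∀ g : ℤ × ℤ → Prop,
    (∀ x ∈ M e ∩ N (s e), g x) →
    (∀ a : GridEdge, a.src ∈ M e \ N (t e) → a.tgt ∈ M e \ N (t e) → (g a.src ↔ g a.tgt)) → g y}
  have hQ0 : ∀ e, M e ∩ N (s e) ⊆ Q e := fun e x hx =>
    ⟨⟨hx.1, fun h => hst e (hNN _ _ _ hx.2 h)⟩, fun g hg _ => hg x hx⟩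
  have hQadj : ∀ e (a : GridEdge), a.src ∈ M e \ N (t e) → a.tgt ∈ M e \ N (t e) →
      (a.src ∈ Q e ↔ a.tgt ∈ Q e) := fun e a h1 h2 =>
    ⟨fun h => ⟨h2, fun g hg hg' => (hg' a h1 h2).1 (h.2 g hg hg')⟩,
      fun h => ⟨h1, fun g hg hg' => (hg' a h1 h2).2 (h.2 g hg hg')⟩⟩
  have hQN : ∀ e v x, x ∈ Q e → x ∈ N v → v = s e := fun e v x hx hv =>
    (hMN e v x hx.1.1 hv).resolve_right fun h => hx.1.2 (h ▸ hv)
  have hQQ : ∀ e e' x, x ∈ Q e → x ∈ Q e' → s e = s e' := by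
    intro e e' x hx hx'
    rcases hMM e e' x hx.1.1 hx'.1.1 with rfl | ⟨v, hv⟩
    · rfl
    · rw [← hQN e v x hx hv, hQN e' v x hx' hv]
  have hω : ∀ e, ∃ a : GridEdge, (a.src ∈ Q e ∧ a.tgt ∈ N (t e)) ∨
      (a.src ∈ N (t e) ∧ a.tgt ∈ Q e) := by
    intro e
    by_contra! hc
    obtain ⟨x, hx⟩ := hs e
    obtain ⟨y, hy⟩ := ht e
    refine ((hM e (· ∈ Q e) ?_ x hx.1 y hy.1 (hQ0 e hx)).1.2) hy.2
    intro a h1 h2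
    by_cases h3 : a.src ∈ N (t e)
    · exact ⟨fun h => absurd h3 h.1.2, fun h => absurd h ((hc a).2 h3)⟩
    · by_cases h4 : a.tgt ∈ N (t e)
      · exact ⟨fun h => absurd h4 ((hc a).1 h), fun h => absurd h4 h.1.2⟩
      · exact hQadj e a ⟨h1, h3⟩ ⟨h2, h4⟩
  choose ω hω using hω
  let N' : V → Set (ℤ × ℤ) := fun v => N v ∪ ⋃ e ∈ {e | s e = v}, Q e
  have hN' : ∀ v x, x ∈ N' v ↔ x ∈ N v ∨ ∃ e, s e = v ∧ x ∈ Q e := by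
    intro v x; simp [N']
  refine ⟨N', ω, ?_, ?_, ?_, ?_, ?_⟩
  · intro v
    refine (hNfin v).union (Set.Finite.biUnion (Set.toFinite _) fun e _ => ?_)
    exact (hMfin e).subset fun x hx => hx.1.1
  · exact fun v => (hne v).mono Set.subset_union_left
  · intro v g hg
    obtain ⟨x₀, hx₀⟩ := hne v
    have hNv : ∀ x ∈ N v, ∀ y ∈ N v, g x → g y := hN v g fun a h1 h2 =>
      hg a ((hN' _ _).2 (Or.inl h1)) ((hN' _ _).2 (Or.inl h2))
    have key : ∀ y ∈ N' v, (g y ↔ g x₀) := by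
      intro y hy
      rcases (hN' _ _).1 hy with hy' | ⟨e, rfl, hy'⟩
      · exact ⟨hNv y hy' x₀ hx₀, hNv x₀ hx₀ y hy'⟩
      · refine hy'.2 (fun y => y ∈ Q e → (g y ↔ g x₀)) ?_ ?_ hy'
        · exact fun x hx _ => ⟨hNv x hx.2 x₀ hx₀, hNv x₀ hx₀ x hx.2⟩
        · intro a h1 h2
          have := hQadj e a h1 h2
          by_cases h : a.src ∈ Q e
          · have h' := this.1 h
            have := hg a ((hN' _ _).2 (Or.inr ⟨e, rfl, h⟩)) ((hN' _ _).2 (Or.inr ⟨e, rfl, h'⟩))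
            simp only [h, h', this]
          · have h' : a.tgt ∉ Q e := fun h' => h (this.2 h')
            simp only [h, h', false_imp_iff]
    exact fun x hx y hy hgx => (key y hy).2 ((key x hx).1 hgx)
  · intro v w x hv hw
    rcases (hN' _ _).1 hv with h | ⟨e, rfl, h⟩ <;>
      rcases (hN' _ _).1 hw with h' | ⟨e', rfl, h'⟩
    · exact hNN _ _ _ h h'
    · exact hQN _ _ _ h' h
    · exact (hQN _ _ _ h h').symm
    · exact hQQ _ _ _ h h'
  · intro e
    rcases hω e with ⟨h1, h2⟩ | ⟨h1, h2⟩
    · exact Or.inl ⟨(hN' _ _).2 (Or.inr ⟨e, rfl, h1⟩), (hN' _ _).2 (Or.inl h2)⟩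
    · exact Or.inr ⟨(hN' _ _).2 (Or.inl h1), (hN' _ _).2 (Or.inr ⟨e, rfl, h2⟩)⟩

end Absorb

/-- The open square of side `2 / n` around a point of the grid of mesh `1 / n`. -/
def gridBox (n : ℕ) (p : ℤ × ℤ) : Set Pt := {x | |n * x.1 - p.1| < 1 ∧ |n * x.2 - p.2| < 1}

/-- The points of the grid of mesh `1 / n` near a set. -/
def gridNbhd (n : ℕ) (K : Set Pt) : Set (ℤ × ℤ) := {p | (K ∩ gridBox n p).Nonempty}

theorem isOpen_gridBox (n : ℕ) (p : ℤ × ℤ) : IsOpen (gridBox n p) := by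
  have h1 : Continuous fun x : Pt => |n * x.1 - p.1| := by fun_prop
  have h2 : Continuous fun x : Pt => |n * x.2 - p.2| := by fun_prop
  exact (isOpen_lt h1 continuous_const).inter (isOpen_lt h2 continuous_const)

theorem exists_mem_gridBox (n : ℕ) (x : Pt) : ∃ p, x ∈ gridBox n p := by
  refine ⟨(⌊n * x.1⌋, ⌊n * x.2⌋), ?_, ?_⟩ <;>
  · rw [Int.self_sub_floor, abs_of_nonneg (Int.fract_nonneg _)]
    exact Int.fract_lt_one _

theorem dist_mul_lt_of_mem_gridBox {n : ℕ} {p : ℤ × ℤ} {x y : Pt} (hx : x ∈ gridBox n p)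
    (hy : y ∈ gridBox n p) : n * dist x y < 2 := by
  obtain ⟨h1, h2⟩ := hx
  obtain ⟨h3, h4⟩ := hy
  have hn : (0 : ℝ) ≤ n := n.cast_nonneg
  rw [Prod.dist_eq, Real.dist_eq, Real.dist_eq, mul_max_of_nonneg _ _ hn]
  rw [abs_lt] at h1 h2 h3 h4
  refine max_lt ?_ ?_
  · nth_rw 1 [← abs_of_nonneg hn]
    rw [← abs_mul, abs_lt, mul_sub]
    constructor <;> linarith
  · nth_rw 1 [← abs_of_nonneg hn]
    rw [← abs_mul, abs_lt, mul_sub]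
    constructor <;> linarith

theorem gridNbhd_nonempty (n : ℕ) {K : Set Pt} (hK : K.Nonempty) : (gridNbhd n K).Nonempty := by
  obtain ⟨x, hx⟩ := hK
  obtain ⟨p, hp⟩ := exists_mem_gridBox n x
  exact ⟨p, x, hx, hp⟩

theorem eventually_disjoint_gridNbhd {K L : Set Pt} (hK : IsCompact K) (hL : IsCompact L)
    (hKL : Disjoint K L) : ∀ᶠ n in Filter.atTop, Disjoint (gridNbhd n K) (gridNbhd n L) := by
  obtain ⟨δ, hδ, hd⟩ := hKL.exists_thickenings hK hL.isClosed
  obtain ⟨m, hm⟩ := exists_nat_gt (2 / δ)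
  filter_upwards [Filter.eventually_ge_atTop m] with n hn
  rw [Set.disjoint_left]
  rintro p ⟨x, hxK, hxp⟩ ⟨y, hyL, hyp⟩
  have h1 := dist_mul_lt_of_mem_gridBox hxp hyp
  have h2 : δ ≤ dist x y := by
    by_contra! hc
    exact Set.disjoint_left.1 hd (Metric.mem_thickening_iff.2 ⟨x, hxK, by rwa [dist_comm]⟩)
      (Metric.self_subset_thickening hδ L hyL)
  have h3 : 2 < m * δ := (div_lt_iff₀ hδ).1 hm
  have h4 : (m : ℝ) ≤ n := by exact_mod_cast hn
  nlinarith [dist_nonneg (x := x) (y := y)]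

theorem finite_gridNbhd (n : ℕ) {K : Set Pt} (hK : IsCompact K) : (gridNbhd n K).Finite := by
  obtain ⟨R, hR⟩ := hK.isBounded.subset_closedBall 0
  have hn : (0 : ℝ) ≤ n := n.cast_nonneg
  refine ((Set.finite_Icc (-(⌈n * R⌉ + 1)) (⌈n * R⌉ + 1)).prod
    (Set.finite_Icc (-(⌈n * R⌉ + 1)) (⌈n * R⌉ + 1))).subset ?_
  rintro p ⟨x, hxK, h1, h2⟩
  have hx := hR hxK
  rw [mem_closedBall_zero_iff, Prod.norm_def, max_le_iff, Real.norm_eq_abs, Real.norm_eq_abs] at hx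
  have hc := Int.le_ceil (n * R)
  have aux : ∀ (a : ℝ) (k : ℤ), |a| ≤ R → |n * a - k| < 1 →
      k ∈ Set.Icc (-(⌈n * R⌉ + 1)) (⌈n * R⌉ + 1) := by
    intro a k ha hk
    rw [abs_le] at ha
    rw [abs_lt] at hk
    have e1 := mul_le_mul_of_nonneg_left ha.1 hn
    have e2 := mul_le_mul_of_nonneg_left ha.2 hn
    constructor
    · have : (-(⌈n * R⌉ + 1) : ℝ) ≤ k := by linarith
      exact_mod_cast this
    · have : (k : ℝ) ≤ ⌈n * R⌉ + 1 := by linarith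
      exact_mod_cast this
  exact ⟨aux _ _ hx.1 h1, aux _ _ hx.2 h2⟩

theorem Int.eq_or_eq_of_abs_sub_lt_one {a : ℝ} {k l : ℤ} (hk : |a - k| < 1) (hl : |a - l| < 1) :
    k = l ∨ l = k + 1 ∨ k = l + 1 := by
  rw [abs_lt] at hk hl
  have h1 : (k : ℝ) < l + 2 := by linarith
  have h2 : (l : ℝ) < k + 2 := by linarith
  have h1' : k < l + 2 := by exact_mod_cast h1
  have h2' : l < k + 2 := by exact_mod_cast h2
  omega

theorem IsPreconnected.gridConnected_gridNbhd (n : ℕ) {K : Set Pt} (hK : IsPreconnected K) :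
    GridConnected (gridNbhd n K) := by
  intro g hg p hp q hq hgp
  have hbox : ∀ x ∈ K, ∀ p q, x ∈ gridBox n p → x ∈ gridBox n q → (g p ↔ g q) := by
    intro x hxK p q hp hq
    have hmid : x ∈ gridBox n (p.1, q.2) := ⟨hp.1, hq.2⟩
    have e1 : g p ↔ g (p.1, q.2) := by
      rcases Int.eq_or_eq_of_abs_sub_lt_one hp.2 hq.2 with h | h | h
      · rw [← h]
      · have := hg (p, true)
        simp only [GridEdge.src, GridEdge.tgt, if_true, ← h] at this
        exact this ⟨x, hxK, hp⟩ ⟨x, hxK, hmid⟩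
      · have := hg ((p.1, q.2), true)
        simp only [GridEdge.src, GridEdge.tgt, if_true, ← h] at this
        exact (this ⟨x, hxK, hmid⟩ ⟨x, hxK, hp⟩).symm
    have e2 : g (p.1, q.2) ↔ g q := by
      rcases Int.eq_or_eq_of_abs_sub_lt_one hp.1 hq.1 with h | h | h
      · rw [h]
      · have := hg ((p.1, q.2), false)
        simp only [GridEdge.src, GridEdge.tgt, Bool.false_eq_true, if_false, ← h] at this
        exact this ⟨x, hxK, hmid⟩ ⟨x, hxK, hq⟩
      · have := hg (q, false)
        simp only [GridEdge.src, GridEdge.tgt, Bool.false_eq_true, if_false, ← h] at this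
        exact (this ⟨x, hxK, hq⟩ ⟨x, hxK, hmid⟩).symm
    exact e1.trans e2
  obtain ⟨x, hxK, hxp⟩ := hp
  obtain ⟨y, hyK, hyq⟩ := hq
  by_contra hgq
  obtain ⟨z, hzK, h1, h2⟩ := hK (⋃ p ∈ {p | g p}, gridBox n p) (⋃ p ∈ {p | ¬ g p}, gridBox n p)
    (isOpen_biUnion fun _ _ => isOpen_gridBox _ _) (isOpen_biUnion fun _ _ => isOpen_gridBox _ _)
    (fun z _ => by
      obtain ⟨r, hr⟩ := exists_mem_gridBox n z
      by_cases h : g r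
      · exact Or.inl (Set.mem_biUnion (show r ∈ {p | g p} from h) hr)
      · exact Or.inr (Set.mem_biUnion (show r ∈ {p | ¬ g p} from h) hr))
    ⟨x, hxK, Set.mem_biUnion (show p ∈ {p | g p} from hgp) hxp⟩
    ⟨y, hyK, Set.mem_biUnion (show q ∈ {p | ¬ g p} from hgq) hyq⟩
  obtain ⟨r, hr, hzr⟩ := Set.mem_iUnion₂.1 h1
  obtain ⟨r', hr', hzr'⟩ := Set.mem_iUnion₂.1 h2
  exact hr' ((hbox z hzK r r' hzr hzr').1 hr)

theorem IsPreconnected.cthickening {K : Set Pt} (hK : IsPreconnected K) (hKc : IsCompact K)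
    {δ : ℝ} (hδ : 0 ≤ δ) : IsPreconnected (Metric.cthickening δ K) := by
  rw [← hKc.add_closedBall_zero hδ, ← Set.add_image_prod]
  exact (hK.prod (convex_closedBall 0 δ).isPreconnected).image _ continuous_add.continuousOn

/-- A finite multigraph drawn in the plane, with compact connected sets as vertices and edges, has
a dual if distinct edges meet only inside the vertices. -/
theorem hasDual_of_planar {E V : Type*} [Fintype E] [Fintype V] {s t : E → V}
    (K : V → Set Pt) (A : E → Set Pt) (hst : ∀ e, s e ≠ t e)
    (hinj : Function.Injective fun e => s(s e, t e))
    (hKc : ∀ v, IsCompact (K v)) (hAc : ∀ e, IsCompact (A e))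
    (hKp : ∀ v, IsConnected (K v)) (hAp : ∀ e, IsPreconnected (A e))
    (hKK : ∀ v w, v ≠ w → Disjoint (K v) (K w))
    (hAK : ∀ e v, v ≠ s e → v ≠ t e → Disjoint (A e) (K v))
    (hAA : ∀ e e', e ≠ e' → A e ∩ A e' ⊆ ⋃ v, K v)
    (hs : ∀ e, (A e ∩ K (s e)).Nonempty) (ht : ∀ e, (A e ∩ K (t e)).Nonempty) :
    HasDual s t := by
  classical
  have small : ∀ X Y : Set Pt, IsCompact X → IsCompact Y → Disjoint X Y →
      ∃ δ : ℝ, 0 < δ ∧ ∀ η ≤ δ, Disjoint (Metric.cthickening η X) (Metric.cthickening η Y) := by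
    intro X Y hX hY hXY
    obtain ⟨δ, hδ, h⟩ := hXY.exists_cthickenings hX hY.isClosed
    exact ⟨δ, hδ, fun η hη => h.mono (Metric.cthickening_mono hη _) (Metric.cthickening_mono hη _)⟩
  have small' : ∀ X Y : Set Pt, IsCompact X → IsCompact Y → Disjoint X Y →
      ∀ᶠ η in nhdsWithin (0 : ℝ) (Set.Ioi 0),
        Disjoint (Metric.cthickening η X) (Metric.cthickening η Y) := by
    intro X Y hX hY hXY
    obtain ⟨δ, hδ, h⟩ := small X Y hX hY hXY
    filter_upwards [Ioc_mem_nhdsGT hδ] with η hη using h η hη.2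
  have ev1 : ∀ᶠ η in nhdsWithin (0 : ℝ) (Set.Ioi 0), ∀ v w, v ≠ w →
      Disjoint (Metric.cthickening η (K v)) (Metric.cthickening η (K w)) := by
    simp only [Filter.eventually_all]
    exact fun v w h => small' _ _ (hKc v) (hKc w) (hKK v w h)
  have ev2 : ∀ᶠ η in nhdsWithin (0 : ℝ) (Set.Ioi 0), ∀ e v, v ≠ s e → v ≠ t e →
      Disjoint (Metric.cthickening η (A e)) (Metric.cthickening η (K v)) := by
    simp only [Filter.eventually_all]
    exact fun e v h h' => small' _ _ (hAc e) (hKc v) (hAK e v h h')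
  obtain ⟨η, hη, h1, h2⟩ := (eventually_mem_nhdsWithin.and (ev1.and ev2)).exists
  have hη0 : 0 < η := hη
  set K' : V → Set Pt := fun v => Metric.cthickening η (K v) with hK'
  have hK'c : ∀ v, IsCompact (K' v) := fun v => (hKc v).cthickening
  set U : Set Pt := ⋃ v, Metric.thickening η (K v) with hU
  have hUo : IsOpen U := isOpen_iUnion fun v => Metric.isOpen_thickening
  have hKU : (⋃ v, K v) ⊆ U := Set.iUnion_mono fun v => Metric.self_subset_thickening hη0 _
  have ev3 : ∀ᶠ n in Filter.atTop, ∀ v w, v ≠ w →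
      Disjoint (gridNbhd n (K' v)) (gridNbhd n (K' w)) := by
    simp only [Filter.eventually_all]
    exact fun v w h => eventually_disjoint_gridNbhd (hK'c v) (hK'c w) (h1 v w h)
  have ev4 : ∀ᶠ n in Filter.atTop, ∀ e v, v ≠ s e → v ≠ t e →
      Disjoint (gridNbhd n (A e)) (gridNbhd n (K' v)) := by
    simp only [Filter.eventually_all]
    exact fun e v h h' => eventually_disjoint_gridNbhd (hAc e) (hK'c v)
      ((h2 e v h h').mono_left (Metric.self_subset_cthickening _))
  have ev5 : ∀ᶠ n in Filter.atTop, ∀ e e', e ≠ e' →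
      Disjoint (gridNbhd n (A e \ U)) (gridNbhd n (A e' \ U)) := by
    simp only [Filter.eventually_all]
    intro e e' h
    refine eventually_disjoint_gridNbhd ((hAc e).diff hUo) ((hAc e').diff hUo) ?_
    rw [Set.disjoint_left]
    exact fun x hx hx' => hx.2 (hKU (hAA e e' h ⟨hx.1, hx'.1⟩))
  obtain ⟨n, h3, h4, h5⟩ := (ev3.and (ev4.and ev5)).exists
  have hmeet : ∀ e v, (A e ∩ K v).Nonempty → (gridNbhd n (A e) ∩ gridNbhd n (K' v)).Nonempty := by
    rintro e v ⟨x, hxA, hxK⟩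
    obtain ⟨p, hp⟩ := exists_mem_gridBox n x
    exact ⟨p, ⟨x, hxA, hp⟩, ⟨x, Metric.self_subset_cthickening _ hxK, hp⟩⟩
  have hMM : ∀ e e' p, p ∈ gridNbhd n (A e) → p ∈ gridNbhd n (A e') →
      e = e' ∨ ∃ v, p ∈ gridNbhd n (K' v) := by
    rintro e e' p ⟨x, hx, hxp⟩ ⟨y, hy, hyp⟩
    by_contra! hc
    have aux : ∀ z ∈ gridBox n p, z ∉ U := by
      intro z hz hzU
      obtain ⟨v, hv⟩ := Set.mem_iUnion.1 hzU
      exact hc.2 v ⟨z, Metric.thickening_subset_cthickening _ _ hv, hz⟩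
    exact Set.disjoint_left.1 (h5 e e' hc.1) ⟨x, ⟨hx, aux x hxp⟩, hxp⟩ ⟨y, ⟨hy, aux y hyp⟩, hyp⟩
  obtain ⟨N', ω, hfin, hne, hconn, hdisj, hω⟩ := exists_gridMinor
    (N := fun v => gridNbhd n (K' v)) (M := fun e => gridNbhd n (A e)) hst
    (fun v => finite_gridNbhd n (hK'c v)) (fun e => finite_gridNbhd n (hAc e))
    (fun v => gridNbhd_nonempty n ((hKp v).nonempty.mono (Metric.self_subset_cthickening _)))
    (fun v => ((hKp v).isPreconnected.cthickening (hKc v) hη0.le).gridConnected_gridNbhd n)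
    (fun e => (hAp e).gridConnected_gridNbhd n)
    (fun v w x hv hw => by_contra fun h => Set.disjoint_left.1 (h3 v w h) hv hw)
    (fun e v x he hv => by
      by_contra! hc
      exact Set.disjoint_left.1 (h4 e v hc.1 hc.2) he hv)
    hMM (fun e => hmeet e _ (hs e)) (fun e => hmeet e _ (ht e))
  exact hasDual_of_gridMinor hst hinj hfin hne hconn hdisj hω

theorem IsCurve.isCompact {c : Set Pt} (hc : IsCurve c) : IsCompact c := by
  obtain ⟨f, hf, -, rfl⟩ := hc
  exact isCompact_Icc.image_of_continuousOn hf

theorem IsCurve.isConnected {c : Set Pt} (hc : IsCurve c) : IsConnected c := by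
  obtain ⟨f, hf, -, rfl⟩ := hc
  exact (isConnected_Icc zero_le_one).image f hf

/-- A curve meeting a set and a compact set contains an arc from the first one to the second one
that meets the second one only once. -/
theorem IsCurve.exists_arc {c X Y : Set Pt} (hc : IsCurve c) (hY : IsCompact Y)
    (hcX : (c ∩ X).Nonempty) (hcY : (c ∩ Y).Nonempty) :
    ∃ D ⊆ c, IsCompact D ∧ IsPreconnected D ∧ (D ∩ X).Nonempty ∧ ∃ y, D ∩ Y = {y} := by
  obtain ⟨g, hg, -, rfl⟩ := hc
  obtain ⟨_, ⟨u, hu, rfl⟩, huX⟩ := hcX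
  obtain ⟨_, ⟨w, hw, rfl⟩, hwY⟩ := hcY
  have hZ : IsCompact (Icc (0 : ℝ) 1 ∩ g ⁻¹' Y) :=
    isCompact_Icc.of_isClosed_subset (hg.preimage_isClosed_of_isClosed isClosed_Icc hY.isClosed)
      inter_subset_left
  obtain ⟨v, ⟨hv, hvY⟩, hmin⟩ := hZ.exists_isMinOn ⟨w, hw, hwY⟩
    (f := fun v => |u - v|) (by fun_prop)
  have hsub : uIcc u v ⊆ Icc 0 1 := uIcc_subset_Icc hu hv
  refine ⟨g '' uIcc u v, image_mono hsub, isCompact_uIcc.image_of_continuousOn (hg.mono hsub),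
    isPreconnected_uIcc.image _ (hg.mono hsub), ⟨g u, mem_image_of_mem g left_mem_uIcc, huX⟩,
    g v, ?_⟩
  refine Subset.antisymm ?_ (by rintro _ rfl; exact ⟨mem_image_of_mem g right_mem_uIcc, hvY⟩)
  rintro _ ⟨⟨z, hz, rfl⟩, hzY⟩
  have h1 : |u - v| ≤ |u - z| := hmin ⟨hsub hz, hzY⟩
  have h2 : z = v := by
    rcases mem_uIcc.1 hz with ⟨h3, h4⟩ | ⟨h3, h4⟩
    · rw [abs_of_nonpos (by linarith), abs_of_nonpos (by linarith)] at h1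
      linarith
    · rw [abs_of_nonneg (by linarith), abs_of_nonneg (by linarith)] at h1
      linarith
  rw [h2, mem_singleton_iff]

/-- Pairwise disjoint curves, each joining two curves of a family of pairwise disjoint curves. -/
theorem card_le_three_mul_of_disjoint {V E : Type*} [Fintype V] [Fintype E] {S : V → Set Pt}
    {c : E → Set Pt} {s t : E → V} (hS : ∀ i, IsCurve (S i)) (hc : ∀ e, IsCurve (c e))
    (hSS : ∀ i j, i ≠ j → Disjoint (S i) (S j)) (hcc : ∀ e e', e ≠ e' → Disjoint (c e) (c e'))
    (hst : ∀ e, s e ≠ t e) (hinj : Function.Injective fun e => s(s e, t e))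
    (hcS : ∀ e i, (c e ∩ S i).Nonempty ↔ i = s e ∨ i = t e) :
    Fintype.card E ≤ 3 * Fintype.card V := by
  refine (hasDual_of_planar S c hst hinj (fun i => (hS i).isCompact) (fun e => (hc e).isCompact)
    (fun i => (hS i).isConnected) (fun e => (hc e).isConnected.isPreconnected) hSS ?_ ?_
    (fun e => (hcS e _).2 (Or.inl rfl)) (fun e => (hcS e _).2 (Or.inr rfl))).card_le_three_mul
    hst hinj
  · intro e i h h'
    rw [disjoint_iff_inter_eq_empty, ← not_nonempty_iff_eq_empty, hcS, not_or]
    exact ⟨h, h'⟩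
  · intro e e' h
    rw [(hcc e e' h).inter_eq]
    exact empty_subset _

/-- Pairwise disjoint curves, each joining a red curve to a blue curve. -/
theorem card_le_two_mul_of_bicolored {R B E : Type*} [Fintype R] [Fintype B] [Fintype E]
    {red : R → Set Pt} {blue : B → Set Pt} {c : E → Set Pt} {r : E → R} {b : E → B}
    (hred : ∀ i, IsCurve (red i)) (hblue : ∀ j, IsCurve (blue j)) (hc : ∀ e, IsCurve (c e))
    (hrr : ∀ i j, i ≠ j → Disjoint (red i) (red j))
    (hbb : ∀ i j, i ≠ j → Disjoint (blue i) (blue j))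
    (hrb : ∀ i j, (red i ∩ blue j).Subsingleton)
    (hcr : ∀ e i, (c e ∩ red i).Nonempty ↔ i = r e)
    (hcb : ∀ e j, (c e ∩ blue j).Nonempty ↔ j = b e)
    (hdisj : ∀ e, Disjoint (red (r e)) (blue (b e)))
    (hcc : ∀ e e', e ≠ e' → Disjoint (c e) (c e'))
    (hinj : ∀ e e', r e = r e' → b e = b e' → e = e') :
    Fintype.card E ≤ 2 * Fintype.card R + 2 * Fintype.card B := by
  classical
  have hD : ∀ e, ∃ D ⊆ c e, IsCompact D ∧ IsPreconnected D ∧ (D ∩ red (r e)).Nonempty ∧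
      ∃ y, D ∩ blue (b e) = {y} := fun e =>
    (hc e).exists_arc (hblue _).isCompact ((hcr e _).2 rfl) ((hcb e _).2 rfl)
  choose D hDc hDcomp hDconn hDr y hy using hD
  choose f hfc hfi hfe using hblue
  have hτ : ∀ e, ∃ τ ∈ Icc (0 : ℝ) 1, f (b e) τ = y e := by
    intro e
    have : y e ∈ blue (b e) := (Set.ext_iff.1 (hy e) _).2 rfl |>.2
    rw [hfe] at this
    exact this
  choose τ hτ01 hτy using hτ
  have hDτ : ∀ e, f (b e) (τ e) ∈ D e := fun e => by
    rw [hτy]; exact ((Set.ext_iff.1 (hy e) _).2 rfl).1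
  have hDb : ∀ e j x, x ∈ D e → x ∈ blue j → b e = j ∧ x = f (b e) (τ e) := by
    intro e j x hx hj
    obtain rfl := (hcb e j).1 ⟨x, hDc e hx, hj⟩
    refine ⟨rfl, ?_⟩
    rw [hτy]
    exact (Set.ext_iff.1 (hy e) _).1 ⟨hx, hj⟩
  have hmem : ∀ j, ∀ s ∈ Icc (0 : ℝ) 1, f j s ∈ blue j := fun j s hs => by
    rw [hfe]; exact mem_image_of_mem _ hs
  -- the parameters at which a blue curve crosses a red one
  let X : B → Set ℝ := fun j => {s | s ∈ Icc (0 : ℝ) 1 ∧ ∃ i, f j s ∈ red i}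
  have hXc : ∀ j, IsCompact (X j) := by
    intro j
    have h1 : IsClosed (⋃ i, red i) :=
      isClosed_iUnion_of_finite fun i => (hred i).isCompact.isClosed
    have h2 : X j = Icc 0 1 ∩ f j ⁻¹' ⋃ i, red i := by
      ext s; simp [X]
    rw [h2]
    exact isCompact_Icc.of_isClosed_subset
      ((hfc j).preimage_isClosed_of_isClosed isClosed_Icc h1) inter_subset_left
  have hτX : ∀ e, τ e ∉ X (b e) := by
    rintro e ⟨-, i, hi⟩
    obtain rfl := (hcr e i).1 ⟨_, hDc e (hDτ e), hi⟩
    exact Set.disjoint_left.1 (hdisj e) hi (hmem _ _ (hτ01 e))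
  -- the piece of a blue curve, cut at its crossings, that contains the end of an arc
  let key : E → B × Set ℝ := fun e => (b e, {s | s ∈ X (b e) ∧ s < τ e})
  have hkey : ∀ e e', b e = b e' → (∀ s ∈ uIcc (τ e) (τ e'), s ∉ X (b e)) → key e = key e' := by
    intro e e' hb h
    refine Prod.ext hb ?_
    ext s
    change s ∈ X (b e) ∧ s < τ e ↔ s ∈ X (b e') ∧ s < τ e'
    rw [← hb]
    refine and_congr_right fun hs => ⟨fun h1 => ?_, fun h1 => ?_⟩ <;> by_contra! h2
    · exact h s (mem_uIcc.2 (Or.inr ⟨h2, h1.le⟩)) hs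
    · exact h s (mem_uIcc.2 (Or.inl ⟨h2, h1.le⟩)) hs
  have hkey' : ∀ e e', key e = key e' → ∀ s ∈ uIcc (τ e) (τ e'), s ∉ X (b e) := by
    intro e e' h s hs hsX
    have hb : b e = b e' := congrArg Prod.fst h
    have h1 : s ∈ X (b e) ∧ s < τ e ↔ s ∈ X (b e') ∧ s < τ e' :=
      Set.ext_iff.1 (congrArg Prod.snd h) s
    have hne : s ≠ τ e := fun h => hτX e (h ▸ hsX)
    have hne' : s ≠ τ e' := fun h => hτX e' (h ▸ hb ▸ hsX)
    rw [← hb] at h1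
    simp only [hsX, true_and] at h1
    rcases mem_uIcc.1 hs with ⟨h2, h3⟩ | ⟨h2, h3⟩
    · exact absurd (h1.2 (lt_of_le_of_ne h3 hne')) (not_lt.2 h2)
    · exact absurd (h1.1 (lt_of_le_of_ne h3 hne)) (not_lt.2 h2)
  let P : Type _ := Set.range key
  have hk0 : ∀ p : P, ∃ e, key e = p ∧ ∀ e', key e' = p → τ e ≤ τ e' := by
    rintro ⟨_, e, rfl⟩
    obtain ⟨e₀, h1, h2⟩ := Set.exists_min_image {e' | key e' = key e} τ (Set.toFinite _) ⟨e, rfl⟩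
    exact ⟨e₀, h1, h2⟩
  have hk1 : ∀ p : P, ∃ e, key e = p ∧ ∀ e', key e' = p → τ e' ≤ τ e := by
    rintro ⟨_, e, rfl⟩
    obtain ⟨e₀, h1, h2⟩ := Set.exists_max_image {e' | key e' = key e} τ (Set.toFinite _) ⟨e, rfl⟩
    exact ⟨e₀, h1, h2⟩
  choose k0 hk0 hmin using hk0
  choose k1 hk1 hmax using hk1
  have hbp : ∀ e (p : P), key e = p → b e = p.1.1 := fun e p h => congrArg Prod.fst h
  let J : P → Set ℝ := fun p => Icc (τ (k0 p)) (τ (k1 p))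
  have hJ : ∀ e (p : P), key e = p → τ e ∈ J p := fun e p h => ⟨hmin p e h, hmax p e h⟩
  have hJ01 : ∀ p, J p ⊆ Icc 0 1 := fun p => Icc_subset_Icc (hτ01 _).1 (hτ01 _).2
  have hJX : ∀ p, ∀ s ∈ J p, s ∉ X p.1.1 := fun p s hs => by
    rw [← hbp _ p (hk0 p)]
    exact hkey' (k0 p) (k1 p) ((hk0 p).trans (hk1 p).symm) s (Icc_subset_uIcc hs)
  have hJkey : ∀ (p : P) e s, b e = p.1.1 → s ∈ J p → (∀ z ∈ uIcc s (τ e), z ∉ X p.1.1) →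
      key e = p := by
    intro p e s hb hs h
    rw [← hk0 p]
    refine (hkey _ _ ((hbp _ p (hk0 p)).trans hb.symm) fun z hz => ?_).symm
    rw [hbp _ p (hk0 p)]
    rcases uIcc_subset_uIcc_union_uIcc (b := s) hz with hz | hz
    · rw [uIcc_of_le hs.1] at hz
      exact hJX p z ⟨hz.1, hz.2.trans hs.2⟩
    · exact h z hz
  let u : P × Bool → E := fun x => if x.2 then k1 x.1 else k0 x.1
  have hu : ∀ x, key (u x) = x.1 := by
    rintro ⟨p, _ | _⟩
    · exact hk0 p
    · exact hk1 p
  have hub : ∀ x, b (u x) = x.1.1.1 := fun x => hbp _ _ (hu x)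
  let far : P × Bool → ℝ → Prop := fun x s =>
    (x.2 = true ∧ τ (u x) < s) ∨ (x.2 = false ∧ s < τ (u x))
  let Q : Type _ := {x : P × Bool // ∃ s ∈ X x.1.1.1, far x s}
  have hQ : ∀ x : Q, ∃ t ∈ X x.1.1.1.1, far x.1 t ∧ ∀ s ∈ uIcc (τ (u x.1)) t,
      s ∈ X x.1.1.1.1 → s = t := by
    rintro ⟨x, s, hs, ⟨hx, hfar⟩ | ⟨hx, hfar⟩⟩
    · obtain ⟨t, ht, hl⟩ := ((hXc x.1.1.1).inter_right isClosed_Ici).exists_isLeast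
        ⟨s, hs, mem_Ici.2 hfar.le⟩
      have hlt : τ (u x) < t := lt_of_le_of_ne ht.2 fun h => hτX (u x) (by
        rw [h, hub]; exact ht.1)
      refine ⟨t, ht.1, Or.inl ⟨hx, hlt⟩, fun z hz hzX => ?_⟩
      rw [uIcc_of_le hlt.le] at hz
      exact le_antisymm hz.2 (hl ⟨hzX, hz.1⟩)
    · obtain ⟨t, ht, hl⟩ := ((hXc x.1.1.1).inter_right isClosed_Iic).exists_isGreatest
        ⟨s, hs, mem_Iic.2 hfar.le⟩
      have hlt : t < τ (u x) := lt_of_le_of_ne ht.2 fun h => hτX (u x) (by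
        rw [← h, hub]; exact ht.1)
      refine ⟨t, ht.1, Or.inr ⟨hx, hlt⟩, fun z hz hzX => ?_⟩
      rw [uIcc_of_ge hlt.le] at hz
      exact le_antisymm (hl ⟨hzX, hz.2⟩) hz.1
  choose t htX hfar htu using hQ
  have ht' : ∀ x : Q, ∃ i, f x.1.1.1.1 (t x) ∈ red i := fun x => (htX x).2
  choose ρ hρ using ht'
  let I : Q → Set ℝ := fun x => uIcc (τ (u x.1)) (t x)
  have hI01 : ∀ x, I x ⊆ Icc 0 1 := fun x => uIcc_subset_Icc (hτ01 _) (htX x).1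
  -- a point of an arc that is not a crossing belongs to the same piece as the arc
  have hI : ∀ x, ∀ s ∈ I x, s ∉ X x.1.1.1.1 → ∀ z ∈ uIcc s (τ (u x.1)), z ∉ X x.1.1.1.1 := by
    intro x s hs hsX z hz hzX
    have hz' : z ∈ I x := uIcc_subset_uIcc hs left_mem_uIcc hz
    obtain rfl : z = t x := htu x z hz' hzX
    have hst : s ≠ t x := fun h => hsX (h ▸ hzX)
    apply hst
    change s ∈ uIcc _ _ at hs
    rw [mem_uIcc] at hs hz
    rcases hs with hs | hs <;> rcases hz with hz | hz <;> linarith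
  let sE : E ⊕ Q → R ⊕ P := Sum.elim (fun e => Sum.inl (r e)) fun x => Sum.inl (ρ x)
  let tE : E ⊕ Q → R ⊕ P := Sum.elim (fun e => Sum.inr ⟨key e, e, rfl⟩) fun x => Sum.inr x.1.1
  let K : R ⊕ P → Set Pt := Sum.elim red fun p => f p.1.1 '' J p
  let A : E ⊕ Q → Set Pt := Sum.elim D fun x => f x.1.1.1.1 '' I x
  have hft : ∀ j s s', s ∈ Icc (0 : ℝ) 1 → s' ∈ Icc (0 : ℝ) 1 → f j s = f j s' → s = s' :=
    fun j s s' h h' e => hfi j h h' e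
  have hff : ∀ j j' s s', s ∈ Icc (0 : ℝ) 1 → s' ∈ Icc (0 : ℝ) 1 → f j s = f j' s' → j = j' := by
    intro j j' s s' h h' e
    by_contra hne
    exact Set.disjoint_left.1 (hbb j j' hne) (hmem j s h) (e ▸ hmem j' s' h')
  have hst : ∀ e, sE e ≠ tE e := by
    rintro (e | x) <;> simp [sE, tE]
  have hinj' : Function.Injective fun e => s(sE e, tE e) := by
    have hx : ∀ (e : E) (x : Q), r e = ρ x → key e = x.1.1 → False := by
      intro e x h1 h2
      have h3 := hρ x
      rw [← h1, ← hbp e _ h2] at h3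
      exact Set.disjoint_left.1 (hdisj e) h3 (hmem _ _ (htX x).1)
    rintro (e | x) (e' | x') h
    · simp only [sE, tE, Sum.elim_inl, Sym2.eq_iff, Sum.inl.injEq, Sum.inr.injEq, reduceCtorEq,
        and_self, or_false] at h
      rw [hinj e e' h.1 (congrArg (fun p : P => p.1.1) h.2)]
    · simp only [sE, tE, Sum.elim_inl, Sum.elim_inr, Sym2.eq_iff, Sum.inl.injEq, Sum.inr.injEq,
        reduceCtorEq, and_self, or_false] at h
      exact (hx e x' h.1 (congrArg Subtype.val h.2)).elim
    · simp only [sE, tE, Sum.elim_inl, Sum.elim_inr, Sym2.eq_iff, Sum.inl.injEq, Sum.inr.injEq,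
        reduceCtorEq, and_self, or_false] at h
      exact (hx e' x h.1.symm (congrArg Subtype.val h.2).symm).elim
    · simp only [sE, tE, Sum.elim_inr, Sym2.eq_iff, Sum.inl.injEq, Sum.inr.injEq,
        reduceCtorEq, and_self, or_false] at h
      obtain ⟨h1, h2⟩ := h
      have h3 : t x = t x' := by
        refine hft x.1.1.1.1 _ _ (htX x).1 (htX x').1 (hrb (ρ x) x.1.1.1.1 ?_ ?_)
        · exact ⟨hρ x, hmem _ _ (htX x).1⟩
        · rw [h1, h2]
          exact ⟨hρ x', hmem _ _ (htX x').1⟩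
      have hfx := hfar x
      have hfx' := hfar x'
      have hJx := hJ _ _ (hu x.1)
      have hJx' := hJ _ _ (hu x'.1)
      obtain ⟨⟨p, d⟩, hp⟩ := x
      obtain ⟨⟨p', d'⟩, hp'⟩ := x'
      obtain rfl : p = p' := h2
      suffices d = d' by subst this; rfl
      cases d <;> cases d' <;> simp [far, u, h3] at hfx hfx' ⊢
      · exact absurd (hfx.trans_le (hmin p _ (hk1 p))) (not_lt.2 hfx'.le)
      · exact absurd (hfx'.trans_le (hmin p _ (hk1 p))) (not_lt.2 hfx.le)
  have hdual : HasDual sE tE := by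
    refine hasDual_of_planar K A hst hinj' ?_ ?_ ?_ ?_ ?_ ?_ ?_ ?_ ?_
    · rintro (i | p)
      · exact (hred i).isCompact
      · exact isCompact_Icc.image_of_continuousOn ((hfc _).mono (hJ01 p))
    · rintro (e | x)
      · exact hDcomp e
      · exact isCompact_uIcc.image_of_continuousOn ((hfc _).mono (hI01 x))
    · rintro (i | p)
      · exact (hred i).isConnected
      · exact (isConnected_Icc (hmin p _ (hk1 p))).image _ ((hfc _).mono (hJ01 p))
    · rintro (e | x)
      · exact hDconn e
      · exact isPreconnected_uIcc.image _ ((hfc _).mono (hI01 x))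
    · have hx : ∀ i p, Disjoint (red i) (f p.1.1 '' J p) := by
        intro i p
        rw [Set.disjoint_left]
        rintro _ hi ⟨s, hs, rfl⟩
        exact hJX p s hs ⟨hJ01 p hs, i, hi⟩
      rintro (i | p) (j | q) h
      · exact hrr i j fun h' => h (h' ▸ rfl)
      · exact hx i q
      · exact (hx j p).symm
      · change Disjoint (f p.1.1 '' J p) (f q.1.1 '' J q)
        rw [Set.disjoint_left]
        rintro _ ⟨s, hs, rfl⟩ ⟨s', hs', he⟩
        have hpq := hff _ _ _ _ (hJ01 p hs) (hJ01 q hs') he.symm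
        rw [hpq] at he
        obtain rfl := hft _ _ _ (hJ01 q hs') (hJ01 p hs) he
        apply h
        congr 1
        refine Subtype.ext ?_
        rw [← hk0 p]
        refine hJkey q _ s' ((hbp _ p (hk0 p)).trans hpq) hs' fun z hz => ?_
        rw [uIcc_of_ge hs.1] at hz
        rw [← hpq]
        exact hJX p z ⟨hz.1, hz.2.trans hs.2⟩
    · rintro (e | x) (i | p) h1 h2
      · change Disjoint (D e) (red i)
        rw [Set.disjoint_left]
        intro z hz hzi
        exact h1 (congrArg Sum.inl ((hcr e i).1 ⟨z, hDc e hz, hzi⟩))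
      · change Disjoint (D e) (f p.1.1 '' J p)
        rw [Set.disjoint_left]
        rintro _ hz ⟨s, hs, rfl⟩
        obtain ⟨hb, he⟩ := hDb e _ _ hz (hmem _ _ (hJ01 p hs))
        rw [hb] at he
        obtain rfl := hft _ _ _ (hJ01 p hs) (hτ01 e) he
        apply h2
        refine congrArg Sum.inr (Subtype.ext (hJkey p e _ hb hs fun z hz => ?_).symm)
        rw [uIcc_self, mem_singleton_iff] at hz
        rw [hz]
        exact hJX p _ hs
      · change Disjoint (f x.1.1.1.1 '' I x) (red i)
        rw [Set.disjoint_left]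
        rintro _ ⟨s, hs, rfl⟩ hi
        obtain rfl := htu x s hs ⟨hI01 x hs, i, hi⟩
        by_contra
        exact Set.disjoint_left.1 (hrr i (ρ x) fun h => h1 (congrArg Sum.inl h)) hi (hρ x)
      · change Disjoint (f x.1.1.1.1 '' I x) (f p.1.1 '' J p)
        rw [Set.disjoint_left]
        rintro _ ⟨s, hs, rfl⟩ ⟨s', hs', he⟩
        have hpq := hff _ _ _ _ (hJ01 p hs') (hI01 x hs) he
        rw [hpq] at he
        obtain rfl := hft _ _ _ (hJ01 p hs') (hI01 x hs) he
        apply h2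
        refine congrArg Sum.inr (Subtype.ext ?_)
        rw [← hJkey p (u x.1) s' ((hub x.1).trans hpq.symm) hs' ?_]
        · exact hu x.1
        · rw [hpq]
          exact hI x s' hs (hpq ▸ hJX p s' hs')
    · have hx : ∀ e x, D e ∩ f x.1.1.1.1 '' I x ⊆ ⋃ v, K v := by
        rintro e x _ ⟨hz, s, hs, rfl⟩
        obtain ⟨hb, he⟩ := hDb e _ _ hz (hmem _ _ (hI01 x hs))
        rw [he]
        exact mem_iUnion.2 ⟨Sum.inr ⟨key e, e, rfl⟩,
          mem_image_of_mem _ (hJ e ⟨key e, e, rfl⟩ rfl)⟩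
      rintro (e | x) (e' | x') h
      · change D e ∩ D e' ⊆ _
        rw [((hcc e e' fun h' => h (h' ▸ rfl)).mono (hDc e) (hDc e')).inter_eq]
        exact empty_subset _
      · exact hx e x'
      · rw [inter_comm]
        exact hx e' x
      · rintro _ ⟨⟨s, hs, rfl⟩, s', hs', he⟩
        have hpq := hff _ _ _ _ (hI01 x' hs') (hI01 x hs) he
        rw [hpq] at he
        obtain rfl := hft _ _ _ (hI01 x' hs') (hI01 x hs) he
        by_cases hsX : s' ∈ X x.1.1.1.1
        · obtain ⟨i, hi⟩ := hsX.2
          exact mem_iUnion.2 ⟨Sum.inl i, hi⟩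
        · have h1 : key (u x.1) = key (u x'.1) := by
            refine hkey _ _ (by rw [hub, hub, hpq]) fun z hz => ?_
            rw [hub]
            rcases uIcc_subset_uIcc_union_uIcc (b := s') hz with hz | hz
            · rw [uIcc_comm] at hz
              exact hI x s' hs hsX z hz
            · rw [← hpq]
              exact hI x' s' hs' (hpq ▸ hsX) z hz
          have h2 : x.1.1 = x'.1.1 := Subtype.ext ((hu x.1).symm.trans (h1.trans (hu x'.1)))
          refine mem_iUnion.2 ⟨Sum.inr x.1.1, mem_image_of_mem _ ?_⟩
          have hfx := hfar x
          have hfx' := hfar x'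
          change s' ∈ uIcc _ _ at hs hs'
          rw [mem_uIcc] at hs hs'
          obtain ⟨⟨p, d⟩, hp⟩ := x
          obtain ⟨⟨p', d'⟩, hp'⟩ := x'
          obtain rfl : p = p' := h2
          have hle := hmin p _ (hk1 p)
          cases d <;> cases d' <;> simp [far, u] at hfx hfx' hs hs' h
          · constructor <;> rcases hs with hs | hs <;> rcases hs' with hs' | hs' <;> linarith
          · constructor <;> rcases hs with hs | hs <;> rcases hs' with hs' | hs' <;> linarith
    · rintro (e | x)
      · exact hDr e
      · exact ⟨_, mem_image_of_mem _ right_mem_uIcc, hρ x⟩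
    · rintro (e | x)
      · refine ⟨_, hDτ e, ?_⟩
        exact mem_image_of_mem _ (hJ e ⟨key e, e, rfl⟩ rfl)
      · exact ⟨_, mem_image_of_mem _ left_mem_uIcc, mem_image_of_mem _ (hJ _ _ (hu x.1))⟩
  have h1 := hdual.card_le_two_mul hinj' (Sum.elim (fun _ => true) fun _ => false)
    (by rintro (e | x) <;> simp [sE, tE])
  have h2 : Fintype.card {x : P × Bool // ¬ ∃ s ∈ X x.1.1.1, far x s} ≤
      Fintype.card (B × Bool) := by
    refine Fintype.card_le_of_injective (fun x => (x.1.1.1.1, x.1.2)) ?_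
    rintro ⟨⟨p, d⟩, hp⟩ ⟨⟨p', d'⟩, hp'⟩ h
    obtain ⟨hb, rfl⟩ : p.1.1 = p'.1.1 ∧ d = d' := by simpa using h
    suffices p = p' by subst this; rfl
    refine Subtype.ext ?_
    rw [← hu (p, d), ← hu (p', d)]
    refine hkey _ _ (by rw [hub, hub, hb]) fun z hz hzX => ?_
    rw [hub] at hzX
    push Not at hp hp'
    have h3 := hp z hzX
    have h4 := hp' z (hb ▸ hzX)
    have h5 : z ≠ τ (u (p, d)) := fun h => hτX (u (p, d)) (by rw [← h, hub]; exact hzX)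
    have h6 : z ≠ τ (u (p', d)) := fun h => hτX (u (p', d)) (by rw [← h, hub, ← hb]; exact hzX)
    rw [mem_uIcc] at hz
    cases d <;> simp only [far, Bool.false_eq_true, false_and, true_and, false_or, or_false,
      reduceCtorEq, not_lt] at h3 h4
    · rcases hz with hz | hz
      · exact h6 (le_antisymm hz.2 h4)
      · exact h5 (le_antisymm hz.2 h3)
    · rcases hz with hz | hz
      · exact h5 (le_antisymm h3 hz.1)
      · exact h6 (le_antisymm h4 hz.1)
  have h3 := Fintype.card_subtype_compl fun x : P × Bool => ∃ s ∈ X x.1.1.1, far x s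
  have h4 := Fintype.card_subtype_le fun x : P × Bool => ∃ s ∈ X x.1.1.1, far x s
  have h5 : Fintype.card {x : P × Bool // ∃ s ∈ X x.1.1.1, far x s} = Fintype.card Q := rfl
  simp only [Fintype.card_sum, Fintype.card_prod, Fintype.card_bool] at h1 h2 h3 h4
  omega

theorem stmt1 (n m : ℕ) (S : Fin n → Set Pt) (color : Fin n → Bool) (C : Fin m → Set Pt)
    (hScurve : ∀ i, IsPolygonalCurve (S i))
    (hCcurve : ∀ k, IsPolygonalCurve (C k))
    (hSinj : Function.Injective S)
    -- every pair of curves of `S` intersects in at most one point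
    (h1int : ∀ i j : Fin n, i ≠ j → (S i ∩ S j).Subsingleton)
    -- no two curves of the same color intersect
    (hsame : ∀ i j : Fin n, i ≠ j → color i = color j → Disjoint (S i) (S j))
    -- every pair of curves intersects in finitely many points
    (hSCfin : ∀ i k, (S i ∩ C k).Finite)
    -- no point belongs to more than two of the curves considered
    (htriple : ∀ p : Pt, ({x : Fin n ⊕ Fin m | p ∈ Sum.elim S C x}).encard ≤ 2)
    -- the curves of `C` are pairwise disjoint
    (hCdisj : ∀ k l : Fin m, k ≠ l → Disjoint (C k) (C l))
    -- each `c ∈ C` intersects exactly two members of `S`, and they are disjoint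
    (htwo : ∀ k : Fin m, ∃ i j : Fin n, i ≠ j ∧ (C k ∩ S i).Nonempty ∧ (C k ∩ S j).Nonempty ∧
      Disjoint (S i) (S j) ∧ ∀ l : Fin n, (C k ∩ S l).Nonempty → l = i ∨ l = j)
    -- distinct members of `C` intersect distinct pairs of members of `S`
    (hdist : ∀ k l : Fin m, k ≠ l →
      {i : Fin n | (C k ∩ S i).Nonempty} ≠ {i : Fin n | (C l ∩ S i).Nonempty}) :
    m ≤ 11 * n - 11 := by
  choose i j hij hi hj hdis hl using htwo
  have hmeet : ∀ k l, (C k ∩ S l).Nonempty ↔ l = i k ∨ l = j k := fun k l =>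
    ⟨hl k l, by rintro (rfl | rfl); exacts [hi k, hj k]⟩
  have hpair : ∀ k l, s(i k, j k) = s(i l, j l) → k = l := by
    intro k l h
    by_contra hkl
    refine hdist k l hkl (Set.ext fun x => ?_)
    rw [mem_ofPred_eq, mem_ofPred_eq, hmeet, hmeet, ← Sym2.mem_iff, h, Sym2.mem_iff]
  have hmono : ∀ c : Bool, Fintype.card {k // color (i k) = c ∧ color (j k) = c} ≤
      3 * Fintype.card {x // color x = c} := by
    intro c
    refine card_le_three_mul_of_disjoint (S := fun x : {x // color x = c} => S x)
      (c := fun k : {k // color (i k) = c ∧ color (j k) = c} => C k)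
      (s := fun k => ⟨i k, k.2.1⟩) (t := fun k => ⟨j k, k.2.2⟩)
      (fun x => (hScurve x).1) (fun k => (hCcurve k).1)
      (fun x y h => hsame x y (Subtype.coe_injective.ne h) (x.2.trans y.2.symm))
      (fun k l h => hCdisj k l (Subtype.coe_injective.ne h))
      (fun k h => hij k (congrArg Subtype.val h)) ?_ ?_
    · intro k l h
      exact Subtype.ext (hpair k l (congrArg (Sym2.map Subtype.val) h))
    · intro k x
      rw [hmeet, Subtype.ext_iff, Subtype.ext_iff]
  have hex : ∀ k : {k // color (i k) ≠ color (j k)}, ∃ x y, color x = true ∧ color y = false ∧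
      s(i k, j k) = s(x, y) := by
    rintro ⟨k, hk⟩
    cases h : color (i k)
    · exact ⟨j k, i k, Bool.eq_true_of_not_eq_false fun h' => hk (h.trans h'.symm), h, Sym2.eq_swap⟩
    · exact ⟨i k, j k, h, Bool.eq_false_of_not_eq_true fun h' => hk (h.trans h'.symm), rfl⟩
  choose r b hr hb hrb using hex
  have hmeet' : ∀ (k : {k // color (i k) ≠ color (j k)}) l,
      (C k ∩ S l).Nonempty ↔ l = r k ∨ l = b k := fun k l => by
    rw [hmeet, ← Sym2.mem_iff, hrb, Sym2.mem_iff]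
  have hbi : Fintype.card {k // color (i k) ≠ color (j k)} ≤
      2 * Fintype.card {x // color x = true} + 2 * Fintype.card {x // color x = false} := by
    refine card_le_two_mul_of_bicolored (red := fun x : {x // color x = true} => S x)
      (blue := fun x : {x // color x = false} => S x)
      (c := fun k : {k // color (i k) ≠ color (j k)} => C k)
      (r := fun k => ⟨r k, hr k⟩) (b := fun k => ⟨b k, hb k⟩)
      (fun x => (hScurve x).1) (fun x => (hScurve x).1) (fun k => (hCcurve k).1)
      (fun x y h => hsame x y (Subtype.coe_injective.ne h) (x.2.trans y.2.symm))
      (fun x y h => hsame x y (Subtype.coe_injective.ne h) (x.2.trans y.2.symm))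
      (fun x y => h1int x y fun h => ?_) ?_ ?_ ?_
      (fun k l h => hCdisj k l (Subtype.coe_injective.ne h)) ?_
    · exact Bool.false_ne_true (y.2.symm.trans ((congrArg color h).symm.trans x.2))
    · intro k x
      rw [hmeet', Subtype.ext_iff, or_iff_left]
      intro h
      exact Bool.false_ne_true ((hb k).symm.trans ((congrArg color h).symm.trans x.2))
    · intro k x
      rw [hmeet', Subtype.ext_iff, or_iff_right]
      intro h
      exact Bool.false_ne_true (x.2.symm.trans ((congrArg color h).trans (hr k)))
    · intro k
      change Disjoint (S (r k)) (S (b k))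
      rcases Sym2.eq_iff.1 (hrb k) with ⟨h1, h2⟩ | ⟨h1, h2⟩
      · rw [← h1, ← h2]; exact hdis k
      · rw [← h1, ← h2]; exact (hdis k).symm
    · intro k l h1 h2
      refine Subtype.ext (hpair k l ?_)
      rw [hrb, hrb, Subtype.mk.inj h1, Subtype.mk.inj h2]
  have hm : Fintype.card (Fin m) ≤ Fintype.card ({k // color (i k) = true ∧ color (j k) = true} ⊕
      {k // color (i k) = false ∧ color (j k) = false} ⊕ {k // color (i k) ≠ color (j k)}) := by
    refine Fintype.card_le_of_surjective
      (Sum.elim Subtype.val (Sum.elim Subtype.val Subtype.val)) fun k => ?_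
    cases h1 : color (i k) <;> cases h2 : color (j k)
    · exact ⟨Sum.inr (Sum.inl ⟨k, h1, h2⟩), rfl⟩
    · exact ⟨Sum.inr (Sum.inr ⟨k, by simp [h1, h2]⟩), rfl⟩
    · exact ⟨Sum.inr (Sum.inr ⟨k, by simp [h1, h2]⟩), rfl⟩
    · exact ⟨Sum.inl ⟨k, h1, h2⟩, rfl⟩
  have hn : Fintype.card ({x // color x = true} ⊕ {x // color x = false}) ≤
      Fintype.card (Fin n) := by
    refine Fintype.card_le_of_injective (Sum.elim Subtype.val Subtype.val)
      (Subtype.val_injective.sumElim Subtype.val_injective fun x y h => ?_)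
    exact Bool.false_ne_true (y.2.symm.trans ((congrArg color h).symm.trans x.2))
  rcases Nat.eq_zero_or_pos m with rfl | hm0
  · exact Nat.zero_le _
  have h1 := (i ⟨0, hm0⟩).isLt
  have h2 := (j ⟨0, hm0⟩).isLt
  have h3 := Fin.val_ne_of_ne (hij ⟨0, hm0⟩)
  have h4 := hmono true
  have h5 := hmono false
  simp only [Fintype.card_sum, Fintype.card_fin] at hm hn
  omega
end
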